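/- Let (R,𝔪) be a complete Noetherian local ring and M a finitely generated R-module of dimension d. The number of isomorphism classes of top local cohomology modules H^d_𝔞(M), as 𝔞 ranges over all ideals of R, equals 2^{|Assh M|}. -/

import Mathlib

noncomputable section
open CategoryTheory

namespace Paper

variable (R : Type) [CommRing R]

/-- The `i`-th local cohomology of the `R`-module `M` with respect to the ideal `I`. -/
abbrev H (I : Ideal R) (i : ℕ) (M : Type) [AddCommGroup M] [Module R M] : ModuleCat R :=
  (localCohomology I i).obj (ModuleCat.of R M)

/-- `N` is a `p`-secondary submodule of `M`: it is nonzero, every `r : R` acts on it either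
surjectively or nilpotently, and `p` is the radical of its annihilator. -/
def IsSecondaryFor {M : Type} [AddCommGroup M] [Module R M]
    (N : Submodule R M) (p : Ideal R) : Prop :=
  N ≠ ⊥ ∧
  (∀ r : R, (∀ m ∈ N, ∃ n ∈ N, r • n = m) ∨ (∃ k : ℕ, ∀ m ∈ N, r ^ k • m = 0)) ∧
  N.annihilator.radical = p

/-- A minimal secondary representation of the module `M`. -/
structure MinSecRep (M : Type) [AddCommGroup M] [Module R M] where
  n : ℕ
  S : Fin n → Submodule R M
  p : Fin n → Ideal R
  prime : ∀ i, (p i).IsPrime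
  sec : ∀ i, IsSecondaryFor R (S i) (p i)
  sum : (⨆ i, S i) = ⊤
  inj : Function.Injective p
  irred : ∀ j, ¬ (S j ≤ ⨆ i ∈ ({j}ᶜ : Set (Fin n)), S i)

/-- `M` is representable: it is a (finite) sum of secondary submodules. -/
def IsRepresentable (M : Type) [AddCommGroup M] [Module R M] : Prop :=
  ∃ (n : ℕ) (S : Fin n → Submodule R M) (p : Fin n → Ideal R),
    (∀ i, (p i).IsPrime) ∧ (∀ i, IsSecondaryFor R (S i) (p i)) ∧ (⨆ i, S i) = ⊤

/-- The set of attached primes of `M`: the primes occurring in a minimal secondary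
representation of `M`. -/
def attached (M : Type) [AddCommGroup M] [Module R M] : Set (Ideal R) :=
  {q | ∃ (rep : MinSecRep R M) (i : Fin rep.n), rep.p i = q}

/-- The coheight (dimension of `R/I`): Krull dimension of the set of primes containing `I`. -/
def coheight (I : Ideal R) : WithBot ℕ∞ :=
  Order.krullDim {p : Ideal R // p.IsPrime ∧ I ≤ p}

/-- The Krull dimension of the ring `R`. -/
def ringDim : WithBot ℕ∞ := Order.krullDim {p : Ideal R // p.IsPrime}

/-- The Krull dimension of (the support of) the finitely generated module `M`. -/
def dimMod (M : Type) [AddCommGroup M] [Module R M] : WithBot ℕ∞ :=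
  coheight R (Module.annihilator R M)

/-- The dimension of the localized module `M_q`: chains of primes in the support of `M`
contained in `q`. -/
def dimModAt (M : Type) [AddCommGroup M] [Module R M] (q : Ideal R) : WithBot ℕ∞ :=
  Order.krullDim {p : Ideal R // p.IsPrime ∧ Module.annihilator R M ≤ p ∧ p ≤ q}

/-- The support of a finitely generated module: primes containing the annihilator. -/
def supp (M : Type) [AddCommGroup M] [Module R M] : Set (Ideal R) :=
  {p | p.IsPrime ∧ Module.annihilator R M ≤ p}

/-- `Min M`: minimal primes of the support of `M`. -/
def minSupp (M : Type) [AddCommGroup M] [Module R M] : Set (Ideal R) :=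
  (Module.annihilator R M).minimalPrimes

/-- `Assh M`: primes in the support of maximal coheight. -/
def assh (M : Type) [AddCommGroup M] [Module R M] : Set (Ideal R) :=
  {p | p ∈ supp R M ∧ coheight R p = dimMod R M}

open RingTheory.Sequence in
/-- Depth of `M` with respect to the ideal `J`: supremum of the lengths of `M`-regular
sequences contained in `J`. -/
def depthOn (J : Ideal R) (M : Type) [AddCommGroup M] [Module R M] : ℕ∞ :=
  ⨆ l ∈ {l : List R | (∀ x ∈ l, x ∈ J) ∧ IsRegular M l}, (l.length : ℕ∞)

/-- `M` is a Cohen–Macaulay module over the local ring `R`: depth = dimension. -/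
def IsCMLocalMod [IsLocalRing R] (M : Type) [AddCommGroup M] [Module R M] : Prop :=
  (depthOn R (IsLocalRing.maximalIdeal R) M : WithBot ℕ∞) = dimMod R M

/-- `R` is a Cohen–Macaulay local ring: it is local and its depth (w.r.t. its Jacobson
radical, which is the maximal ideal) equals its Krull dimension. -/
def IsCMLocalRing : Prop :=
  IsLocalRing R ∧ ((depthOn R ((⊥ : Ideal R).jacobson) R : WithBot ℕ∞) = ringDim R)

/-- `R` is a Cohen–Macaulay ring: all of its localizations at primes are CM local rings. -/
def IsCMRing : Prop :=
  ∀ (p : Ideal R) [p.IsPrime], IsCMLocalRing (Localization.AtPrime p)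

/-- `M` is an equidimensional module: every minimal prime of its support has coheight equal
to the dimension of `M`. -/
def IsEquidim (M : Type) [AddCommGroup M] [Module R M] : Prop :=
  ∀ q ∈ minSupp R M, coheight R q = dimMod R M

/-- `R` is catenary: any two saturated chains of primes with the same endpoints have the
same length. -/
def IsCatenary : Prop :=
  ∀ (c₁ c₂ : LTSeries {p : Ideal R // p.IsPrime}),
    c₁.head = c₂.head → c₁.last = c₂.last →
    (∀ i : Fin c₁.length, c₁.toFun i.castSucc ⋖ c₁.toFun i.succ) →
    (∀ i : Fin c₂.length, c₂.toFun i.castSucc ⋖ c₂.toFun i.succ) →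
    c₁.length = c₂.length

/-- `R` is universally catenary: every finitely generated `R`-algebra is catenary. -/
def IsUnivCatenary : Prop :=
  ∀ (A : Type) [CommRing A] [Algebra R A], Algebra.FiniteType R A → IsCatenary A

/-- `x` is a uniform local cohomological annihilator of `M`: `x` avoids all minimal primes
of `M` and, for every maximal ideal `m`, kills `H^i_m(M)` for all `i < dim M_m`. -/
def IsULCA (M : Type) [AddCommGroup M] [Module R M] (x : R) : Prop :=
  (∀ p ∈ minSupp R M, x ∉ p) ∧
  ∀ (m : Ideal R), m.IsMaximal → ∀ i : ℕ, (i : WithBot ℕ∞) < dimModAt R M m →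
    ∀ y : H R m i M, x • y = 0

/-- `M` has a uniform local cohomological annihilator. -/
def HasULCA (M : Type) [AddCommGroup M] [Module R M] : Prop := ∃ x, IsULCA R M x

/-- `R/p` has a uniform local cohomological annihilator (local case): some `x ∉ p` kills
`H^i_𝔪(R/p)` for all `i < dim R/p`. -/
def HasULCAQuot [IsLocalRing R] (p : Ideal R) : Prop :=
  ∃ x ∉ p, ∀ i : ℕ, (i : WithBot ℕ∞) < coheight R p →
    ∀ y : H R (IsLocalRing.maximalIdeal R) i (R ⧸ p), x • y = 0

/-- `M` is generalized Cohen–Macaulay over the local ring `R`: a power of the maximal ideal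
kills all local cohomology below the dimension. -/
def IsGCM [IsLocalRing R] (M : Type) [AddCommGroup M] [Module R M] : Prop :=
  ∃ n : ℕ, ∀ i : ℕ, (i : WithBot ℕ∞) < dimMod R M →
    ∀ a ∈ (IsLocalRing.maximalIdeal R) ^ n,
      ∀ y : H R (IsLocalRing.maximalIdeal R) i M, a • y = 0

end Paper
open Paper in
/-- The setoid identifying ideals with isomorphic `d`-th local cohomology of `M`. -/
def Paper.topLCSetoid (R : Type) [CommRing R] (d : ℕ)
    (M : Type) [AddCommGroup M] [Module R M] : Setoid (Ideal R) where
  r a b := Nonempty ((H R a d M) ≃ₗ[R] (H R b d M))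
  iseqv := ⟨fun _ => ⟨LinearEquiv.refl _ _⟩,
    fun h => h.elim fun e => ⟨e.symm⟩,
    fun h1 h2 => h1.elim fun e => h2.elim fun f => ⟨e.trans f⟩⟩

namespace LocCoh
open Abelian IsLocalRing
open scoped Pointwise TensorProduct

variable {R : Type} [CommRing R]

/-- A short exact sequence of modules. -/
structure SES {A B C : Type} [AddCommGroup A] [AddCommGroup B] [AddCommGroup C]
    [Module R A] [Module R B] [Module R C] (f : A →ₗ[R] B) (g : B →ₗ[R] C) : Prop where
  inj : Function.Injective f
  exact : Function.Exact f g
  surj : Function.Surjective g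

section
variable {A B C D X Y Z : Type} [AddCommGroup A] [AddCommGroup B] [AddCommGroup C] [AddCommGroup D]
    [AddCommGroup X] [AddCommGroup Y] [AddCommGroup Z]
    [Module R A] [Module R B] [Module R C] [Module R D] [Module R X] [Module R Y] [Module R Z]

variable (R) in
/-- The short complex attached to two composable linear maps. -/
abbrev sc (f : A →ₗ[R] B) (g : B →ₗ[R] C) (h : Function.Exact f g) : ShortComplex (ModuleCat.{0} R) :=
  ShortComplex.mk (ModuleCat.ofHom f) (ModuleCat.ofHom g) (by
    ext x; exact h.apply_apply_eq_zero x)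

lemma SES.shortExact {f : A →ₗ[R] B} {g : B →ₗ[R] C} (h : SES f g) :
    (sc R f g h.exact).ShortExact where
  exact := by
    rw [ShortComplex.ShortExact.moduleCat_exact_iff_function_exact]
    exact h.exact
  mono_f := (ModuleCat.mono_iff_injective _).2 h.inj
  epi_g := (ModuleCat.epi_iff_surjective _).2 h.surj

variable (R) in
/-- The Ext modules between two modules. -/
def ExtM (X A : Type) [AddCommGroup X] [Module R X] [AddCommGroup A] [Module R A] (i : ℕ) : Type := Abelian.Ext (ModuleCat.of R X) (ModuleCat.of R A) i

instance (i : ℕ) : AddCommGroup (ExtM R X A i) :=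
  inferInstanceAs (AddCommGroup (Abelian.Ext (ModuleCat.of R X) (ModuleCat.of R A) i))

instance (i : ℕ) : Module R (ExtM R X A i) :=
  inferInstanceAs (Module R (Abelian.Ext (ModuleCat.of R X) (ModuleCat.of R A) i))

/-- Functoriality of Ext in the second variable. -/
def post (X : Type) [AddCommGroup X] [Module R X] (i : ℕ) (f : A →ₗ[R] B) :
    ExtM R X A i →ₗ[R] ExtM R X B i where
  toFun x := Ext.comp x (Ext.mk₀ (ModuleCat.ofHom f)) (add_zero i)
  map_add' _ _ := Ext.add_comp ..
  map_smul' _ _ := Ext.smul_comp ..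

/-- Functoriality of Ext in the first variable. -/
def pre (A : Type) [AddCommGroup A] [Module R A] (i : ℕ) (f : X →ₗ[R] Y) :
    ExtM R Y A i →ₗ[R] ExtM R X A i where
  toFun x := (Ext.mk₀ (ModuleCat.ofHom f)).comp x (zero_add i)
  map_add' _ _ := Ext.comp_add ..
  map_smul' _ _ := Ext.comp_smul ..

/-- The covariant connecting map. -/
def SES.conn {f : A →ₗ[R] B} {g : B →ₗ[R] C} (h : SES f g) (X : Type) [AddCommGroup X] [Module R X]
    (i : ℕ) : ExtM R X C i →ₗ[R] ExtM R X A (i + 1) where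
  toFun x := Ext.comp x h.shortExact.extClass rfl
  map_add' _ _ := Ext.add_comp ..
  map_smul' _ _ := Ext.smul_comp ..

/-- The contravariant connecting map. -/
def SES.coconn {f : X →ₗ[R] Y} {g : Y →ₗ[R] Z} (h : SES f g) (A : Type) [AddCommGroup A]
    [Module R A] (i : ℕ) : ExtM R X A i →ₗ[R] ExtM R Z A (i + 1) where
  toFun x := Ext.comp h.shortExact.extClass x (add_comm 1 i)
  map_add' _ _ := Ext.comp_add ..
  map_smul' _ _ := Ext.comp_smul ..

@[simp] lemma post_id (i : ℕ) (x : ExtM R X A i) : post X i (LinearMap.id : A →ₗ[R] A) x = x :=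
  Ext.comp_mk₀_id x

lemma post_comp (i : ℕ) (f : A →ₗ[R] B) (g : B →ₗ[R] C) (x : ExtM R X A i) :
    post X i (g ∘ₗ f) x = post X i g (post X i f x) := by
  refine Eq.trans ?_ (Ext.comp_assoc_of_third_deg_zero _ _ _ (add_zero i)).symm
  rw [Ext.mk₀_comp_mk₀]; rfl

lemma post_add (i : ℕ) (f g : A →ₗ[R] B) (x : ExtM R X A i) :
    post X i (f + g) x = post X i f x + post X i g x := by
  refine Eq.trans ?_ (Ext.comp_add _ _ _ (add_zero i))
  rw [← Ext.mk₀_add]; rfl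

lemma post_smul (i : ℕ) (r : R) (f : A →ₗ[R] B) (x : ExtM R X A i) :
    post X i (r • f) x = r • post X i f x := by
  refine Eq.trans ?_ (Ext.comp_smul _ _ (add_zero i) _)
  rw [← Ext.mk₀_smul]; rfl

@[simp] lemma pre_id (i : ℕ) (x : ExtM R X A i) : pre A i (LinearMap.id : X →ₗ[R] X) x = x :=
  Ext.mk₀_id_comp x

lemma pre_comp (i : ℕ) (f : X →ₗ[R] Y) (g : Y →ₗ[R] Z) (x : ExtM R Z A i) :
    pre A i (g ∘ₗ f) x = pre A i f (pre A i g x) := by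
  exact (Ext.mk₀_comp_mk₀_assoc ..).symm

lemma pre_smul (i : ℕ) (r : R) (f : X →ₗ[R] Y) (x : ExtM R Y A i) :
    pre A i (r • f) x = r • pre A i f x := by
  refine Eq.trans ?_ (Ext.smul_comp _ _ (zero_add i) _)
  rw [← Ext.mk₀_smul]; rfl

lemma post_pre (i : ℕ) (f : X →ₗ[R] Y) (g : A →ₗ[R] B) (x : ExtM R Y A i) :
    post X i g (pre A i f x) = pre B i f (post Y i g x) := by
  exact Ext.comp_assoc_of_third_deg_zero _ _ _ (zero_add i)

lemma SES.conn_pre {f : A →ₗ[R] B} {g : B →ₗ[R] C} (h : SES f g) (i : ℕ) (k : X →ₗ[R] Y)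
    (x : ExtM R Y C i) : h.conn X i (pre C i k x) = pre A (i + 1) k (h.conn Y i x) := by
  exact Ext.comp_assoc _ _ _ (zero_add i) rfl (by omega)

lemma SES.exact₁ {f : A →ₗ[R] B} {g : B →ₗ[R] C} (h : SES f g) (X : Type) [AddCommGroup X]
    [Module R X] (i : ℕ) : Function.Exact (h.conn X i) (post X (i + 1) f) := by
  intro x
  constructor
  · intro hx
    exact Ext.covariant_sequence_exact₁ _ h.shortExact x hx rfl
  · rintro ⟨y, rfl⟩
    refine (Ext.comp_assoc_of_third_deg_zero _ _ _ rfl).trans ?_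
    rw [h.shortExact.extClass_comp]; exact Ext.comp_zero _ _ _ _ rfl

lemma SES.exact₂ {f : A →ₗ[R] B} {g : B →ₗ[R] C} (h : SES f g) (X : Type) [AddCommGroup X]
    [Module R X] (i : ℕ) : Function.Exact (post X i f) (post X i g) := by
  intro x
  constructor
  · intro hx
    exact Ext.covariant_sequence_exact₂ _ h.shortExact x hx
  · rintro ⟨y, rfl⟩
    rw [← post_comp, h.exact.linearMap_comp_eq_zero, ← zero_smul R (0 : A →ₗ[R] C), post_smul,
      zero_smul]

lemma SES.exact₃ {f : A →ₗ[R] B} {g : B →ₗ[R] C} (h : SES f g) (X : Type) [AddCommGroup X]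
    [Module R X] (i : ℕ) : Function.Exact (post X i g) (h.conn X i) := by
  intro x
  constructor
  · intro hx
    exact Ext.covariant_sequence_exact₃ _ h.shortExact x rfl hx
  · rintro ⟨y, rfl⟩
    refine (Ext.comp_assoc_of_second_deg_zero _ _ _ rfl).trans ?_
    rw [h.shortExact.comp_extClass]; exact Ext.comp_zero _ _ _ _ rfl

lemma SES.coexact₃ {f : X →ₗ[R] Y} {g : Y →ₗ[R] Z} (h : SES f g) (A : Type) [AddCommGroup A]
    [Module R A] (i : ℕ) {x : ExtM R Z A (i + 1)} (hx : pre A (i + 1) g x = 0) :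
    ∃ y, h.coconn A i y = x :=
  Ext.contravariant_sequence_exact₃ h.shortExact _ x hx (add_comm 1 i)

variable (R) in
/-- Ext in degree zero is Hom. -/
def ext0 (X A : Type) [AddCommGroup X] [Module R X] [AddCommGroup A] [Module R A] : ExtM R X A 0 ≃ₗ[R] (X →ₗ[R] A) :=
  Ext.linearEquiv₀ (R := R) ≪≫ₗ ModuleCat.homLinearEquiv

lemma ext0_post (f : A →ₗ[R] B) (x : ExtM R X A 0) :
    ext0 R X B (post X 0 f x) = f ∘ₗ ext0 R X A x := by
  obtain ⟨φ, rfl⟩ := (ext0 R X A).symm.surjective x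
  apply (ext0 R X B).symm.injective
  simp only [LinearEquiv.symm_apply_apply, LinearEquiv.apply_symm_apply]
  exact Ext.mk₀_comp_mk₀ ..

lemma ext0_pre (f : X →ₗ[R] Y) (x : ExtM R Y A 0) :
    ext0 R X A (pre A 0 f x) = ext0 R Y A x ∘ₗ f := by
  obtain ⟨φ, rfl⟩ := (ext0 R Y A).symm.surjective x
  apply (ext0 R X A).symm.injective
  simp only [LinearEquiv.symm_apply_apply, LinearEquiv.apply_symm_apply]
  exact Ext.mk₀_comp_mk₀ ..

lemma subsingleton_ext_of_injective (X J : Type) [AddCommGroup X] [Module R X]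
    [AddCommGroup J] [Module R J] [Module.Injective R J] (i : ℕ) :
    Subsingleton (ExtM R X J (i + 1)) := by
  have : Injective (ModuleCat.of R J) := (Module.injective_iff_injective_object R J).1 inferInstance
  exact ⟨fun a b => by rw [Ext.eq_zero_of_injective a, Ext.eq_zero_of_injective b]⟩

lemma subsingleton_ext_of_projective (P A : Type) [AddCommGroup P] [Module R P]
    [AddCommGroup A] [Module R A] [Module.Projective R P] (i : ℕ) :
    Subsingleton (ExtM R P A (i + 1)) := by
  have : Projective (ModuleCat.of R P) := (IsProjective.iff_projective P).1 inferInstance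
  exact ⟨fun a b => by rw [Ext.eq_zero_of_projective a, Ext.eq_zero_of_projective b]⟩

end

section
variable {A B C N : Type} [AddCommGroup A] [AddCommGroup B] [AddCommGroup C] [AddCommGroup N]
    [Module R A] [Module R B] [Module R C] [Module R N]

/-- The transition maps of the direct system of Ext modules defining local cohomology. -/
abbrev LC.res (I : Ideal R) (i : ℕ) (N : Type) [AddCommGroup N] [Module R N] (n m : ℕ) (h : n ≤ m) :
    ExtM R (R ⧸ I ^ n) N i →ₗ[R] ExtM R (R ⧸ I ^ m) N i :=
  pre N i (Submodule.factor (Ideal.pow_le_pow_right h))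

/-- Local cohomology, as a direct limit of Ext modules. -/
def LC (I : Ideal R) (i : ℕ) (N : Type) [AddCommGroup N] [Module R N] : Type :=
  Module.DirectLimit (fun n => ExtM R (R ⧸ I ^ n) N i) (LC.res I i N)

instance (I : Ideal R) (i : ℕ) : AddCommGroup (LC I i N) :=
  inferInstanceAs (AddCommGroup (Module.DirectLimit _ (LC.res I i N)))

instance (I : Ideal R) (i : ℕ) : Module R (LC I i N) :=
  inferInstanceAs (Module R (Module.DirectLimit _ (LC.res I i N)))

namespace LC

/-- The structure maps of the direct limit. -/
def of (I : Ideal R) (i : ℕ) (N : Type) [AddCommGroup N] [Module R N] (n : ℕ) :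
    ExtM R (R ⧸ I ^ n) N i →ₗ[R] LC I i N :=
  Module.DirectLimit.of R ℕ (fun n => ExtM R (R ⧸ I ^ n) N i) (LC.res I i N) n

instance (I : Ideal R) (i : ℕ) :
    DirectedSystem (fun n => ExtM R (R ⧸ I ^ n) N i) (fun n m h => LC.res I i N n m h) where
  map_self n x := by
    have : Submodule.factor (le_refl (I ^ n)) = LinearMap.id := by ext; simp
    simp [LC.res, this]
  map_map n m k h h' x := by
    simp only [LC.res]
    rw [← pre_comp, Submodule.factor_comp]

lemma exists_of {I : Ideal R} {i : ℕ} (z : LC I i N) : ∃ n x, of I i N n x = z :=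
  Module.DirectLimit.exists_of z

lemma of_res {I : Ideal R} {i : ℕ} {n m : ℕ} (h : n ≤ m) (x : ExtM R (R ⧸ I ^ n) N i) :
    of I i N m (pre N i (Submodule.factor (Ideal.pow_le_pow_right h)) x) = of I i N n x :=
  Module.DirectLimit.of_f (f := LC.res I i N) (hij := h)

lemma of_eq_zero {I : Ideal R} {i : ℕ} {n : ℕ} {x : ExtM R (R ⧸ I ^ n) N i}
    (h : of I i N n x = 0) :
    ∃ (m : ℕ) (hm : n ≤ m), pre N i (Submodule.factor (Ideal.pow_le_pow_right (I := I) hm)) x = 0 :=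
  Module.DirectLimit.of.zero_exact h

/-- Functoriality of local cohomology. -/
def map (I : Ideal R) (i : ℕ) (f : A →ₗ[R] B) : LC I i A →ₗ[R] LC I i B :=
  Module.DirectLimit.map (fun _ => post _ i f) (fun _ _ _ => by
    ext x; simp only [LinearMap.comp_apply]; exact post_pre _ _ _ _)

@[simp] lemma map_of (I : Ideal R) (i : ℕ) (f : A →ₗ[R] B) (n : ℕ) (x) :
    map I i f (of I i A n x) = of I i B n (post _ i f x) :=
  Module.DirectLimit.map_apply_of _ _ _

/-- The connecting map of local cohomology. -/
def conn (I : Ideal R) (i : ℕ) {f : A →ₗ[R] B} {g : B →ₗ[R] C} (h : SES f g) :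
    LC I i C →ₗ[R] LC I (i + 1) A :=
  Module.DirectLimit.map (fun _ => h.conn _ i) (fun _ _ _ => by
    ext x; simp only [LinearMap.comp_apply]; exact h.conn_pre _ _ _)

@[simp] lemma conn_of (I : Ideal R) (i : ℕ) {f : A →ₗ[R] B} {g : B →ₗ[R] C} (h : SES f g) (n : ℕ)
    (x) : conn I i h (of I i C n x) = of I (i + 1) A n (h.conn _ i x) :=
  Module.DirectLimit.map_apply_of _ _ _

@[simp] lemma map_id (I : Ideal R) (i : ℕ) (x : LC I i A) :
    map I i (LinearMap.id : A →ₗ[R] A) x = x := by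
  obtain ⟨n, y, rfl⟩ := exists_of x
  simp

lemma map_comp (I : Ideal R) (i : ℕ) (f : A →ₗ[R] B) (g : B →ₗ[R] C) (x : LC I i A) :
    map I i (g ∘ₗ f) x = map I i g (map I i f x) := by
  obtain ⟨n, y, rfl⟩ := exists_of x
  simp [post_comp]

lemma map_add (I : Ideal R) (i : ℕ) (f g : A →ₗ[R] B) (x : LC I i A) :
    map I i (f + g) x = map I i f x + map I i g x := by
  obtain ⟨n, y, rfl⟩ := exists_of x
  simp [post_add]

lemma map_smul (I : Ideal R) (i : ℕ) (r : R) (f : A →ₗ[R] B) (x : LC I i A) :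
    map I i (r • f) x = r • map I i f x := by
  obtain ⟨n, y, rfl⟩ := exists_of x
  simp [post_smul]

lemma map_smul_id (I : Ideal R) (i : ℕ) (r : R) (x : LC I i A) :
    map I i (r • (LinearMap.id : A →ₗ[R] A)) x = r • x := by
  rw [map_smul, map_id]

lemma map_zero (I : Ideal R) (i : ℕ) (x : LC I i A) : map I i (0 : A →ₗ[R] B) x = 0 := by
  rw [← zero_smul R (0 : A →ₗ[R] B), map_smul, zero_smul]

/-- Local cohomology of isomorphic modules. -/
def congr (I : Ideal R) (i : ℕ) (e : A ≃ₗ[R] B) : LC I i A ≃ₗ[R] LC I i B :=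
  LinearEquiv.ofLinearMap (map I i e.toLinearMap) (map I i e.symm.toLinearMap)
    (by ext1 x; simp [← map_comp]) (by ext1 x; simp [← map_comp])

lemma exact₁ (I : Ideal R) (i : ℕ) {f : A →ₗ[R] B} {g : B →ₗ[R] C} (h : SES f g) :
    Function.Exact (conn I i h) (map I (i + 1) f) := by
  intro x
  constructor
  · intro hx
    obtain ⟨n, x, rfl⟩ := exists_of x
    rw [map_of] at hx
    obtain ⟨m, hm, hx⟩ := of_eq_zero hx
    rw [← post_pre] at hx
    obtain ⟨y, hy⟩ := (h.exact₁ _ i _).1 hx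
    exact ⟨of I i C m y, by rw [conn_of, hy, of_res hm]⟩
  · rintro ⟨y, rfl⟩
    obtain ⟨n, y, rfl⟩ := exists_of y
    rw [conn_of, map_of, (h.exact₁ _ i).apply_apply_eq_zero, LinearMap.map_zero]

lemma exact₂ (I : Ideal R) (i : ℕ) {f : A →ₗ[R] B} {g : B →ₗ[R] C} (h : SES f g) :
    Function.Exact (map I i f) (map I i g) := by
  intro x
  constructor
  · intro hx
    obtain ⟨n, x, rfl⟩ := exists_of x
    rw [map_of] at hx
    obtain ⟨m, hm, hx⟩ := of_eq_zero hx
    rw [← post_pre] at hx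
    obtain ⟨y, hy⟩ := (h.exact₂ _ i _).1 hx
    exact ⟨of I i A m y, by rw [map_of, hy, of_res hm]⟩
  · rintro ⟨y, rfl⟩
    obtain ⟨n, y, rfl⟩ := exists_of y
    rw [map_of, map_of, (h.exact₂ _ i).apply_apply_eq_zero, LinearMap.map_zero]

lemma exact₃ (I : Ideal R) (i : ℕ) {f : A →ₗ[R] B} {g : B →ₗ[R] C} (h : SES f g) :
    Function.Exact (map I i g) (conn I i h) := by
  intro x
  constructor
  · intro hx
    obtain ⟨n, x, rfl⟩ := exists_of x
    rw [conn_of] at hx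
    obtain ⟨m, hm, hx⟩ := of_eq_zero hx
    rw [← h.conn_pre] at hx
    obtain ⟨y, hy⟩ := (h.exact₃ _ i _).1 hx
    exact ⟨of I i B m y, by rw [map_of, hy, of_res hm]⟩
  · rintro ⟨y, rfl⟩
    obtain ⟨n, y, rfl⟩ := exists_of y
    rw [map_of, conn_of, (h.exact₃ _ i).apply_apply_eq_zero, LinearMap.map_zero]

lemma smul_ext_eq_zero {J : Ideal R} {r : R} (hr : r ∈ J) (i : ℕ) (x : ExtM R (R ⧸ J) N i) :
    r • x = 0 := by
  have : r • (LinearMap.id : (R ⧸ J) →ₗ[R] (R ⧸ J)) = 0 := by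
    ext
    simp only [LinearMap.comp_apply, LinearMap.smul_apply, LinearMap.id_apply, LinearMap.zero_apply]
    rw [← LinearMap.map_smul, Submodule.mkQ_apply, Submodule.Quotient.mk_eq_zero]
    simpa using hr
  have h2 := pre_smul i r (LinearMap.id : (R ⧸ J) →ₗ[R] (R ⧸ J)) x
  rw [this, pre_id] at h2
  rw [← h2, ← zero_smul R (0 : (R ⧸ J) →ₗ[R] (R ⧸ J)), pre_smul, zero_smul]

lemma exists_pow_smul_eq_zero {I : Ideal R} {i : ℕ} (z : LC I i N) :
    ∃ n, ∀ r ∈ I ^ n, r • z = 0 := by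
  obtain ⟨n, x, rfl⟩ := exists_of z
  exact ⟨n, fun r hr => by rw [← LinearMap.map_smul, smul_ext_eq_zero hr, LinearMap.map_zero]⟩

instance (I : Ideal R) (i : ℕ) [Subsingleton N] : Subsingleton (LC I i N) := by
  refine subsingleton_of_forall_eq 0 fun x => ?_
  rw [← map_id I i x, Subsingleton.elim (LinearMap.id : N →ₗ[R] N) 0, map_zero]

lemma subsingleton_of_injective (I : Ideal R) (i : ℕ) (J : Type) [AddCommGroup J] [Module R J]
    [Module.Injective R J] : Subsingleton (LC I (i + 1) J) := by
  refine subsingleton_of_forall_eq 0 fun x => ?_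
  obtain ⟨n, x, rfl⟩ := exists_of x
  have := subsingleton_ext_of_injective (R := R) (R ⧸ I ^ n) J i
  rw [Subsingleton.elim x 0, LinearMap.map_zero]

lemma subsingleton_bot (i : ℕ) (N : Type) [AddCommGroup N] [Module R N] :
    Subsingleton (LC (⊥ : Ideal R) (i + 1) N) := by
  refine subsingleton_of_forall_eq 0 fun x => ?_
  obtain ⟨n, x, rfl⟩ := exists_of x
  rw [← of_res (Nat.le_succ n)]
  have h : (⊥ : Ideal R) ^ (n + 1) = ⊥ := by rw [pow_succ, Ideal.mul_bot]
  have hp : Module.Projective R (R ⧸ (⊥ : Ideal R) ^ (n + 1)) := by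
    rw [h]
    exact Module.Projective.of_equiv (Submodule.quotEquivOfEqBot (⊥ : Ideal R) rfl).symm
  have := subsingleton_ext_of_projective (R := R) (R ⧸ (⊥ : Ideal R) ^ (n + 1)) N i
  rw [Subsingleton.elim (pre N _ _ x) 0, LinearMap.map_zero]

instance subsingleton_top (i : ℕ) (N : Type) [AddCommGroup N] [Module R N] :
    Subsingleton (LC (⊤ : Ideal R) i N) := by
  refine subsingleton_of_forall_eq 0 fun x => ?_
  obtain ⟨n, hn⟩ := exists_pow_smul_eq_zero x
  simpa using hn 1 (by rw [Ideal.top_pow]; trivial)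

/-- Evaluation at `1` in degree zero. -/
def ev (I : Ideal R) (N : Type) [AddCommGroup N] [Module R N] : LC I 0 N →ₗ[R] N :=
  Module.DirectLimit.lift R ℕ _ _
    (fun n => (LinearMap.applyₗ (Submodule.mkQ (I ^ n) 1)) ∘ₗ (ext0 R (R ⧸ I ^ n) N).toLinearMap)
    (fun n m h x => by simp [ext0_pre])

@[simp] lemma ev_of (I : Ideal R) (n : ℕ) (x : ExtM R (R ⧸ I ^ n) N 0) :
    ev I N (of I 0 N n x) = ext0 R (R ⧸ I ^ n) N x (Submodule.mkQ (I ^ n) 1) :=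
  Module.DirectLimit.lift_of _ _ _

lemma ev_map (I : Ideal R) (f : A →ₗ[R] B) (x : LC I 0 A) : ev I B (map I 0 f x) = f (ev I A x) := by
  obtain ⟨n, x, rfl⟩ := exists_of x
  simp [ext0_post]

lemma ev_injective (I : Ideal R) (N : Type) [AddCommGroup N] [Module R N] :
    Function.Injective (ev I N) := by
  rw [injective_iff_map_eq_zero]
  intro x hx
  obtain ⟨n, x, rfl⟩ := exists_of x
  rw [ev_of] at hx
  have : ext0 R (R ⧸ I ^ n) N x = 0 := by
    ext; simpa using hx
  rw [(LinearEquiv.map_eq_zero_iff _).1 this, LinearMap.map_zero]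

lemma mem_range_ev {I : Ideal R} {z : N} :
    z ∈ LinearMap.range (ev I N) ↔ ∃ n, ∀ r ∈ I ^ n, r • z = 0 := by
  constructor
  · rintro ⟨x, rfl⟩
    obtain ⟨n, hn⟩ := exists_pow_smul_eq_zero x
    exact ⟨n, fun r hr => by rw [← LinearMap.map_smul, hn r hr, LinearMap.map_zero]⟩
  · rintro ⟨n, hn⟩
    let φ : (R ⧸ I ^ n) →ₗ[R] N := Submodule.liftQ (I ^ n) (LinearMap.toSpanSingleton R N z) (by
      intro r hr; simpa using hn r hr)
    refine ⟨of I 0 N n ((ext0 R (R ⧸ I ^ n) N).symm φ), ?_⟩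
    rw [ev_of, LinearEquiv.apply_symm_apply]
    exact (Submodule.liftQ_apply _ _ _).trans (by simp)

/-- The comparison map for an inclusion of ideals. -/
def comp {a b : Ideal R} (h : a ≤ b) (i : ℕ) (N : Type) [AddCommGroup N] [Module R N] :
    LC b i N →ₗ[R] LC a i N :=
  Module.DirectLimit.map (fun n => pre N i (Submodule.factor (Ideal.pow_right_mono h n)))
    (fun n m h => by
      ext x; simp only [LinearMap.comp_apply]; rw [← pre_comp, ← pre_comp, Submodule.factor_comp,
        Submodule.factor_comp])

@[simp] lemma comp_of {a b : Ideal R} (h : a ≤ b) (i : ℕ) (n : ℕ) (x : ExtM R (R ⧸ b ^ n) N i) :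
    comp h i N (of b i N n x) =
      of a i N n (pre N i (Submodule.factor (Ideal.pow_right_mono h n)) x) :=
  Module.DirectLimit.map_apply_of _ _ _

lemma comp_map {a b : Ideal R} (h : a ≤ b) (i : ℕ) (f : A →ₗ[R] B) (x : LC b i A) :
    comp h i B (map b i f x) = map a i f (comp h i A x) := by
  obtain ⟨n, x, rfl⟩ := exists_of x
  simp [post_pre]

lemma comp_conn {a b : Ideal R} (h : a ≤ b) (i : ℕ) {f : A →ₗ[R] B} {g : B →ₗ[R] C} (s : SES f g)
    (x : LC b i C) : comp h (i + 1) A (conn b i s x) = conn a i s (comp h i C x) := by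
  obtain ⟨n, x, rfl⟩ := exists_of x
  simp [s.conn_pre]

lemma ev_comp {a b : Ideal R} (h : a ≤ b) (x : LC b 0 N) : ev a N (comp h 0 N x) = ev b N x := by
  obtain ⟨n, x, rfl⟩ := exists_of x
  simp [ext0_pre]

end LC
end

section bridge
open Opposite

namespace Bridge

/-- The functor whose left derived functors define the Ext functors of Mathlib. -/
abbrev F (Y : ModuleCat.{0} R) : ModuleCat.{0} R ⥤ (ModuleCat.{0} R)ᵒᵖ :=
  ((linearYoneda R (ModuleCat.{0} R)).obj Y).rightOp

variable {X : ModuleCat.{0} R} (P : ProjectiveResolution X) (Y : ModuleCat.{0} R) (n : ℕ)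

/-- The complex computing Ext, in the opposite category. -/
abbrev K : ChainComplex (ModuleCat.{0} R)ᵒᵖ ℕ :=
  ((F Y).mapHomologicalComplex (ComplexShape.down ℕ)).obj P.complex

/-- The module of cocycles. -/
abbrev T : ModuleCat.{0} R := ((K P Y).opcycles n).unop

/-- The map from cocycles to cochains. -/
def b : T P Y n ⟶ ModuleCat.of R (P.complex.X n ⟶ Y) := ((K P Y).pOpcycles n).unop

/-- The derived functor is computed by the projective resolution. -/
def iso : ((F Y).leftDerived n).obj X ≅ (K P Y).homology n := P.isoLeftDerivedObj (F Y) n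

/-- The map from cocycles to cohomology. -/
def a : T P Y n ⟶ ((_root_.Ext R (ModuleCat.{0} R) n).obj (op X)).obj Y :=
  ((iso P Y n).hom ≫ (K P Y).homologyι n).unop

lemma b_inj : Function.Injective (b P Y n) := by
  exact (ModuleCat.mono_iff_injective _).1 (unop_mono_of_epi _)

lemma a_surj : Function.Surjective (a P Y n) := by
  exact (ModuleCat.epi_iff_surjective _).1 (unop_epi_of_mono _)

lemma d_b (m : ℕ) (_ : n + 1 = m) (t : T P Y n) : P.complex.d m n ≫ (b P Y n t : _ ⟶ _) = 0 := by
  have := (K P Y).d_pOpcycles m n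
  have h2 := congrArg Quiver.Hom.unop this
  exact congrArg (fun f => (ModuleCat.Hom.hom f) t) h2

lemma exists_b (m : ℕ) (hm : n + 1 = m) (f : P.complex.X n ⟶ Y) (hf : P.complex.d m n ≫ f = 0) :
    ∃ t, b P Y n t = f := by
  have := (K P Y).opcyclesIsCokernel m n (by simp [hm])
  let S : ShortComplex (ModuleCat.{0} R)ᵒᵖ := ShortComplex.mk ((K P Y).d m n) ((K P Y).pOpcycles n) ((K P Y).d_pOpcycles m n)
  have hS : S.Exact := S.exact_of_g_is_cokernel this
  have h2 := (ShortComplex.ShortExact.moduleCat_exact_iff_function_exact _).1 hS.unop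
  exact (h2 f).1 hf

/-- The map from cochains to coboundaries. -/
def δ (p : ℕ) : ModuleCat.of R (P.complex.X p ⟶ Y) ⟶ T P Y n := ((K P Y).fromOpcycles n p).unop

lemma b_δ (p : ℕ) (g : P.complex.X p ⟶ Y) : b P Y n (δ P Y n p g) = P.complex.d n p ≫ g :=
  congrArg (fun f => (ModuleCat.Hom.hom f) g) (congrArg Quiver.Hom.unop ((K P Y).p_fromOpcycles n p))

lemma a_eq_zero_iff (t : T P Y n) :
    a P Y n t = 0 ↔ ∃ g : P.complex.X ((ComplexShape.down ℕ).next n) ⟶ Y, b P Y n t = P.complex.d n _ ≫ g := by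
  have := (K P Y).homologyIsKernel n _ rfl
  let S : ShortComplex (ModuleCat.{0} R)ᵒᵖ := ShortComplex.mk ((K P Y).homologyι n) ((K P Y).fromOpcycles n ((ComplexShape.down ℕ).next n)) (by simp)
  have hS : S.Exact := S.exact_of_f_is_kernel this
  have h2 := (ShortComplex.ShortExact.moduleCat_exact_iff_function_exact _).1 hS.unop
  have h3 : a P Y n t = 0 ↔ ((K P Y).homologyι n).unop t = 0 := by
    have h4 : Function.Injective (iso P Y n).hom.unop :=
      (ModuleCat.mono_iff_injective _).1 (unop_mono_of_epi _)
    exact (map_eq_zero_iff (iso P Y n).hom.unop.hom h4)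
  rw [h3]
  refine (h2 t).trans ⟨?_, ?_⟩
  · rintro ⟨g, rfl⟩
    exact ⟨g, b_δ P Y n _ g⟩
  · rintro ⟨g, hg⟩
    exact ⟨g, b_inj P Y n ((b_δ P Y n _ g).trans hg.symm)⟩

variable {P} {X' : ModuleCat.{0} R} {P' : ProjectiveResolution X'} {g : X' ⟶ X} (φ : ProjectiveResolution.Hom P' P g)

/-- Functoriality of cocycles. -/
def tmap : T P Y n ⟶ T P' Y n :=
  (HomologicalComplex.opcyclesMap (((F Y).mapHomologicalComplex (ComplexShape.down ℕ)).map φ.hom) n).unop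

lemma b_tmap (t : T P Y n) : b P' Y n (tmap Y n φ t) = φ.hom.f n ≫ (b P Y n t : _ ⟶ _) := by
  have := HomologicalComplex.p_opcyclesMap (((F Y).mapHomologicalComplex (ComplexShape.down ℕ)).map φ.hom) n
  exact congrArg (fun f => (ModuleCat.Hom.hom f) t) (congrArg Quiver.Hom.unop this)

lemma a_tmap (t : T P Y n) : a P' Y n (tmap Y n φ t) =
    (((_root_.Ext R (ModuleCat.{0} R) n).map g.op).app Y) (a P Y n t) := by
  have h : ((F Y).leftDerived n).map g ≫ (iso P Y n).hom = (iso P' Y n).hom ≫ HomologicalComplex.homologyMap (((F Y).mapHomologicalComplex (ComplexShape.down ℕ)).map φ.hom) n := ProjectiveResolution.isoLeftDerivedObj_hom_naturality g P' P φ.hom (φ.hom_f_zero_comp_π_f_zero.trans (by simp)) (F Y) n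
  have h2 := HomologicalComplex.homologyι_naturality (((F Y).mapHomologicalComplex (ComplexShape.down ℕ)).map φ.hom) n
  have h3 : ((F Y).leftDerived n).map g ≫ (iso P Y n).hom ≫ (K P Y).homologyι n =
    ((iso P' Y n).hom ≫ (K P' Y).homologyι n) ≫ (HomologicalComplex.opcyclesMap (((F Y).mapHomologicalComplex (ComplexShape.down ℕ)).map φ.hom) n) := by
    rw [← Category.assoc, h, Category.assoc, Category.assoc, ← h2]
  exact (congrArg (fun f => (ModuleCat.Hom.hom f) t) (congrArg Quiver.Hom.unop h3)).symm

end Bridge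

open CochainComplex HomComplex in
lemma extMk_zero_eq_zero {X Y : ModuleCat.{0} R} (P : ProjectiveResolution X) (f : P.complex.X 0 ⟶ Y) (hf : P.complex.d 1 0 ≫ f = 0)
   (h : P.extMk f 1 rfl hf = 0) : f = 0 := by
  rw [← P.extEquivCohomologyClass.apply_eq_iff_eq,
    ProjectiveResolution.extEquivCohomologyClass_extMk, ProjectiveResolution.extEquivCohomologyClass_zero,
    CohomologyClass.mk_eq_zero_iff,
    Cocycle.toSingleMk_mem_coboundaries_iff _ _ _ _ _ 1 (by simp)] at h
  obtain ⟨g, hg⟩ := h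
  have h0 : P.cochainComplex.d (-(0:ℕ)) 1 = 0 := by
    have : Limits.IsZero (P.cochainComplex.X 1) := CochainComplex.isZero_of_isStrictlyLE _ 0 _ (by simp)
    exact this.eq_of_tgt _ _
  rw [h0, Limits.zero_comp] at hg
  rw [← cancel_epi (P.cochainComplexXIso (-(0:ℕ)) 0 rfl).hom, ← hg]; simp

namespace Bridge
variable {X : ModuleCat.{0} R} (P : ProjectiveResolution X) (Y : ModuleCat.{0} R) (n : ℕ)

/-- The map from cocycles to the modern Ext groups. -/
def e : T P Y n →ₗ[R] Abelian.Ext X Y n where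
  toFun t := P.extMk (b P Y n t) (n + 1) rfl (d_b P Y n _ rfl t)
  map_add' s t := by
    rw [ProjectiveResolution.add_extMk]; congr 1; exact map_add (b P Y n).hom _ _
  map_smul' r t := by
    simp only [Ext.smul_eq_comp_mk₀, ProjectiveResolution.extMk_comp_mk₀, RingHom.id_apply]
    congr 1
    exact (map_smul (b P Y n).hom r t).trans (by simp)

lemma e_surj : Function.Surjective (e P Y n) := fun x => by
  obtain ⟨f, hf, rfl⟩ := P.extMk_surjective x (n + 1) rfl
  obtain ⟨t, rfl⟩ := exists_b P Y n _ rfl f hf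
  exact ⟨t, rfl⟩

lemma e_eq_zero_iff (t : T P Y n) :
    e P Y n t = 0 ↔ ∃ g : P.complex.X ((ComplexShape.down ℕ).next n) ⟶ Y, b P Y n t = P.complex.d n _ ≫ g := by
  obtain _ | n := n
  · have : ¬ (ComplexShape.down ℕ).Rel 0 ((ComplexShape.down ℕ).next 0) := by simp
    rw [P.complex.shape _ _ this]
    constructor
    · intro h
      exact ⟨0, by rw [extMk_zero_eq_zero P _ (d_b P Y 0 1 rfl t) h]; simp⟩
    · rintro ⟨g, hg⟩
      rw [Limits.zero_comp] at hg
      have : t = 0 := b_inj P Y 0 (hg.trans (map_zero (b P Y 0).hom).symm)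
      rw [this, LinearMap.map_zero]
  · rw [ChainComplex.next_nat_succ]
    refine (P.extMk_eq_zero_iff _ _ rfl (d_b P Y (n + 1) _ rfl t) n rfl).trans ?_
    simp only [eq_comm]

lemma ker_eq : LinearMap.ker (a P Y n).hom = LinearMap.ker (e P Y n) :=
  Submodule.ext fun t => (a_eq_zero_iff P Y n t).trans (e_eq_zero_iff P Y n t).symm

/-- The two Ext modules agree. -/
def θ : ((_root_.Ext R (ModuleCat.{0} R) n).obj (op X)).obj Y ≃ₗ[R] Abelian.Ext X Y n :=
  ((a P Y n).hom.quotKerEquivOfSurjective (a_surj P Y n)).symm ≪≫ₗ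
    Submodule.quotEquivOfEq _ _ (ker_eq P Y n) ≪≫ₗ
    (e P Y n).quotKerEquivOfSurjective (e_surj P Y n)

lemma θ_a (t : T P Y n) : θ P Y n (a P Y n t) = e P Y n t := by
  have : ((a P Y n).hom.quotKerEquivOfSurjective (a_surj P Y n)).symm (a P Y n t) =
    Submodule.Quotient.mk t := by
    rw [LinearEquiv.symm_apply_eq]; rfl
  simp only [θ, LinearEquiv.trans_apply]
  rw [this]; rfl

lemma θ_naturality {X' : ModuleCat.{0} R} (P' : ProjectiveResolution X') (g : X' ⟶ X)
    (z : ((_root_.Ext R (ModuleCat.{0} R) n).obj (op X)).obj Y) :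
    θ P' Y n ((((_root_.Ext R (ModuleCat.{0} R) n).map g.op).app Y) z) =
      (Ext.mk₀ g).comp (θ P Y n z) (zero_add n) := by
  obtain ⟨t, rfl⟩ := a_surj P Y n z
  let φ : ProjectiveResolution.Hom P' P g := ⟨ProjectiveResolution.lift g P' P, by
    rw [ProjectiveResolution.lift_commutes_zero]; simp⟩
  rw [← a_tmap Y n φ, θ_a, θ_a]
  refine Eq.trans ?_ (ProjectiveResolution.mk₀_comp_extMk (b P Y n t) (n + 1) rfl
    (d_b P Y n _ rfl t) φ).symm
  have h : ∀ (f f' : P'.complex.X n ⟶ Y) (hf : P'.complex.d (n + 1) n ≫ f = 0)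
      (hf' : P'.complex.d (n + 1) n ≫ f' = 0), f = f' →
      P'.extMk f (n + 1) rfl hf = P'.extMk f' (n + 1) rfl hf' := by
    rintro f _ _ _ rfl; rfl
  exact h _ _ (d_b P' Y n (n + 1) rfl _)
    (by rw [← b_tmap Y n φ t]; exact d_b P' Y n (n + 1) rfl _) (b_tmap Y n φ t)

end Bridge

variable (I : Ideal R) (i : ℕ) (M : Type) [AddCommGroup M] [Module R M]

namespace Bridge

/-- The diagram computing the local cohomology of a module. -/
abbrev G : (ℕᵒᵖ)ᵒᵖ ⥤ ModuleCat.{0} R :=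
  localCohomology.diagram (localCohomology.idealPowersDiagram I) i ⋙
    (evaluation _ _).obj (ModuleCat.of R M)

/-- The colimit cocone of local cohomology. -/
abbrev coc : Limits.Cocone (G I i M) :=
  ((evaluation _ _).obj (ModuleCat.of R M)).mapCocone
    (Limits.colimit.cocone (localCohomology.diagram (localCohomology.idealPowersDiagram I) i))

/-- The cocone of local cohomology is a colimit. -/
def isCol : Limits.IsColimit (coc I i M) :=
  Limits.isColimitOfPreserves _ (Limits.colimit.isColimit _)

/-- Comparison at a finite level. -/
def lev (n : ℕ) : (G I i M).obj (op (op n)) ≃ₗ[R] ExtM R (R ⧸ I ^ n) M i :=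
  θ (projectiveResolution _) _ _

lemma lev_map {n m : ℕ} (h : n ≤ m) (z : (G I i M).obj (op (op n))) :
    lev I i M m ((G I i M).map (homOfLE h).op.op z) = LC.res I i M n m h (lev I i M n z) :=
  θ_naturality (projectiveResolution _) _ _ (projectiveResolution _) _ z

/-- The cocone with point the direct limit. -/
def coc' : Limits.Cocone (G I i M) where
  pt := ModuleCat.of R (LC I i M)
  ι :=
  { app := fun n => ModuleCat.ofHom (LC.of I i M n.unop.unop ∘ₗ (lev I i M n.unop.unop).toLinearMap)
    naturality := fun n m f => by
      ext z
      have h : n.unop.unop ≤ m.unop.unop := leOfHom f.unop.unop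
      have h2 := LC.of_res h (lev I i M _ z)
      refine Eq.trans ?_ h2
      exact congrArg (LC.of I i M m.unop.unop) (lev_map I i M h z) }

/-- The map from the direct limit to local cohomology. -/
def bwd : LC I i M →ₗ[R] (coc I i M).pt :=
  Module.DirectLimit.lift R ℕ (fun n => ExtM R (R ⧸ I ^ n) M i) (LC.res I i M)
    (fun n => ((coc I i M).ι.app (op (op n))).hom ∘ₗ (lev I i M n).symm.toLinearMap)
    (fun n m h x => by
      obtain ⟨z, rfl⟩ := (lev I i M n).surjective x
      simp only [LinearMap.comp_apply, LinearEquiv.coe_coe]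
      rw [← lev_map, LinearEquiv.symm_apply_apply, LinearEquiv.symm_apply_apply]
      exact congrArg (fun f => f.hom z) ((coc I i M).w (homOfLE h).op.op))

lemma bwd_of (n : ℕ) (x) : bwd I i M (LC.of I i M n x) =
    (coc I i M).ι.app (op (op n)) ((lev I i M n).symm x) :=
  Module.DirectLimit.lift_of (f := LC.res I i M) _ _ _

/-- The map from local cohomology to the direct limit. -/
def fwd : (coc I i M).pt →ₗ[R] LC I i M := ((isCol I i M).desc (coc' I i M)).hom

lemma fwd_ι (n : ℕ) (z) : fwd I i M ((coc I i M).ι.app (op (op n)) z) =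
    LC.of I i M n (lev I i M n z) :=
  congrArg (fun f => f.hom z) ((isCol I i M).fac (coc' I i M) (op (op n)))

lemma fwd_bwd (x : LC I i M) : fwd I i M (bwd I i M x) = x := by
  obtain ⟨n, x, rfl⟩ := LC.exists_of x
  rw [bwd_of, fwd_ι, LinearEquiv.apply_symm_apply]

lemma bwd_fwd (x : (coc I i M).pt) : bwd I i M (fwd I i M x) = x := by
  have : ModuleCat.ofHom (bwd I i M ∘ₗ fwd I i M) = 𝟙 _ := by
    refine (isCol I i M).hom_ext fun n => ?_
    ext z
    have := fwd_ι I i M n.unop.unop z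
    refine (congrArg (bwd I i M) this).trans ?_
    rw [bwd_of, LinearEquiv.symm_apply_apply]
    rfl
  exact congrArg (fun f => f.hom x) this

/-- Mathlib's local cohomology is the direct limit of modern Ext modules. -/
def equiv : (localCohomology I i).obj (ModuleCat.of R M) ≃ₗ[R] LC I i M :=
  LinearEquiv.ofLinearMap (fwd I i M) (bwd I i M)
    (LinearMap.ext (fwd_bwd I i M)) (LinearMap.ext (bwd_fwd I i M))

end Bridge

end bridge

section
variable {A B C N J : Type} [AddCommGroup A] [AddCommGroup B] [AddCommGroup C] [AddCommGroup N]
    [AddCommGroup J] [Module R A] [Module R B] [Module R C] [Module R N] [Module R J]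

lemma SES.of_injective {f : A →ₗ[R] B} (hf : Function.Injective f) :
    SES f (LinearMap.range f).mkQ where
  inj := hf
  exact := by
    rw [LinearMap.exact_iff, Submodule.ker_mkQ]
  surj := Submodule.mkQ_surjective _

lemma SES.of_surjective {g : B →ₗ[R] C} (hg : Function.Surjective g) :
    SES (LinearMap.ker g).subtype g where
  inj := Subtype.val_injective
  exact := by
    rw [LinearMap.exact_iff, Submodule.range_subtype]
  surj := hg

lemma SES.of_submodule (P : Submodule R N) : SES P.subtype P.mkQ where
  inj := Subtype.val_injective
  exact := by rw [LinearMap.exact_iff, Submodule.range_subtype, Submodule.ker_mkQ]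
  surj := Submodule.mkQ_surjective _

/-- The short exact sequence given by multiplication by a regular element. -/
lemma SES.of_isSMulRegular {x : R} (hx : IsSMulRegular N x) :
    SES (x • LinearMap.id : N →ₗ[R] N) (x • (⊤ : Submodule R N)).mkQ where
  inj := hx
  exact := by
    rw [LinearMap.exact_iff, Submodule.ker_mkQ]
    ext y
    simp [Submodule.mem_smul_pointwise_iff_exists]
  surj := Submodule.mkQ_surjective _

/-- Extension of a linear map into an injective module along an arbitrary map. -/
lemma exists_extend [Module.Injective R J] (f : A →ₗ[R] B) (g : A →ₗ[R] J)
    (h : LinearMap.ker f ≤ LinearMap.ker g) : ∃ k : B →ₗ[R] J, k ∘ₗ f = g := by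
  have hinj : Function.Injective ((LinearMap.ker f).liftQ f le_rfl) := by
    rw [← LinearMap.ker_eq_bot]; exact Submodule.ker_liftQ_eq_bot _ _ _ le_rfl
  obtain ⟨k, hk⟩ := Module.Injective.out _ hinj ((LinearMap.ker f).liftQ g h)
  exact ⟨k, LinearMap.ext fun x => by simpa using hk (Submodule.Quotient.mk x)⟩

variable (R) in
lemma exists_injective (N : Type) [AddCommGroup N] [Module R N] :
    ∃ (J : Type) (_ : AddCommGroup J) (_ : Module R J) (f : N →ₗ[R] J),
      Module.Injective R J ∧ Function.Injective f := by
  let J := Injective.under (ModuleCat.of R N)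
  refine ⟨J, inferInstance, inferInstance, (Injective.ι (ModuleCat.of R N)).hom, ?_, ?_⟩
  · exact (Module.injective_iff_injective_object R J).2 (inferInstanceAs (Injective J))
  · exact (ModuleCat.mono_iff_injective (Injective.ι (ModuleCat.of R N))).1 inferInstance

/-- The submodule of elements killed by a power of an ideal. -/
def tors (c : Ideal R) (N : Type) [AddCommGroup N] [Module R N] : Submodule R N where
  carrier := {x | ∃ n, ∀ r ∈ c ^ n, r • x = 0}
  add_mem' := by
    rintro x y ⟨n, hn⟩ ⟨m, hm⟩
    refine ⟨n + m, fun r hr => ?_⟩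
    rw [smul_add, hn r (Ideal.pow_le_pow_right (by omega) hr),
      hm r (Ideal.pow_le_pow_right (by omega) hr), add_zero]
  zero_mem' := ⟨0, by simp⟩
  smul_mem' := by
    rintro s x ⟨n, hn⟩
    exact ⟨n, fun r hr => by rw [smul_comm, hn r hr, smul_zero]⟩

lemma mem_tors {c : Ideal R} {x : N} : x ∈ tors c N ↔ ∃ n, ∀ r ∈ c ^ n, r • x = 0 := Iff.rfl

/-- Every element is killed by a power of the ideal. -/
def IsTors (c : Ideal R) (N : Type) [AddCommGroup N] [Module R N] : Prop :=
  ∀ x : N, ∃ n, ∀ r ∈ c ^ n, r • x = 0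

lemma isTors_tors (c : Ideal R) (N : Type) [AddCommGroup N] [Module R N] : IsTors c (tors c N) := by
  rintro ⟨x, n, hn⟩
  exact ⟨n, fun r hr => Subtype.ext (hn r hr)⟩

lemma LC.isTors (I : Ideal R) (i : ℕ) (N : Type) [AddCommGroup N] [Module R N] : IsTors I (LC I i N) :=
  fun z => LC.exists_pow_smul_eq_zero z

lemma IsTors.of_injective {c : Ideal R} (h : IsTors c B) {f : A →ₗ[R] B} (hf : Function.Injective f) :
    IsTors c A := fun x => by
  obtain ⟨n, hn⟩ := h (f x)
  exact ⟨n, fun r hr => hf (by rw [map_smul, hn r hr, map_zero])⟩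

lemma IsTors.of_surjective {c : Ideal R} (h : IsTors c A) {f : A →ₗ[R] B}
    (hf : Function.Surjective f) : IsTors c B := fun x => by
  obtain ⟨x, rfl⟩ := hf x
  obtain ⟨n, hn⟩ := h x
  exact ⟨n, fun r hr => by rw [← map_smul, hn r hr, map_zero]⟩

/-- A finitely generated torsion module is killed by a power of the ideal. -/
lemma IsTors.exists_pow [Module.Finite R N] {c : Ideal R} (h : IsTors c N) :
    ∃ n, c ^ n ≤ Module.annihilator R N := by
  obtain ⟨s, hs⟩ := Module.Finite.fg_top (R := R) (M := N)
  choose n hn using h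
  refine ⟨s.sup n, fun r hr => ?_⟩
  rw [Module.mem_annihilator]
  intro x
  have hx : x ∈ Submodule.span R (s : Set N) := hs ▸ Submodule.mem_top
  induction hx using Submodule.span_induction with
  | mem x hx => exact hn x r (Ideal.pow_le_pow_right (Finset.le_sup (f := n) hx) hr)
  | zero => simp
  | add x y _ _ hx hy => rw [smul_add, hx, hy, add_zero]
  | smul a x _ hx => rw [smul_comm, hx, smul_zero]

lemma exists_pow_le_ker [IsNoetherianRing R] {c : Ideal R} [Module.Finite R A] (h : IsTors c N) (g : A →ₗ[R] N) :
    ∃ n, c ^ n • ⊤ ≤ LinearMap.ker g := by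
  have h1 : IsTors c (LinearMap.range g) := h.of_injective (f := (LinearMap.range g).subtype) Subtype.val_injective
  obtain ⟨n, hn⟩ := h1.exists_pow
  refine ⟨n, Submodule.smul_le.2 fun r hr x _ => ?_⟩
  have := Module.mem_annihilator.1 (hn hr) ⟨g x, x, rfl⟩
  rw [LinearMap.mem_ker, map_smul]
  exact congrArg Subtype.val this

instance tors_injective [IsNoetherianRing R] [Module.Injective R J] (c : Ideal R) :
    Module.Injective R (tors c J) := by
  refine Module.Baer.injective fun I g => ?_
  obtain ⟨n, hn⟩ := exists_pow_le_ker (isTors_tors c J) g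
  obtain ⟨k, hk⟩ := Ideal.exists_pow_inf_eq_pow_smul c I
  have hker : LinearMap.ker ((c ^ (n + k)).mkQ ∘ₗ Submodule.subtype I) ≤
      LinearMap.ker ((tors c J).subtype ∘ₗ g) := by
    rintro ⟨x, hx⟩ hx'
    have h1 : x ∈ c ^ (n + k) • (⊤ : Submodule R R) ⊓ I := by
      refine ⟨?_, hx⟩
      simpa [Submodule.mkQ_apply, Ideal.Quotient.eq_zero_iff_mem] using hx'
    rw [hk _ (by omega)] at h1
    have h2 : x ∈ c ^ n • (I : Submodule R R) :=
      Submodule.smul_mono (Ideal.pow_le_pow_right (by omega)) inf_le_right h1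
    have h3 : (⟨x, hx⟩ : I) ∈ c ^ n • (⊤ : Submodule R I) := by
      exact (Submodule.mem_smul_top_iff (c ^ n) (I : Submodule R R) ⟨x, hx⟩).2 h2
    have h4 := hn h3
    rw [LinearMap.mem_ker] at h4 ⊢
    rw [LinearMap.comp_apply, h4]; rfl
  obtain ⟨h, hh⟩ := exists_extend _ _ hker
  have hmem : ∀ y, h y ∈ tors c J := fun y => ⟨n + k, fun r hr => by
    rw [← map_smul]
    obtain ⟨y, rfl⟩ := Submodule.Quotient.mk_surjective _ y
    have : r • (Submodule.Quotient.mk y : R ⧸ c ^ (n + k)) = 0 := by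
      rw [← Submodule.Quotient.mk_smul, Submodule.Quotient.mk_eq_zero]
      exact Ideal.mul_mem_right _ _ hr
    rw [this, map_zero]⟩
  refine ⟨(h.codRestrict _ hmem) ∘ₗ (c ^ (n + k)).mkQ, fun x hx => Subtype.ext ?_⟩
  exact LinearMap.congr_fun hh ⟨x, hx⟩

lemma exists_injective_tors [IsNoetherianRing R] {c : Ideal R} (h : IsTors c N) :
    ∃ (J : Type) (_ : AddCommGroup J) (_ : Module R J) (f : N →ₗ[R] J),
      Module.Injective R J ∧ Function.Injective f ∧ IsTors c J := by
  obtain ⟨J, _, _, f, hJ, hf⟩ := exists_injective R N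
  exact ⟨tors c J, inferInstance, inferInstance, f.codRestrict _ (fun x => by
    obtain ⟨n, hn⟩ := h x
    exact ⟨n, fun r hr => by rw [← map_smul, hn r hr, map_zero]⟩), inferInstance,
    fun x y hxy => hf (congrArg Subtype.val hxy), isTors_tors c J⟩

end

namespace LC
variable {N : Type} [AddCommGroup N] [Module R N]

lemma sup_pow_le (a c : Ideal R) (s n m : ℕ) {b : Ideal R} (hb : b ^ s ≤ a ⊔ c) :
    b ^ (s * (n + m)) ≤ a ^ n ⊔ c ^ m := by
  rw [pow_mul]
  exact (Ideal.pow_right_mono hb _).trans Ideal.sup_pow_add_le_pow_sup_pow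

/-- Local cohomology of `c`-torsion modules only depends on `a ⊔ c` up to radical. -/
lemma comp_bijective [IsNoetherianRing R] {a b c : Ideal R} (h : a ≤ b) {s : ℕ} (hb : b ^ s ≤ a ⊔ c)
    (i : ℕ) (N : Type) [AddCommGroup N] [Module R N] (hN : IsTors c N) :
    Function.Bijective (comp h i N) := by
  induction i generalizing N with
  | zero =>
    constructor
    · intro x y hxy
      apply ev_injective
      rw [← ev_comp h, ← ev_comp h, hxy]
    · intro y
      obtain ⟨n, hn⟩ := mem_range_ev.1 ⟨y, rfl⟩
      obtain ⟨m, hm⟩ := hN (ev a N y)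
      have : ev a N y ∈ LinearMap.range (ev b N) := by
        refine mem_range_ev.2 ⟨s * (n + m), fun r hr => ?_⟩
        obtain ⟨u, hu, v, hv, rfl⟩ := Submodule.mem_sup.1 (sup_pow_le a c s n m hb hr)
        rw [add_smul, hn u hu, hm v hv, add_zero]
      obtain ⟨x, hx⟩ := this
      exact ⟨x, ev_injective a N (by rw [ev_comp, hx])⟩
  | succ i ih =>
    obtain ⟨J, _, _, f, hJ, hf, hJt⟩ := exists_injective_tors hN
    have ses := SES.of_injective hf
    have hQ := ih _ (hJt.of_surjective ses.surj)
    have h1 := subsingleton_of_injective b i J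
    have h2 := subsingleton_of_injective a i J
    constructor
    · rw [← LinearMap.ker_eq_bot, LinearMap.ker_eq_bot']
      intro x hx
      obtain ⟨y, rfl⟩ := (exact₁ b i ses x).1 (Subsingleton.elim _ _)
      rw [comp_conn] at hx
      obtain ⟨w, hw⟩ := (exact₃ a i ses _).1 hx
      obtain ⟨w, rfl⟩ := (ih J hJt).2 w
      rw [← comp_map] at hw
      rw [← hQ.1 hw]
      exact (exact₃ b i ses).apply_apply_eq_zero w
    · intro x
      obtain ⟨y, rfl⟩ := (exact₁ a i ses x).1 (Subsingleton.elim _ _)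
      obtain ⟨y, rfl⟩ := hQ.2 y
      exact ⟨conn b i ses y, by rw [comp_conn]⟩

/-- The comparison isomorphism. -/
def compEquiv [IsNoetherianRing R] {a b c : Ideal R} (h : a ≤ b) {s : ℕ} (hb : b ^ s ≤ a ⊔ c)
    (i : ℕ) (N : Type) [AddCommGroup N] [Module R N] (hN : IsTors c N) : LC b i N ≃ₗ[R] LC a i N :=
  LinearEquiv.ofBijective _ (comp_bijective h hb i N hN)

lemma subsingleton_of_isTors [IsNoetherianRing R] {I : Ideal R} (hN : IsTors I N) (i : ℕ) :
    Subsingleton (LC I (i + 1) N) := by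
  have := subsingleton_bot (R := R) i N
  exact (compEquiv (a := ⊥) (b := I) (c := I) bot_le (s := 1) (by simp) (i + 1) N hN).toEquiv.subsingleton

section les
variable {A B C : Type} [AddCommGroup A] [AddCommGroup B] [AddCommGroup C]
    [Module R A] [Module R B] [Module R C] {f : A →ₗ[R] B} {g : B →ₗ[R] C}

lemma map_surjective_of_subsingleton (I : Ideal R) (i : ℕ) (h : SES f g)
    [Subsingleton (LC I (i + 1) A)] : Function.Surjective (map I i g) := fun x =>
  (exact₃ I i h x).1 (Subsingleton.elim _ _)

lemma map_injective_of_subsingleton (I : Ideal R) (i : ℕ) (h : SES f g)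
    [Subsingleton (LC I i A)] : Function.Injective (map I i g) := by
  rw [← LinearMap.ker_eq_bot, LinearMap.ker_eq_bot']
  intro x hx
  obtain ⟨y, rfl⟩ := (exact₂ I i h x).1 hx
  rw [Subsingleton.elim y 0, LinearMap.map_zero]

lemma map_surjective_left (I : Ideal R) (i : ℕ) (h : SES f g)
    [Subsingleton (LC I i C)] : Function.Surjective (map I i f) := fun x =>
  (exact₂ I i h x).1 (Subsingleton.elim _ _)

lemma map_injective_left (I : Ideal R) (i : ℕ) (h : SES f g)
    [Subsingleton (LC I i C)] : Function.Injective (map I (i + 1) f) := by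
  rw [← LinearMap.ker_eq_bot, LinearMap.ker_eq_bot']
  intro x hx
  obtain ⟨y, rfl⟩ := (exact₁ I i h x).1 hx
  rw [Subsingleton.elim y 0, LinearMap.map_zero]

lemma subsingleton_middle (I : Ideal R) (i : ℕ) (h : SES f g) [Subsingleton (LC I i A)]
    [Subsingleton (LC I i C)] : Subsingleton (LC I i B) :=
  (map_injective_of_subsingleton I i h).subsingleton

end les

lemma map_mkQ_tors_bijective [IsNoetherianRing R] (I : Ideal R) (i : ℕ) (N : Type) [AddCommGroup N] [Module R N] :
    Function.Bijective (map I (i + 1) (tors I N).mkQ) := by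
  have h1 := subsingleton_of_isTors (isTors_tors I N) i
  have h2 := subsingleton_of_isTors (isTors_tors I N) (i + 1)
  exact ⟨map_injective_of_subsingleton I _ (SES.of_submodule _),
    map_surjective_of_subsingleton I _ (SES.of_submodule _)⟩

end LC

section
variable {N : Type} [AddCommGroup N] [Module R N]

lemma torsionFree_quotient_tors [IsNoetherianRing R] (I : Ideal R) (x : N ⧸ tors I N)
    (n : ℕ) (hx : ∀ r ∈ I ^ n, r • x = 0) : x = 0 := by
  obtain ⟨x, rfl⟩ := Submodule.Quotient.mk_surjective _ x
  rw [Submodule.Quotient.mk_eq_zero]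
  let g : ↥(I ^ n) →ₗ[R] tors I N := ((LinearMap.toSpanSingleton R N x) ∘ₗ (I ^ n).subtype).codRestrict _
    (fun r => by
      have := hx r r.2
      rwa [← Submodule.Quotient.mk_smul, Submodule.Quotient.mk_eq_zero] at this)
  obtain ⟨m, hm⟩ := exists_pow_le_ker (isTors_tors I N) g
  refine ⟨m + n, fun r hr => ?_⟩
  rw [pow_add] at hr
  induction hr using Submodule.mul_induction_on' with
  | mem_mul_mem s hs t ht =>
    have := hm (Submodule.smul_mem_smul hs (Submodule.mem_top (x := ⟨t, ht⟩)))
    have := congrArg Subtype.val (LinearMap.mem_ker.1 this)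
    exact this
  | add y _ z _ hy hz => rw [add_smul, hy, hz, add_zero]

lemma exists_isSMulRegular [IsNoetherianRing R] [Module.Finite R N] (I : Ideal R)
    (h : ∀ (x : N) (n : ℕ), (∀ r ∈ I ^ n, r • x = 0) → x = 0) : ∃ r ∈ I, IsSMulRegular N r := by
  by_contra! hc
  have hfin := associatedPrimes.finite R N
  have h1 : (I : Set R) ⊆ ⋃ p ∈ associatedPrimes R N, ((id p : Ideal R) : Set R) := by
    simp only [id]
    rw [biUnion_associatedPrimes_eq_compl_regular]
    exact fun r hr => hc r hr
  obtain ⟨p, ⟨hp, x, rfl⟩, hI⟩ :=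
    (Ideal.subset_union_prime_finite hfin (f := id) ⊥ ⊥ (fun p hp _ _ => hp.isPrime)).1 h1
  obtain ⟨n, hn⟩ := Ideal.exists_pow_le_of_le_radical_of_fg hI (IsNoetherian.noetherian I)
  have hx := h x n (fun r hr => by simpa [Submodule.mem_colon_singleton] using hn hr)
  subst hx
  refine hp.ne_top ((Ideal.eq_top_iff_one _).2 (Ideal.le_radical ?_))
  simp [Submodule.mem_colon_singleton]

end

lemma dim_lt {D S : WithBot ℕ∞} {i : ℕ} (h : D + 1 ≤ S) (h2 : S < ((i + 1 : ℕ) : WithBot ℕ∞)) : D < i := by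
  by_contra! hc
  have h3 : ((i + 1 : ℕ) : WithBot ℕ∞) ≤ D + 1 := by push_cast; gcongr
  exact absurd (h3.trans h) (not_le.2 h2)

lemma supportDim_quotient_smul {N : Type} [AddCommGroup N] [Module R N] [Module.Finite R N] {x : R}
    (hx : IsSMulRegular N x) :
    Module.supportDim R (N ⧸ x • (⊤ : Submodule R N)) + 1 ≤ Module.supportDim R N :=
  Module.supportDim_quotSMulTop_succ_le_of_notMem_minimalPrimes
    (fun _ => hx.notMem_of_mem_minimalPrimes)

lemma eq_zero_of_smul_injective {x : R} {I : Ideal R} (hx : x ∈ I) {N : Type} [AddCommGroup N] [Module R N]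
    (hN : IsTors I N) (h : ∀ z : N, x • z = 0 → z = 0) (z : N) : z = 0 := by
  obtain ⟨n, hn⟩ := hN z
  have : ∀ m, x ^ m • z = 0 → z = 0 := by
    intro m
    induction m with
    | zero => simp
    | succ m ih => intro h'; rw [pow_succ', mul_smul] at h'; exact ih (h _ h')
  exact this n (hn _ (Ideal.pow_mem_pow hx n))

/-- Grothendieck vanishing. -/
theorem LC.subsingleton_of_supportDim_lt [IsNoetherianRing R] (I : Ideal R) (i : ℕ) (N : Type)
    [AddCommGroup N] [Module R N] [Module.Finite R N] (h : Module.supportDim R N < i) :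
    Subsingleton (LC I i N) := by
  induction i generalizing N with
  | zero =>
    have : Module.supportDim R N = ⊥ := by
      by_contra hb
      obtain ⟨k, hk⟩ := WithBot.ne_bot_iff_exists.1 hb
      rw [← hk] at h
      have : (k : WithBot ℕ∞) < ((0 : ℕ∞) : WithBot ℕ∞) := h
      rw [WithBot.coe_lt_coe] at this
      simp at this
    have := (Module.supportDim_eq_bot_iff_subsingleton R N).1 this
    infer_instance
  | succ i ih =>
    obtain ⟨x, hx, hreg⟩ := exists_isSMulRegular (N := N ⧸ tors I N) I
      (torsionFree_quotient_tors I)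
    have h1 := ih _ (dim_lt (supportDim_quotient_smul hreg)
      ((Module.supportDim_le_of_surjective _ (Submodule.mkQ_surjective (tors I N))).trans_lt h))
    have h2 := map_injective_left I i (SES.of_isSMulRegular hreg)
    have h3 : Subsingleton (LC I (i + 1) (N ⧸ tors I N)) := subsingleton_of_forall_eq 0 fun z => eq_zero_of_smul_injective hx (LC.isTors I (i + 1) _)
      (fun w hw => h2 (by rw [LC.map_smul_id, hw, LinearMap.map_zero])) z
    exact (map_mkQ_tors_bijective I i N).1.subsingleton

section
variable {A B C N J : Type} [AddCommGroup A] [AddCommGroup B] [AddCommGroup C] [AddCommGroup N]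
    [AddCommGroup J] [Module R A] [Module R B] [Module R C] [Module R N] [Module R J]

lemma LC.smul_surjective (I : Ideal R) (i : ℕ) {x : R} (h1 : ∀ z : N, x • z = 0 → z = 0)
    (h2 : ∀ z : N, ∃ y, x • y = z) : Function.Bijective (fun z : LC I i N => x • z) := by
  let e : N ≃ₗ[R] N := LinearEquiv.ofBijective (x • LinearMap.id)
    ⟨by
      rw [← LinearMap.ker_eq_bot, LinearMap.ker_eq_bot']
      exact fun z hz => h1 z (by simpa using hz), fun z => by simpa using h2 z⟩
  have := (LC.congr I i e).bijective
  convert this using 1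
  ext z
  exact (LC.map_smul_id I i x z).symm

lemma LC.subsingleton_of_smul_bijective {I : Ideal R} (i : ℕ) {x : R} (hx : x ∈ I)
    (h1 : ∀ z : N, x • z = 0 → z = 0)
    (h2 : ∀ z : N, ∃ y, x • y = z) : Subsingleton (LC I i N) :=
  subsingleton_of_forall_eq 0 fun z => eq_zero_of_smul_injective hx (LC.isTors I i N)
    (fun w hw => (LC.smul_surjective I i h1 h2).1 (by simpa using hw)) z

end

section BaseChange
variable {A : Type} [CommRing A] [Algebra R A]

lemma isTors_of_algebra {N : Type} [AddCommGroup N] [Module R N] [Module A N] [IsScalarTower R A N] {c : Ideal R}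
    (h : IsTors (c.map (algebraMap R A)) N) : IsTors c N := fun x => by
  obtain ⟨n, hn⟩ := h x
  refine ⟨n, fun r hr => ?_⟩
  rw [← algebraMap_smul A r x]
  exact hn _ (by rw [← Ideal.map_pow]; exact Ideal.mem_map_of_mem _ hr)

lemma mem_tors_algebra {N : Type} [AddCommGroup N] [Module R N] [Module A N] [IsScalarTower R A N] {c : Ideal R}
    {x : N} : x ∈ tors c N ↔ x ∈ tors (c.map (algebraMap R A)) N := by
  rw [mem_tors, mem_tors]
  refine exists_congr fun n => ⟨fun h r hr => ?_, fun h r hr => ?_⟩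
  · rw [← Ideal.map_pow] at hr
    induction hr using Submodule.span_induction with
    | mem r hr => obtain ⟨r, hr, rfl⟩ := hr; rw [algebraMap_smul, h r hr]
    | zero => rw [zero_smul]
    | add r s _ _ hr hs => rw [add_smul, hr, hs, add_zero]
    | smul a r _ hr => rw [smul_eq_mul, mul_smul, hr, smul_zero]
  · rw [← algebraMap_smul A r x]
    exact h _ (by rw [← Ideal.map_pow]; exact Ideal.mem_map_of_mem _ hr)

lemma SES.restrictScalars {N N' N'' : Type} [AddCommGroup N] [Module R N] [Module A N] [IsScalarTower R A N]
    [AddCommGroup N'] [Module R N'] [Module A N'] [IsScalarTower R A N']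
    [AddCommGroup N''] [Module R N''] [Module A N''] [IsScalarTower R A N'']
    {f : N →ₗ[A] N'} {g : N' →ₗ[A] N''} (h : SES f g) :
    SES (f.restrictScalars R) (g.restrictScalars R) := ⟨h.inj, h.exact, h.surj⟩

/-- An element acts surjectively on the quotient of an injective module by its torsion. -/
lemma exists_smul_sub_mem_tors [IsNoetherianRing R] {J : Type} [AddCommGroup J] [Module R J]
    [Module.Injective R J] (x : R) (z : J) : ∃ y, x • y - z ∈ tors (Ideal.span {x}) J := by
  obtain ⟨n, hn⟩ := monotone_stabilizes_iff_noetherian.2 (inferInstanceAs (IsNoetherian R R))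
    ⟨fun n => LinearMap.ker (LinearMap.mulLeft R (x ^ n)), monotone_nat_of_le_succ fun n y hy => by
      rw [LinearMap.mem_ker, LinearMap.mulLeft_apply] at hy ⊢
      rw [pow_succ', mul_assoc, hy, mul_zero]⟩
  obtain ⟨k, hk⟩ := exists_extend (LinearMap.mulLeft R (x ^ (n + 1)))
    (LinearMap.toSpanSingleton R J (x ^ n • z)) (by
      have := hn (n + 1) (by omega)
      change LinearMap.ker (LinearMap.mulLeft R (x ^ n)) = LinearMap.ker (LinearMap.mulLeft R (x ^ (n + 1))) at this
      rw [← this]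
      intro y hy
      rw [LinearMap.mem_ker, LinearMap.mulLeft_apply] at hy
      rw [LinearMap.mem_ker, LinearMap.toSpanSingleton_apply, ← mul_smul, mul_comm, hy, zero_smul])
  have h1 : x ^ (n + 1) • k 1 = x ^ n • z := by
    have := LinearMap.congr_fun hk 1
    rw [LinearMap.comp_apply, LinearMap.mulLeft_apply, ← smul_eq_mul, map_smul] at this
    simpa using this
  refine ⟨k 1, n, fun r hr => ?_⟩
  rw [Ideal.span_singleton_pow] at hr
  obtain ⟨s, rfl⟩ := Ideal.mem_span_singleton'.1 hr
  rw [mul_smul, smul_sub, ← mul_smul (x ^ n), ← pow_succ, h1, sub_self, smul_zero]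

lemma LC.subsingleton_of_injective_algebra [IsNoetherianRing R] [IsNoetherianRing A] (s : Finset R) (i : ℕ)
    (J : Type) [AddCommGroup J] [Module R J] [Module A J] [IsScalarTower R A J]
    [Module.Injective A J] : Subsingleton (LC (Ideal.span (s : Set R)) (i + 1) J) := by
  classical
  induction s using Finset.induction_on generalizing J with
  | empty =>
    rw [Finset.coe_empty, Ideal.span_empty]
    exact subsingleton_bot i J
  | insert x s _ ih =>
    set a := Ideal.span ((insert x s : Finset R) : Set R)
    have hx : x ∈ a := Ideal.subset_span (by simp)
    let Γ : Submodule A J := tors (Ideal.span {algebraMap R A x}) J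
    have ses : SES (Γ.subtype.restrictScalars R) (Γ.mkQ.restrictScalars R) :=
      SES.restrictScalars (SES.of_submodule Γ)
    have h1 : Subsingleton (LC a (i + 1) (J ⧸ Γ)) := by
      refine LC.subsingleton_of_smul_bijective (i + 1) hx (fun z hz => ?_) fun z => ?_
      · refine torsionFree_quotient_tors _ z 1 fun r hr => ?_
        rw [pow_one] at hr
        obtain ⟨s, rfl⟩ := Ideal.mem_span_singleton'.1 hr
        rw [mul_smul, algebraMap_smul, hz, smul_zero]
      · obtain ⟨z, rfl⟩ := Submodule.Quotient.mk_surjective _ z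
        obtain ⟨y, hy⟩ := exists_smul_sub_mem_tors (algebraMap R A x) z
        refine ⟨Submodule.Quotient.mk y, ?_⟩
        rw [← Submodule.Quotient.mk_smul, Submodule.Quotient.eq]
        rwa [algebraMap_smul] at hy
    have hle : Ideal.span (s : Set R) ≤ a := Ideal.span_mono (by simp)
    have ht : IsTors (Ideal.span {x}) Γ := isTors_of_algebra (A := A) (by
      rw [Ideal.map_span, Set.image_singleton]
      exact isTors_tors _ _)
    have h2 : Subsingleton (LC a (i + 1) Γ) := by
      have := ih Γ
      exact (compEquiv hle (s := 1) (c := Ideal.span {x}) (by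
        rw [pow_one, ← Ideal.span_union, Set.union_comm, ← Set.insert_eq, ← Finset.coe_insert])
          (i + 1) Γ ht).toEquiv.subsingleton
    exact (map_surjective_left a (i + 1) ses).subsingleton

/-- Vanishing of local cohomology can be checked after changing the base ring. -/
theorem LC.subsingleton_of_algebra [IsNoetherianRing R] [IsNoetherianRing A] (a : Ideal R) (i : ℕ)
    (N : Type) [AddCommGroup N] [Module R N] [Module A N] [IsScalarTower R A N]
    (h : Subsingleton (LC (a.map (algebraMap R A)) i N)) : Subsingleton (LC a i N) := by
  have hJ : ∀ (i : ℕ) (J : Type) [AddCommGroup J] [Module R J] [Module A J] [IsScalarTower R A J]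
      [Module.Injective A J], Subsingleton (LC a (i + 1) J) := by
    intro i J _ _ _ _ _
    obtain ⟨s, rfl⟩ := IsNoetherian.noetherian a
    exact LC.subsingleton_of_injective_algebra (A := A) s i J
  have key : ∀ (N : Type) [AddCommGroup N] [Module R N] [Module A N] [IsScalarTower R A N] (z : N),
      z ∈ LinearMap.range (ev a N) ↔ z ∈ LinearMap.range (ev (a.map (algebraMap R A)) N) := by
    intro N _ _ _ _ z
    rw [mem_range_ev, mem_range_ev]
    exact mem_tors_algebra
  have step : ∀ (N : Type) [AddCommGroup N] [Module R N] [Module A N] [IsScalarTower R A N],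
      ∃ (J : Type) (_ : AddCommGroup J) (_ : Module R J) (_ : Module A J) (_ : IsScalarTower R A J)
        (f : N →ₗ[A] J), Module.Injective A J ∧ Function.Injective f := by
    intro N _ _ _ _
    obtain ⟨J, _, _, f, hJ, hf⟩ := exists_injective A N
    let := Module.compHom J (algebraMap R A)
    exact ⟨J, _, _, _, IsScalarTower.of_algebraMap_smul fun r x => rfl, f, hJ, hf⟩
  induction i generalizing N with
  | zero =>
    refine subsingleton_of_forall_eq 0 fun z => ev_injective a N ?_
    obtain ⟨w, hw⟩ := (key N _).1 ⟨z, rfl⟩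
    rw [← hw, Subsingleton.elim w 0, LinearMap.map_zero, LinearMap.map_zero]
  | succ i ih =>
    obtain ⟨J, _, _, _, _, f, hJi, hf⟩ := step N
    have ses := SES.of_injective hf
    have sesR : SES (f.restrictScalars R) ((LinearMap.range f).mkQ.restrictScalars R) := ses.restrictScalars
    have h1 := hJ i J
    refine subsingleton_of_forall_eq 0 fun z => ?_
    obtain ⟨y, rfl⟩ := (exact₁ a i sesR z).1 (Subsingleton.elim _ _)
    cases i with
    | zero =>
      obtain ⟨w, hw⟩ := (key _ _).1 ⟨y, rfl⟩
      obtain ⟨w, rfl⟩ := map_surjective_of_subsingleton _ 0 ses w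
      obtain ⟨v, hv⟩ := (key J _).2 ⟨w, rfl⟩
      rw [ev_map, ← hv] at hw
      have : y = map a 0 ((LinearMap.range f).mkQ.restrictScalars R) v := by
        apply ev_injective
        rw [ev_map, ← hw]; rfl
      rw [this]
      exact (exact₃ a 0 sesR).apply_apply_eq_zero v
    | succ i =>
      have h3 : Subsingleton (LC (a.map (algebraMap R A)) (i + 1) J) := subsingleton_of_injective _ i J
      have h4 : Subsingleton (LC (a.map (algebraMap R A)) (i + 1) (J ⧸ LinearMap.range f)) := by
        refine subsingleton_of_forall_eq 0 fun z => ?_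
        obtain ⟨w, rfl⟩ := (exact₃ _ _ ses z).1 (Subsingleton.elim _ _)
        rw [Subsingleton.elim w 0, LinearMap.map_zero]
      have := ih _ h4
      rw [Subsingleton.elim y 0, LinearMap.map_zero]

end BaseChange

section
variable {J : Type} [AddCommGroup J] [Module R J]

/-- `P` is an essential extension of `K` inside the ambient module. -/
def IsEssExt (K P : Submodule R J) : Prop :=
  K ≤ P ∧ ∀ x ∈ P, x ≠ 0 → ∃ r : R, r • x ≠ 0 ∧ r • x ∈ K

lemma exists_maximal_isEssExt (K : Submodule R J) : ∃ P, Maximal (IsEssExt K) P := by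
  have h0 : IsEssExt K K := ⟨le_rfl, fun x hx h => ⟨1, by simpa, by simpa⟩⟩
  obtain ⟨P, -, hP⟩ := zorn_le_nonempty₀ {P | IsEssExt K P} (fun c hc hch y hy => by
    refine ⟨sSup c, ⟨(hc hy).1.trans (le_sSup hy), fun x hx hx0 => ?_⟩, fun z hz => le_sSup hz⟩
    obtain ⟨P, hP, hxP⟩ := (Submodule.mem_sSup_of_directed ⟨y, hy⟩ hch.directedOn).1 hx
    exact (hc hP).2 x hxP hx0) K h0
  exact ⟨P, hP⟩

lemma exists_maximal_disjoint (P : Submodule R J) : ∃ Q, Maximal (fun Q => Q ⊓ P = ⊥) Q := by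
  obtain ⟨Q, -, hQ⟩ := zorn_le_nonempty₀ {Q | Q ⊓ P = ⊥} (fun c hc hch y hy => by
    refine ⟨sSup c, ?_, fun z hz => le_sSup hz⟩
    rw [Set.mem_ofPred_eq, eq_bot_iff]
    rintro x ⟨hx, hxP⟩
    obtain ⟨Q, hQ, hxQ⟩ := (Submodule.mem_sSup_of_directed ⟨y, hy⟩ hch.directedOn).1 hx
    have : x ∈ Q ⊓ P := ⟨hxQ, hxP⟩
    rwa [hc hQ] at this) ⊥ (by simp)
  exact ⟨Q, hQ⟩

lemma injective_of_maximal_isEssExt [Module.Injective R J] {K P : Submodule R J}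
    (hP : Maximal (IsEssExt K) P) : Module.Injective R P := by
  obtain ⟨Q, hQ⟩ := exists_maximal_disjoint P
  have hess : ∀ z : J ⧸ Q, z ≠ 0 → ∃ r : R, ∃ e ∈ P, e ≠ 0 ∧ r • z = Q.mkQ e := by
    intro z hz
    obtain ⟨x, rfl⟩ := Submodule.Quotient.mk_surjective _ z
    have hx : x ∉ Q := by rwa [Ne, Submodule.Quotient.mk_eq_zero] at hz
    have h1 : ¬ (Q ⊔ Submodule.span R {x}) ⊓ P = ⊥ := fun h =>
      hx (hQ.2 h le_sup_left (Submodule.mem_sup_right (Submodule.mem_span_singleton_self x)))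
    obtain ⟨e, ⟨he, heP⟩, he0⟩ := Submodule.exists_mem_ne_zero_of_ne_bot h1
    obtain ⟨q, hq, w, hw, rfl⟩ := Submodule.mem_sup.1 he
    obtain ⟨r, rfl⟩ := Submodule.mem_span_singleton.1 hw
    refine ⟨r, _, heP, he0, ?_⟩
    rw [map_add, map_smul, Submodule.mkQ_apply, Submodule.mkQ_apply, (Submodule.Quotient.mk_eq_zero Q).2 hq, zero_add]
  obtain ⟨h, hh⟩ := exists_extend (Q.mkQ ∘ₗ P.subtype) P.subtype (fun x hx => by
    rw [LinearMap.mem_ker, LinearMap.comp_apply, Submodule.mkQ_apply, Submodule.Quotient.mk_eq_zero] at hx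
    have : (x : J) ∈ Q ⊓ P := ⟨hx, x.2⟩
    rw [hQ.1] at this
    exact this)
  have hh' : ∀ e ∈ P, h (Q.mkQ e) = e := fun e he => LinearMap.congr_fun hh ⟨e, he⟩
  have hrange : LinearMap.range h ≤ P := by
    refine hP.2 ⟨hP.1.1.trans fun e he => ⟨_, hh' e he⟩, ?_⟩ fun e he => ⟨_, hh' e he⟩
    rintro _ ⟨z, rfl⟩ hz
    obtain ⟨r, e, he, he0, hr⟩ := hess z (fun h0 => hz (by rw [h0, map_zero]))
    obtain ⟨s, hs0, hs⟩ := hP.1.2 e he he0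
    have : (s * r) • h z = s • e := by rw [mul_smul, ← map_smul h r, hr, hh' e he]
    exact ⟨s * r, by rwa [this], by rwa [this]⟩
  constructor
  intro X Y _ _ _ _ f hf g
  obtain ⟨k, hk⟩ := Module.Injective.out f hf (P.subtype ∘ₗ g)
  refine ⟨(h ∘ₗ Q.mkQ ∘ₗ k).codRestrict P (fun y => hrange ⟨_, rfl⟩), fun x => Subtype.ext ?_⟩
  change h (Q.mkQ (k (f x))) = g x
  rw [hk]
  exact hh' _ (g x).2

end

variable (R) in
lemma exists_dual [IsLocalRing R] : ∃ (E : Type) (_ : AddCommGroup E) (_ : Module R E),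
    Module.Injective R E ∧ Module.Finite R ((R ⧸ maximalIdeal R) →ₗ[R] E) ∧
      ∃ f : (R ⧸ maximalIdeal R) →ₗ[R] E, Function.Injective f := by
  obtain ⟨J, _, _, f, _, hf⟩ := exists_injective R (R ⧸ maximalIdeal R)
  obtain ⟨P, hP⟩ := exists_maximal_isEssExt (LinearMap.range f)
  let f' : (R ⧸ maximalIdeal R) →ₗ[R] P := f.codRestrict P (fun x => hP.1.1 ⟨x, rfl⟩)
  refine ⟨P, inferInstance, inferInstance, injective_of_maximal_isEssExt hP, ?_, f',
    fun x y hxy => hf (congrArg Subtype.val hxy)⟩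
  have hmem : ∀ φ : (R ⧸ maximalIdeal R) →ₗ[R] P, ∃ y, f y = φ 1 := by
    intro φ
    by_cases h0 : φ 1 = 0
    · exact ⟨0, by rw [h0, map_zero]; rfl⟩
    obtain ⟨r, hr0, hr⟩ := hP.1.2 (φ 1) (φ 1).2 (fun h => h0 (Subtype.ext h))
    have hu : IsUnit r := by
      by_contra hu
      apply hr0
      have : r • φ 1 = 0 := by
        rw [← map_smul, ← map_zero φ]
        congr 1
        rw [Algebra.smul_def, mul_one]
        exact Ideal.Quotient.eq_zero_iff_mem.2 ((mem_maximalIdeal r).2 hu)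
      exact congrArg Subtype.val this
    obtain ⟨u, rfl⟩ := hu
    have := (LinearMap.range f).smul_mem (↑u⁻¹ : R) hr
    rwa [← mul_smul, Units.inv_mul, one_smul] at this
  refine ⟨⟨{f'}, eq_top_iff.2 fun φ _ => ?_⟩⟩
  obtain ⟨y, hy⟩ := hmem φ
  obtain ⟨r, rfl⟩ := Ideal.Quotient.mk_surjective y
  rw [Finset.coe_singleton, Submodule.mem_span_singleton]
  have h1 : (Ideal.Quotient.mk (maximalIdeal R) r) = r • (1 : R ⧸ maximalIdeal R) := by
    rw [Algebra.smul_def, mul_one]; rfl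
  refine ⟨r, LinearMap.ext fun z => ?_⟩
  obtain ⟨s, rfl⟩ := Ideal.Quotient.mk_surjective z
  have h2 : (Ideal.Quotient.mk (maximalIdeal R) s) = s • (1 : R ⧸ maximalIdeal R) := by
    rw [Algebra.smul_def, mul_one]; rfl
  rw [h2, map_smul, map_smul]
  congr 1
  apply Subtype.ext
  rw [← hy, h1, map_smul]
  rfl

variable (R) in
/-- An injective module cogenerating the category of modules over a local ring
(the injective hull of the residue field). -/
def Hull [IsLocalRing R] : Type := (exists_dual R).choose

section dual
variable [IsLocalRing R]

instance : AddCommGroup (Hull R) := (exists_dual R).choose_spec.choose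
instance : Module R (Hull R) := (exists_dual R).choose_spec.choose_spec.choose
instance : Module.Injective R (Hull R) := (exists_dual R).choose_spec.choose_spec.choose_spec.1
instance : Module.Finite R ((R ⧸ maximalIdeal R) →ₗ[R] Hull R) :=
  (exists_dual R).choose_spec.choose_spec.choose_spec.2.1

variable (R) in
/-- The Matlis dual. -/
abbrev Dual (X : Type) [AddCommGroup X] [Module R X] : Type := X →ₗ[R] Hull R

variable {A B C N X : Type} [AddCommGroup A] [AddCommGroup B] [AddCommGroup C] [AddCommGroup N]
    [AddCommGroup X] [Module R A] [Module R B] [Module R C] [Module R N] [Module R X]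

variable (R) in
lemma exists_dual_ne_zero {z : X} (hz : z ≠ 0) : ∃ φ : Dual R X, φ z ≠ 0 := by
  obtain ⟨f, hf⟩ : ∃ f : (R ⧸ maximalIdeal R) →ₗ[R] Hull R, Function.Injective f :=
    (exists_dual R).choose_spec.choose_spec.choose_spec.2.2
  obtain ⟨φ, hφ⟩ := exists_extend (LinearMap.toSpanSingleton R X z) (f ∘ₗ (maximalIdeal R).mkQ) (by
    intro r hr
    rw [LinearMap.mem_ker, LinearMap.toSpanSingleton_apply] at hr
    have : r ∈ maximalIdeal R := by
      rw [mem_maximalIdeal]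
      intro hu
      exact hz ((hu.smul_eq_zero).1 hr)
    rw [LinearMap.mem_ker, LinearMap.comp_apply, Submodule.mkQ_apply,
      (Submodule.Quotient.mk_eq_zero _).2 this, map_zero])
  refine ⟨φ, fun h0 => ?_⟩
  have h1 := LinearMap.congr_fun hφ 1
  rw [LinearMap.comp_apply, LinearMap.toSpanSingleton_apply, one_smul, h0, LinearMap.comp_apply] at h1
  have h2 : (maximalIdeal R).mkQ 1 = 0 := hf (by rw [← h1, map_zero])
  rw [Submodule.mkQ_apply, Submodule.Quotient.mk_eq_zero] at h2
  exact (Ideal.ne_top_iff_one _).1 (maximalIdeal.isMaximal R).ne_top h2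

lemma smul_eq_zero_of_dual {r : R} (h : ∀ φ : Dual R X, r • φ = 0) (z : X) : r • z = 0 := by
  by_contra hz
  obtain ⟨φ, hφ⟩ := exists_dual_ne_zero R hz
  exact hφ (by rw [map_smul, ← LinearMap.smul_apply, h, LinearMap.zero_apply])

/-- The dual of a finitely generated torsion module is finitely generated. -/
lemma finite_dual_of_isTors [IsNoetherianRing R] [Module.Finite R N] (hN : IsTors (maximalIdeal R) N) :
    Module.Finite R (Dual R N) := by
  have hfin := ‹Module.Finite R N›
  revert hN
  induction hfin using IsNoetherianRing.induction_on_isQuotientEquivQuotientPrime R with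
  | subsingleton N => exact fun _ => inferInstance
  | quotient N p e =>
    intro hN
    obtain ⟨n, hn⟩ := hN.exists_pow
    have hp : p.1 = maximalIdeal R := by
      rw [e.annihilator_eq, Ideal.annihilator_quotient] at hn
      have := p.2
      exact le_antisymm (le_maximalIdeal this.ne_top) (Ideal.IsPrime.le_of_pow_le hn)
    have e' : N ≃ₗ[R] R ⧸ maximalIdeal R := e.trans (Submodule.quotEquivOfEq _ _ hp)
    exact Module.Finite.equiv (e'.symm.congrLeft (Hull R) R)
  | exact N₁ N₂ N₃ f g hf hg hfg h₁ h₃ =>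
    intro hN
    have := h₁ (hN.of_injective hf)
    have := h₃ (hN.of_surjective hg)
    have := isNoetherian_of_range_eq_ker (LinearMap.lcomp R (Hull R) g) (LinearMap.lcomp R (Hull R) f) (by
      ext φ
      rw [LinearMap.mem_range, LinearMap.mem_ker]
      constructor
      · rintro ⟨ψ, rfl⟩
        ext x
        simp [hfg.apply_apply_eq_zero]
      · intro h
        obtain ⟨k, hk⟩ := exists_extend g φ (fun x hx => by
          obtain ⟨y, rfl⟩ := (hfg x).1 hx
          exact LinearMap.congr_fun h y)
        exact ⟨k, hk⟩)
    infer_instance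

end dual

instance isPrecomplete_pi (I : Ideal R) [IsPrecomplete I R] (n : ℕ) : IsPrecomplete I (Fin n → R) where
  prec' f hf := by
    have h := fun j => IsPrecomplete.prec (I := I) (M := R) inferInstance (f := fun k => f k j)
      (fun {a b} hab => by
        have := (hf hab).map (LinearMap.proj j : (Fin n → R) →ₗ[R] R)
        rw [SModEq.sub_mem] at this ⊢
        refine Submodule.smul_mono le_rfl le_top ((Submodule.map_smul'' _ _ _).le this))
    choose L hL using h
    refine ⟨L, fun k => ?_⟩
    rw [SModEq.sub_mem, pi_eq_sum_univ (f k - L)]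
    refine Submodule.sum_mem _ fun j _ => Submodule.smul_mem_smul ?_ Submodule.mem_top
    simpa [SModEq.sub_mem] using hL j k

/-- Nakayama's lemma over a complete ring. -/
lemma finite_of_finite_quotient {I : Ideal R} [IsPrecomplete I R] {N : Type} [AddCommGroup N] [Module R N]
    [IsHausdorff I N] (P : Submodule R N) (hP : P ≤ I • ⊤) [Module.Finite R (N ⧸ P)] : Module.Finite R N := by
  obtain ⟨n, f, hf⟩ := Module.Finite.exists_fin' R (N ⧸ P)
  obtain ⟨g, hg⟩ := Module.projective_lifting_property P.mkQ f P.mkQ_surjective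
  refine Module.Finite.of_surjective g (surjective_of_mkQ_comp_surjective (I := I) fun y => ?_)
  obtain ⟨y, rfl⟩ := Submodule.mkQ_surjective _ y
  obtain ⟨x, hx⟩ := hf (P.mkQ y)
  refine ⟨x, ?_⟩
  rw [← hg, LinearMap.comp_apply, Submodule.mkQ_apply, Submodule.mkQ_apply, Submodule.Quotient.eq] at hx
  rw [LinearMap.comp_apply, Submodule.mkQ_apply, Submodule.mkQ_apply, Submodule.Quotient.eq]
  exact hP hx

section
variable [IsLocalRing R] {L L₀ N : Type} [AddCommGroup L] [AddCommGroup L₀] [AddCommGroup N]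
  [Module R L] [Module R L₀] [Module R N]

lemma isHausdorff_dual (hL : IsTors (maximalIdeal R) L) : IsHausdorff (maximalIdeal R) (Dual R L) where
  haus' φ hφ := by
    ext z
    obtain ⟨n, hn⟩ := hL z
    have h := hφ n
    rw [SModEq.zero] at h
    refine Submodule.smul_induction_on (p := fun ψ : Dual R L => ψ z = (0 : Dual R L) z) h ?_ ?_
    · intro r hr ψ _
      rw [LinearMap.smul_apply, ← map_smul, hn r hr, map_zero, LinearMap.zero_apply]
    · intro ψ χ h1 h2
      rw [LinearMap.add_apply, h1, h2]; simp

/-- If multiplication by `x` on `L` has kernel covered by `L₀`, the dual of `L` is controlled by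
that of `L₀`. -/
lemma finite_dual_of_conn [IsNoetherianRing R] [IsAdicComplete (maximalIdeal R) R]
    (hL : IsTors (maximalIdeal R) L) {x : R} (hx : x ∈ maximalIdeal R) (δ : L₀ →ₗ[R] L)
    (hδ : ∀ z, x • z = 0 → z ∈ LinearMap.range δ) [Module.Finite R (Dual R L₀)] {i : ℕ}
    (hi : Module.supportDim R (Dual R L₀) ≤ i) :
    Module.Finite R (Dual R L) ∧ Module.supportDim R (Dual R L) ≤ (i + 1 : ℕ) := by
  have := isHausdorff_dual hL
  let F := LinearMap.lcomp R (Hull R) δ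
  have hP : LinearMap.ker F ≤ x • (⊤ : Submodule R (Dual R L)) := by
    intro φ hφ
    obtain ⟨ψ, hψ⟩ := exists_extend (x • LinearMap.id : L →ₗ[R] L) φ (fun z hz => by
      obtain ⟨y, rfl⟩ := hδ z (by simpa using hz)
      exact LinearMap.congr_fun hφ y)
    rw [Submodule.mem_smul_pointwise_iff_exists]
    refine ⟨ψ, Submodule.mem_top, ?_⟩
    rw [← hψ]
    ext z
    simp
  have hP' : x • (⊤ : Submodule R (Dual R L)) ≤ maximalIdeal R • ⊤ := by
    rintro _ hφ
    obtain ⟨ψ, -, rfl⟩ := Submodule.mem_smul_pointwise_iff_exists _ _ _ |>.1 hφ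
    exact Submodule.smul_mem_smul hx Submodule.mem_top
  have hinj : Function.Injective ((LinearMap.ker F).liftQ F le_rfl) := by
    rw [← LinearMap.ker_eq_bot]; exact Submodule.ker_liftQ_eq_bot _ _ _ le_rfl
  have : Module.Finite R (Dual R L ⧸ LinearMap.ker F) := Module.Finite.of_injective _ hinj
  have hfin : Module.Finite R (Dual R L) := finite_of_finite_quotient _ (hP.trans hP')
  refine ⟨hfin, (Module.supportDim_le_supportDim_quotSMulTop_succ hx).trans ?_⟩
  have h1 := (Module.supportDim_le_of_surjective _ (Submodule.factor_surjective hP)).trans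
    ((Module.supportDim_le_of_injective _ hinj).trans hi)
  push_cast
  gcongr

lemma supportDim_le_zero_of_pow_le {n : ℕ} (h : maximalIdeal R ^ n ≤ Module.annihilator R N) :
    Module.supportDim R N ≤ 0 := by
  have : Subsingleton (Module.support R N) := by
    refine ⟨fun p q => ?_⟩
    have : ∀ p : Module.support R N, p.1.asIdeal = maximalIdeal R := fun p =>
      have := p.1.2
      le_antisymm (le_maximalIdeal this.ne_top) (Ideal.IsPrime.le_of_pow_le (h.trans (Module.annihilator_le_of_mem_support p.2)))
    exact Subtype.ext (PrimeSpectrum.ext ((this p).trans (this q).symm))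
  exact Order.krullDim_nonpos_of_subsingleton

lemma dual_equiv_finite {X Y : Type} [AddCommGroup X] [AddCommGroup Y] [Module R X] [Module R Y] (e : X ≃ₗ[R] Y)
    {i : ℕ}
    (h : Module.Finite R (Dual R X) ∧ Module.supportDim R (Dual R X) ≤ (i : ℕ)) :
    Module.Finite R (Dual R Y) ∧ Module.supportDim R (Dual R Y) ≤ (i : ℕ) := by
  have e' : Dual R X ≃ₗ[R] Dual R Y := e.congrLeft (Hull R) R
  have := h.1
  exact ⟨Module.Finite.equiv e', (Module.supportDim_eq_of_equiv e').symm.le.trans h.2⟩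

/-- The dual of local cohomology with support in the maximal ideal of a finitely generated module
over a complete local ring is finitely generated, with dimension bounded by the degree. -/
theorem finite_dual_LC [IsNoetherianRing R] [IsAdicComplete (maximalIdeal R) R] (i : ℕ) (N : Type)
    [AddCommGroup N] [Module R N] [Module.Finite R N] :
    Module.Finite R (Dual R (LC (maximalIdeal R) i N)) ∧
      Module.supportDim R (Dual R (LC (maximalIdeal R) i N)) ≤ i := by
  induction i generalizing N with
  | zero =>
    have ht := LC.isTors (maximalIdeal R) 0 N
    have hfin : Module.Finite R (LC (maximalIdeal R) 0 N) :=
      Module.Finite.of_injective _ (LC.ev_injective (maximalIdeal R) N)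
    refine ⟨finite_dual_of_isTors ht, ?_⟩
    obtain ⟨n, hn⟩ := ht.exists_pow
    refine supportDim_le_zero_of_pow_le (n := n) (hn.trans fun r hr => ?_)
    rw [Module.mem_annihilator] at hr ⊢
    intro φ
    ext z
    rw [LinearMap.smul_apply, ← map_smul, hr, map_zero, LinearMap.zero_apply]
  | succ i ih =>
    refine dual_equiv_finite (LinearEquiv.ofBijective _ (LC.map_mkQ_tors_bijective (maximalIdeal R) i N)).symm ?_
    obtain ⟨x, hx, hreg⟩ := exists_isSMulRegular (N := N ⧸ tors (maximalIdeal R) N) (maximalIdeal R)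
      (torsionFree_quotient_tors _)
    have ses := SES.of_isSMulRegular hreg
    obtain ⟨h1, h2⟩ := ih ((N ⧸ tors (maximalIdeal R) N) ⧸ x • (⊤ : Submodule R (N ⧸ tors (maximalIdeal R) N)))
    refine finite_dual_of_conn (LC.isTors _ _ _) hx (LC.conn (maximalIdeal R) i ses) (fun z hz => ?_) h2
    exact (LC.exact₁ _ i ses z).1 (by rw [LC.map_smul_id, hz])

end

section top
variable [IsNoetherianRing R] {A B N : Type} [AddCommGroup A] [AddCommGroup B] [AddCommGroup N] [Module R A] [Module R B] [Module R N]

/-- The local cohomology in the dimension is right exact. -/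
lemma LC.map_surjective_top (I : Ideal R) [Module.Finite R A] {d : ℕ} (hA : Module.supportDim R A ≤ d)
    {f : A →ₗ[R] B} (hf : Function.Surjective f) : Function.Surjective (LC.map I d f) := by
  have h : Module.supportDim R (LinearMap.ker f) < ((d + 1 : ℕ) : WithBot ℕ∞) :=
    (Module.supportDim_le_of_injective (LinearMap.ker f).subtype Subtype.val_injective).trans_lt
      (hA.trans_lt (by exact_mod_cast Nat.lt_succ_self d))
  have := LC.subsingleton_of_supportDim_lt I (d + 1) _ h
  exact LC.map_surjective_of_subsingleton I d (SES.of_surjective hf)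

lemma LC.smul_surjective_top (I : Ideal R) [Module.Finite R N] {d : ℕ} (hN : Module.supportDim R N ≤ d)
    (x : R) (h : Subsingleton (LC I d (N ⧸ x • (⊤ : Submodule R N)))) (z : LC I d N) :
    ∃ w, x • w = z := by
  let f : N →ₗ[R] (x • (⊤ : Submodule R N) : Submodule R N) :=
    (x • LinearMap.id : N →ₗ[R] N).codRestrict _ (fun y => by
      simpa using Submodule.smul_mem_pointwise_smul y x ⊤ Submodule.mem_top)
  have hf : Function.Surjective f := by
    rintro ⟨y, hy⟩
    obtain ⟨w, -, rfl⟩ := (Submodule.mem_smul_pointwise_iff_exists _ _ _).1 hy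
    exact ⟨w, rfl⟩
  obtain ⟨u, rfl⟩ := LC.map_surjective_left I d (SES.of_submodule (x • (⊤ : Submodule R N))) z
  obtain ⟨w, rfl⟩ := LC.map_surjective_top I hN hf u
  refine ⟨w, ?_⟩
  rw [← LC.map_smul_id, ← LC.map_comp]
  rfl

end top

section dim

lemma supportDim_quotient_anti {I I' : Ideal R} (h : I ≤ I') :
    Module.supportDim R (R ⧸ I') ≤ Module.supportDim R (R ⧸ I) :=
  Module.supportDim_le_of_surjective _ (Submodule.factor_surjective h)

lemma isSMulRegular_quotient_prime {p : Ideal R} [hp : p.IsPrime] {x : R} (hx : x ∉ p) :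
    IsSMulRegular (R ⧸ p) x := by
  rw [isSMulRegular_iff_right_eq_zero_of_smul]
  intro z hz
  obtain ⟨z, rfl⟩ := Submodule.Quotient.mk_surjective _ z
  rw [← Submodule.Quotient.mk_smul, Submodule.Quotient.mk_eq_zero] at hz
  rw [Submodule.Quotient.mk_eq_zero]
  exact (hp.mem_or_mem hz).resolve_left hx

lemma exists_surjective_quotient_smul {p q : Ideal R} (h : p ≤ q) {x : R} (hx : x ∈ q) :
    ∃ f : ((R ⧸ p) ⧸ x • (⊤ : Submodule R (R ⧸ p))) →ₗ[R] R ⧸ q, Function.Surjective f := by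
  refine ⟨Submodule.liftQ _ (Submodule.factor h) ?_, fun y => ?_⟩
  · intro y hy
    obtain ⟨w, -, rfl⟩ := (Submodule.mem_smul_pointwise_iff_exists _ _ _).1 hy
    obtain ⟨w, rfl⟩ := Submodule.Quotient.mk_surjective _ w
    rw [LinearMap.mem_ker, ← Submodule.Quotient.mk_smul]
    exact (Submodule.Quotient.mk_eq_zero q).2 (q.mul_mem_right _ hx)
  · obtain ⟨y, rfl⟩ := Submodule.factor_surjective h y
    exact ⟨Submodule.Quotient.mk y, rfl⟩

lemma supportDim_lt_of_prime_lt [IsNoetherianRing R] {p q : Ideal R} [hp : p.IsPrime] (h : p < q) :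
    Module.supportDim R (R ⧸ q) + 1 ≤ Module.supportDim R (R ⧸ p) := by
  obtain ⟨x, hx, hxp⟩ := SetLike.exists_of_lt h
  obtain ⟨f, hf⟩ := exists_surjective_quotient_smul h.le hx
  refine le_trans ?_ (supportDim_quotient_smul (isSMulRegular_quotient_prime hxp))
  gcongr
  exact Module.supportDim_le_of_surjective f hf

lemma supportDim_le_sup_span [IsNoetherianRing R] [IsLocalRing R] (I : Ideal R) {x : R} (hx : x ∈ maximalIdeal R) :
    Module.supportDim R (R ⧸ I) ≤ Module.supportDim R (R ⧸ (I ⊔ Ideal.span {x})) + 1 := by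
  refine (Module.supportDim_le_supportDim_quotSMulTop_succ hx).trans ?_
  gcongr
  let f : R →ₗ[R] (R ⧸ I) ⧸ x • (⊤ : Submodule R (R ⧸ I)) := Submodule.mkQ _ ∘ₗ Submodule.mkQ I
  have hf : I ⊔ Ideal.span {x} ≤ LinearMap.ker f := ?_
  · refine Module.supportDim_le_of_surjective (Submodule.liftQ _ f hf) ?_
    intro y
    obtain ⟨y, rfl⟩ := Submodule.Quotient.mk_surjective _ y
    obtain ⟨y, rfl⟩ := Submodule.Quotient.mk_surjective _ y
    exact ⟨Submodule.Quotient.mk y, rfl⟩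
  · refine sup_le (fun y hy => ?_) ((Ideal.span_singleton_le_iff_mem _).2 ?_)
    · change (x • (⊤ : Submodule R (R ⧸ I))).mkQ (Submodule.Quotient.mk y) = 0
      rw [(Submodule.Quotient.mk_eq_zero I).2 hy, map_zero]
    · have h1 : (Submodule.Quotient.mk x : R ⧸ I) = x • Submodule.Quotient.mk (1 : R) := by
        rw [← Submodule.Quotient.mk_smul, smul_eq_mul, mul_one]
      change (x • (⊤ : Submodule R (R ⧸ I))).mkQ (Submodule.Quotient.mk x) = 0
      rw [h1]
      exact (Submodule.Quotient.mk_eq_zero (x • (⊤ : Submodule R (R ⧸ I)))).2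
        (Submodule.smul_mem_pointwise_smul _ _ _ Submodule.mem_top)

lemma mem_support_quotient {I : Ideal R} {q : PrimeSpectrum R} :
    q ∈ Module.support R (R ⧸ I) ↔ I ≤ q.asIdeal := by
  rw [Module.mem_support_iff_of_finite, Ideal.annihilator_quotient]

/-- The dimension of a finitely generated module is attained at some prime of its support. -/
lemma exists_prime_of_le_supportDim {N : Type} [AddCommGroup N] [Module R N] {n : ℕ}
    (h : n ≤ Module.supportDim R N) :
    ∃ q ∈ Module.support R N, n ≤ Module.supportDim R (R ⧸ q.asIdeal) := by
  obtain ⟨l, hl⟩ := Order.le_krullDim_iff.1 h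
  refine ⟨l.head.1, l.head.2, Order.le_krullDim_iff.2 ⟨⟨l.length, fun i => ⟨(l i).1, ?_⟩, fun i => l.step i⟩, hl⟩⟩
  rw [mem_support_quotient]
  exact (l.monotone (Fin.zero_le i) : l.head ≤ l i)

lemma supportDim_quotient_le_of_mem_support {N : Type} [AddCommGroup N] [Module R N] [Module.Finite R N]
    {q : PrimeSpectrum R} (hq : q ∈ Module.support R N) :
    Module.supportDim R (R ⧸ q.asIdeal) ≤ Module.supportDim R N := by
  refine Order.krullDim_le_of_strictMono (fun a => ⟨a.1, ?_⟩) (fun {_ _} h => h)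
  rw [Module.mem_support_iff_of_finite] at hq ⊢
  exact hq.trans (mem_support_quotient.1 a.2)

lemma zero_le_supportDim {I : Ideal R} (h : I ≠ ⊤) : 0 ≤ Module.supportDim R (R ⧸ I) := by
  have : Nontrivial (R ⧸ I) := Ideal.Quotient.nontrivial_iff.2 h
  have := Module.supportDim_ne_bot_of_nontrivial R (R ⧸ I)
  obtain ⟨k, hk⟩ := WithBot.ne_bot_iff_exists.1 this
  rw [← hk]
  exact WithBot.coe_le_coe.2 zero_le

lemma le_of_add_one_le {D : WithBot ℕ∞} {n : ℕ} (h : D + 1 ≤ ((n + 1 : ℕ) : WithBot ℕ∞)) : D ≤ n := by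
  cases D with
  | bot => exact bot_le
  | coe k =>
    have h' : k + 1 ≤ ((n + 1 : ℕ) : ℕ∞) := WithBot.coe_le_coe.1 h
    push_cast at h'
    exact WithBot.coe_le_coe.2 ((ENat.add_le_add_iff_right (by simp)).1 h')

lemma le_of_le_add_one {D : WithBot ℕ∞} {n : ℕ} (h : ((n + 1 : ℕ) : WithBot ℕ∞) ≤ D + 1) : (n : WithBot ℕ∞) ≤ D := by
  cases D with
  | bot => exact absurd h (by rw [WithBot.bot_add]; exact not_le.2 (WithBot.bot_lt_coe _))
  | coe k =>
    have h' : ((n + 1 : ℕ) : ℕ∞) ≤ k + 1 := WithBot.coe_le_coe.1 h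
    push_cast at h'
    exact WithBot.coe_le_coe.2 ((ENat.add_le_add_iff_right (by simp)).1 h')

lemma supportDim_maximalIdeal_le [IsLocalRing R] {I : Ideal R}
    (h : ∀ q : Ideal R, q.IsPrime → I ≤ q → q = maximalIdeal R) : Module.supportDim R (R ⧸ I) ≤ 0 := by
  by_contra! hc
  have : ((1 : ℕ) : WithBot ℕ∞) ≤ Module.supportDim R (R ⧸ I) := by
    cases hD : Module.supportDim R (R ⧸ I) with
    | bot => rw [hD] at hc; exact absurd hc (by simp)
    | coe k =>
      rw [hD] at hc
      have h' : 0 < k := WithBot.coe_lt_coe.1 hc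
      exact WithBot.coe_le_coe.2 (by simpa using Order.one_le_iff_pos.2 h')
  obtain ⟨l, hl⟩ := Order.le_krullDim_iff.1 this
  have hm := fun i => h _ (l i).1.2 (mem_support_quotient.1 (l i).2)
  have : l.head < l.last := l.strictMono (Fin.lt_def.2 (by simp [hl]))
  refine this.ne (Subtype.ext (PrimeSpectrum.ext ?_))
  exact (hm _).trans (hm _).symm

end dim

lemma LC.subsingleton_zero_of_prime {p a : Ideal R} [hp : p.IsPrime] (h : ¬ a ≤ p) :
    Subsingleton (LC a 0 (R ⧸ p)) := by
  obtain ⟨x, hx, hxp⟩ := SetLike.not_le_iff_exists.1 h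
  refine subsingleton_of_forall_eq 0 fun z => eq_zero_of_smul_injective hx (LC.isTors a 0 _) (fun w hw => ?_) z
  apply LC.ev_injective
  rw [LinearMap.map_zero]
  refine isSMulRegular_iff_right_eq_zero_of_smul.1 (isSMulRegular_quotient_prime hxp) _ ?_
  rw [← LinearMap.map_smul, hw, LinearMap.map_zero]

section nonvanishing
variable [IsLocalRing R] [IsNoetherianRing R]

/-- Existence of a prime one step above `p` avoiding a given element. -/
lemma exists_prime_gt_notMem {p : Ideal R} [hp : p.IsPrime] {d : ℕ}
    (hd : Module.supportDim R (R ⧸ p) = (d + 1 : ℕ)) {y : R} (hy : y ∉ p) (h0 : d = 0 → IsUnit y) :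
    ∃ q : Ideal R, q.IsPrime ∧ p < q ∧ y ∉ q ∧ Module.supportDim R (R ⧸ q) = d := by
  have hpm : p < maximalIdeal R := lt_of_le_of_ne (le_maximalIdeal hp.ne_top) (by
    rintro rfl
    have := supportDim_maximalIdeal_le (R := R) (I := maximalIdeal R) (fun q hq h =>
      ((maximalIdeal.isMaximal R).eq_of_le hq.ne_top h).symm)
    rw [hd] at this
    exact absurd this (not_le.2 (by exact_mod_cast Nat.succ_pos d)))
  have hle : ∀ q : Ideal R, p < q → Module.supportDim R (R ⧸ q) ≤ d := fun q hq =>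
    le_of_add_one_le ((supportDim_lt_of_prime_lt hq).trans hd.le)
  rcases Nat.eq_zero_or_pos d with rfl | hdpos
  · refine ⟨maximalIdeal R, inferInstance, hpm, ?_, le_antisymm (hle _ hpm)
      (zero_le_supportDim (maximalIdeal.isMaximal R).ne_top)⟩
    rw [mem_maximalIdeal, mem_nonunits_iff, not_not]
    exact h0 rfl
  have hfin := Ideal.finite_minimalPrimes_of_isNoetherianRing R (p ⊔ Ideal.span {y})
  have hnot : ¬ ((maximalIdeal R : Set R) ⊆ ⋃ q ∈ (p ⊔ Ideal.span {y}).minimalPrimes ∪ {p}, ((id q : Ideal R) : Set R)) := by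
    rw [Ideal.subset_union_prime_finite (hfin.union (Set.finite_singleton p)) (f := id) p p]
    · rintro ⟨q, hq | hq, hm⟩
      · have hqm : q = maximalIdeal R := le_antisymm (le_maximalIdeal hq.1.1.ne_top) hm
        subst hqm
        have hym : y ∈ maximalIdeal R := hq.1.2 (Ideal.mem_sup_right (Ideal.mem_span_singleton_self y))
        have h1 := supportDim_maximalIdeal_le (R := R) (I := p ⊔ Ideal.span {y}) (fun q' hq' h =>
          le_antisymm (le_maximalIdeal hq'.ne_top) (hq.2 ⟨hq', h⟩ (le_maximalIdeal hq'.ne_top)))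
        have h2 := supportDim_le_sup_span p hym
        rw [hd] at h2
        have h3 := (le_of_le_add_one h2).trans h1
        exact absurd h3 (not_le.2 (by exact_mod_cast hdpos))
      · rw [Set.mem_singleton_iff] at hq
        subst hq
        exact hpm.not_ge hm
    · rintro q (hq | hq) _ _
      · exact hq.1.1
      · rw [Set.mem_singleton_iff] at hq
        subst hq
        exact hp
  obtain ⟨x, hxm, hx⟩ := Set.not_subset.1 hnot
  simp only [Set.mem_iUnion, not_exists, id] at hx
  have hxp : x ∉ p := hx p (Or.inr rfl)
  obtain ⟨q, hq, hqd⟩ := exists_prime_of_le_supportDim (le_of_le_add_one (hd.symm.le.trans (supportDim_le_sup_span p hxm)))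
  rw [mem_support_quotient] at hq
  have hxq : x ∈ q.asIdeal := hq (Ideal.mem_sup_right (Ideal.mem_span_singleton_self x))
  have hpq : p < q.asIdeal := lt_of_le_of_ne (le_sup_left.trans hq) (by rintro rfl; exact hxp hxq)
  refine ⟨q.asIdeal, q.2, hpq, fun hyq => ?_, le_antisymm (hle _ hpq) hqd⟩
  obtain ⟨q', hq', hqq⟩ := Ideal.exists_minimalPrimes_le (I := p ⊔ Ideal.span {y}) (J := q.asIdeal)
    (sup_le hpq.le ((Ideal.span_singleton_le_iff_mem _).2 hyq))
  have hxq' : x ∉ q' := hx q' (Or.inl hq')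
  have := hq'.1.1
  have h1 : q' < q.asIdeal := lt_of_le_of_ne hqq (by rintro h; exact hxq' (h ▸ hxq))
  have h2 : p < q' := lt_of_le_of_ne (le_sup_left.trans hq'.1.2) (by
    rintro rfl; exact hy (hq'.1.2 (Ideal.mem_sup_right (Ideal.mem_span_singleton_self y))))
  have h3 := (supportDim_lt_of_prime_lt h1).trans (hle _ h2)
  have h4 : ((d + 1 : ℕ) : WithBot ℕ∞) ≤ d := by
    refine le_trans ?_ h3
    push_cast
    gcongr
  exact absurd h4 (not_le.2 (by exact_mod_cast Nat.lt_succ_self d))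

/-- Grothendieck non-vanishing for prime cyclic modules over a complete local ring. -/
theorem LC.not_subsingleton_of_prime [IsAdicComplete (maximalIdeal R) R] (d : ℕ) (p : Ideal R)
    [hp : p.IsPrime] (hd : Module.supportDim R (R ⧸ p) = d) :
    ¬ Subsingleton (LC (maximalIdeal R) d (R ⧸ p)) := by
  induction d generalizing p with
  | zero =>
    intro hs
    have hpm : p = maximalIdeal R := by
      by_contra hne
      have := supportDim_lt_of_prime_lt (lt_of_le_of_ne (le_maximalIdeal hp.ne_top) hne)
      rw [hd] at this
      have h2 := zero_le_supportDim (maximalIdeal.isMaximal R).ne_top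
      have h3 : (1 : WithBot ℕ∞) ≤ ((0 : ℕ) : WithBot ℕ∞) := by
        refine le_trans ?_ this
        simpa using add_le_add_left h2 1
      exact absurd h3 (by simp)
    have h1 : (1 : R ⧸ p) ∈ LinearMap.range (ev (maximalIdeal R) (R ⧸ p)) := by
      refine mem_range_ev.2 ⟨1, fun r hr => ?_⟩
      rw [pow_one, ← hpm] at hr
      rw [Algebra.smul_def, mul_one]
      exact Ideal.Quotient.eq_zero_iff_mem.2 hr
    obtain ⟨z, hz⟩ := h1
    rw [Subsingleton.elim z 0, LinearMap.map_zero] at hz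
    exact zero_ne_one hz
  | succ d ih =>
    intro hs
    obtain ⟨y, hy, h0, hky⟩ : ∃ y, y ∉ p ∧ (d = 0 → IsUnit y) ∧ ∀ z : LC (maximalIdeal R) d (R ⧸ p), y • z = 0 := by
      rcases Nat.eq_zero_or_pos d with rfl | hdpos
      · refine ⟨1, (Ideal.ne_top_iff_one p).1 hp.ne_top, fun _ => isUnit_one, fun z => ?_⟩
        have := LC.subsingleton_zero_of_prime (a := maximalIdeal R) (p := p) (fun hm => by
          have hpm : maximalIdeal R = p := le_antisymm hm (le_maximalIdeal hp.ne_top)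
          have := supportDim_maximalIdeal_le (R := R) (I := p) (fun q hq h => by
            rw [← hpm] at h
            exact ((maximalIdeal.isMaximal R).eq_of_le hq.ne_top h).symm)
          rw [hd] at this
          exact absurd this (by simp))
        exact Subsingleton.elim _ _
      · obtain ⟨h1, h2⟩ := finite_dual_LC (R := R) d (R ⧸ p)
        by_contra! hc
        have hann : Module.annihilator R (Dual R (LC (maximalIdeal R) d (R ⧸ p))) ≤ p := by
          intro y hy
          by_contra hyp
          obtain ⟨z, hz⟩ := hc y hyp (fun h => by omega)
          exact hz (smul_eq_zero_of_dual (fun φ => Module.mem_annihilator.1 hy φ) z)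
        have h3 := supportDim_quotient_le_of_mem_support (q := ⟨p, hp⟩)
          (Module.mem_support_iff_of_finite.2 hann)
        have h4 := hd.symm.le.trans (h3.trans h2)
        exact absurd h4 (not_le.2 (by exact_mod_cast Nat.lt_succ_self d))
    obtain ⟨q, hq, hpq, hyq, hqd⟩ := exists_prime_gt_notMem hd hy h0
    refine ih q hqd ?_
    obtain ⟨x, hx, hxp⟩ := SetLike.exists_of_lt hpq
    obtain ⟨f, hf⟩ := exists_surjective_quotient_smul hpq.le hx
    have hreg := isSMulRegular_quotient_prime hxp
    have s1 := LC.map_surjective_of_subsingleton (maximalIdeal R) d (SES.of_isSMulRegular hreg)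
    have s2 := LC.map_surjective_top (maximalIdeal R) (d := d)
      (le_of_add_one_le ((supportDim_quotient_smul hreg).trans hd.le)) hf
    have hkill : ∀ z : LC (maximalIdeal R) d (R ⧸ q), y • z = 0 := by
      intro z
      obtain ⟨z, rfl⟩ := s2 z
      obtain ⟨z, rfl⟩ := s1 z
      rw [← LinearMap.map_smul, ← LinearMap.map_smul, hky, LinearMap.map_zero, LinearMap.map_zero]
    have hlt : Module.supportDim R ((R ⧸ q) ⧸ y • (⊤ : Submodule R (R ⧸ q))) < d := by
      have := supportDim_quotient_smul (isSMulRegular_quotient_prime (p := q) hyq)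
      rw [hqd] at this
      exact dim_lt this (by exact_mod_cast Nat.lt_succ_self d)
    have := LC.subsingleton_of_supportDim_lt (maximalIdeal R) d _ hlt
    refine subsingleton_of_forall_eq 0 fun z => ?_
    obtain ⟨w, rfl⟩ := LC.smul_surjective_top (maximalIdeal R) hqd.le y this z
    exact hkill w

end nonvanishing

section functional

/-- A finitely generated module whose annihilator lies in the prime `p` maps nontrivially to `R ⧸ p`. -/
lemma exists_functional {M : Type} [AddCommGroup M] [Module R M] [Module.Finite R M] (p : Ideal R)
    [hp : p.IsPrime] (h : Module.annihilator R M ≤ p) : ∃ f : M →ₗ[R] R ⧸ p, f ≠ 0 := by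
  have hs : (⟨p, hp⟩ : PrimeSpectrum R) ∈ Module.support R M := Module.mem_support_iff_of_finite.2 h
  have hV : Nontrivial (TensorProduct R p.ResidueField M) :=
    (Module.mem_support_iff_nontrivial_residueField_tensorProduct ⟨p, hp⟩).1 hs
  obtain ⟨v, hv⟩ := exists_ne (0 : TensorProduct R p.ResidueField M)
  obtain ⟨l, hl⟩ := not_forall.1 (mt (Module.forall_dual_apply_eq_zero_iff p.ResidueField v).1 hv)
  let g : M →ₗ[R] p.ResidueField := (l.restrictScalars R) ∘ₗ TensorProduct.mk R p.ResidueField M 1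
  obtain ⟨x, hx⟩ : ∃ x, g x ≠ 0 := by
    by_contra! hg
    apply hl
    clear hl hv
    induction v using TensorProduct.induction_on with
    | zero => exact map_zero l
    | tmul c x =>
      have : c ⊗ₜ[R] x = c • ((1 : p.ResidueField) ⊗ₜ[R] x) := by
        rw [TensorProduct.smul_tmul', smul_eq_mul, mul_one]
      rw [this, map_smul, show l ((1 : p.ResidueField) ⊗ₜ[R] x) = 0 from hg x, smul_zero]
    | add v w h1 h2 => rw [map_add, h1, h2, add_zero]
  obtain ⟨s, hs⟩ := Module.Finite.fg_top (R := R) (M := M)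
  obtain ⟨c, hc⟩ := IsLocalization.exist_integer_multiples (nonZeroDivisors (R ⧸ p)) s g
  let k : (R ⧸ p) →ₗ[R] p.ResidueField := (IsScalarTower.toAlgHom R (R ⧸ p) p.ResidueField).toLinearMap
  have hk : Function.Injective k := IsFractionRing.injective (R ⧸ p) p.ResidueField
  obtain ⟨c', hc'⟩ := Ideal.Quotient.mk_surjective (c : R ⧸ p)
  have hmem : ∀ y, c' • g y ∈ LinearMap.range k := by
    intro y
    have : (⊤ : Submodule R M) ≤ (LinearMap.range k).comap (c' • g) := by
      rw [← hs, Submodule.span_le]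
      intro y hy
      obtain ⟨z, hz⟩ := hc y hy
      refine ⟨z, hz.trans ?_⟩
      rw [← hc']
      exact (IsScalarTower.algebraMap_smul (R ⧸ p) c' (g y))
    exact this (Submodule.mem_top (x := y))
  let f : M →ₗ[R] R ⧸ p := (LinearEquiv.ofInjective k hk).symm.toLinearMap ∘ₗ (c' • g).codRestrict _ hmem
  refine ⟨f, fun hf => ?_⟩
  have h1 : k (f x) = c' • g x := by
    have := congrArg Subtype.val ((LinearEquiv.ofInjective k hk).apply_symm_apply (⟨c' • g x, hmem x⟩))
    exact this
  rw [hf, LinearMap.zero_apply, map_zero, ← IsScalarTower.algebraMap_smul (R ⧸ p) c' (g x)] at h1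
  refine (smul_ne_zero ?_ hx) h1.symm
  rw [Ideal.Quotient.algebraMap_eq, hc']
  exact nonZeroDivisors.ne_zero c.2

end functional

section chevalley
variable [IsLocalRing R] [IsNoetherianRing R]

lemma exists_sup_pow_eq (b : ℕ → Ideal R) (hb : Antitone b) (k : ℕ) :
    ∃ N, ∀ n, N ≤ n → b n ⊔ maximalIdeal R ^ k = b N ⊔ maximalIdeal R ^ k := by
  rcases Nat.eq_zero_or_pos k with rfl | hk
  · exact ⟨0, fun n _ => by simp⟩
  have : IsArtinianRing (R ⧸ maximalIdeal R ^ k) :=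
    quotient_artinian_of_mem_minimalPrimes_of_isLocalRing _
      ⟨⟨inferInstance, Ideal.pow_le_self hk.ne'⟩, fun q hq _ => hq.1.le_of_pow_le hq.2⟩
  let f : ℕ →o (Submodule (R ⧸ maximalIdeal R ^ k) (R ⧸ maximalIdeal R ^ k))ᵒᵈ :=
    { toFun n := (b n).map (Ideal.Quotient.mk (maximalIdeal R ^ k))
      monotone' i j e := Ideal.map_mono (hb e) }
  obtain ⟨N, hN⟩ := IsArtinian.monotone_stabilizes f
  refine ⟨N, fun n hn => ?_⟩
  have h : (b N).map (Ideal.Quotient.mk (maximalIdeal R ^ k)) = (b n).map (Ideal.Quotient.mk (maximalIdeal R ^ k)) := hN n hn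
  have := congrArg (Ideal.comap (Ideal.Quotient.mk (maximalIdeal R ^ k))) h
  rw [Ideal.comap_map_of_surjective' _ Ideal.Quotient.mk_surjective, Ideal.mk_ker,
    Ideal.comap_map_of_surjective' _ Ideal.Quotient.mk_surjective, Ideal.mk_ker] at this
  exact this.symm

lemma mem_of_forall_mem_sup_pow {b : Ideal R} {x : R} (h : ∀ n, x ∈ b ⊔ maximalIdeal R ^ n) : x ∈ b := by
  have h1 : IsHausdorff (maximalIdeal R) (R ⧸ b) := inferInstance
  rw [← Submodule.Quotient.mk_eq_zero]
  refine h1.haus _ fun n => ?_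
  rw [SModEq.zero]
  obtain ⟨u, hu, v, hv, rfl⟩ := Submodule.mem_sup.1 (h n)
  have : (Submodule.Quotient.mk (u + v) : R ⧸ b) = v • Submodule.Quotient.mk (1 : R) := by
    rw [Submodule.Quotient.mk_add, (Submodule.Quotient.mk_eq_zero b).2 hu, zero_add,
      ← Submodule.Quotient.mk_smul, smul_eq_mul, mul_one]
  rw [this]
  exact Submodule.smul_mem_smul hv Submodule.mem_top

/-- Chevalley's theorem. -/
theorem exists_le_maximalIdeal_pow [IsAdicComplete (maximalIdeal R) R] (b : ℕ → Ideal R)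
    (hb : Antitone b) (h : ∀ x, (∀ n, x ∈ b n) → x = 0) (j : ℕ) : ∃ n, b n ≤ maximalIdeal R ^ j := by
  by_contra! hc
  let m := maximalIdeal R
  have hstep : ∀ k x, (∀ n, x ∈ b n ⊔ m ^ k) → ∃ y, (∀ n, y ∈ b n ⊔ m ^ (k + 1)) ∧ x - y ∈ m ^ k := by
    intro k x hx
    obtain ⟨N, hN⟩ := exists_sup_pow_eq b hb (k + 1)
    obtain ⟨u, hu, v, hv, rfl⟩ := Submodule.mem_sup.1 (hx N)
    refine ⟨u, fun n => ?_, by simpa using hv⟩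
    rcases le_total N n with hn | hn
    · rw [hN n hn]
      exact Ideal.mem_sup_left hu
    · exact Ideal.mem_sup_left (hb hn hu)
  obtain ⟨x, hx, hxj⟩ : ∃ x, (∀ n, x ∈ b n ⊔ m ^ j) ∧ x ∉ m ^ j := by
    obtain ⟨N, hN⟩ := exists_sup_pow_eq b hb j
    obtain ⟨x, hx, hxj⟩ := SetLike.not_le_iff_exists.1 (hc N)
    refine ⟨x, fun n => ?_, hxj⟩
    rcases le_total N n with hn | hn
    · rw [hN n hn]
      exact Ideal.mem_sup_left hx
    · exact Ideal.mem_sup_left (hb hn hx)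
  choose! g hg1 hg2 using hstep
  let s : ℕ → R := fun i => Nat.rec x (fun i y => g (j + i) y) i
  have hs : ∀ i n, s i ∈ b n ⊔ m ^ (j + i) := by
    intro i
    induction i with
    | zero => exact hx
    | succ i ih => exact hg1 (j + i) (s i) ih
  have hs' : ∀ i, s i - s (i + 1) ∈ m ^ (j + i) := fun i => hg2 (j + i) (s i) (hs i)
  have hs'' : ∀ i k, i ≤ k → s i - s k ∈ m ^ (j + i) := by
    intro i k hik
    induction k, hik using Nat.le_induction with
    | base => simp
    | succ k hk ih =>
      rw [← sub_add_sub_cancel (s i) (s k)]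
      exact add_mem ih (Ideal.pow_le_pow_right (by omega) (hs' k))
  obtain ⟨L, hL⟩ := (inferInstance : IsPrecomplete m R).prec' s (fun {i k} hik => by
    rw [SModEq.sub_mem]
    simpa using Ideal.pow_le_pow_right (by omega) (hs'' i k hik))
  have hL' : ∀ i, s i - L ∈ m ^ i := fun i => by simpa using SModEq.sub_mem.1 (hL i)
  have hL0 : L = 0 := h L fun n => mem_of_forall_mem_sup_pow fun i => by
    have : L = s i - (s i - L) := by ring
    rw [this]
    exact sub_mem ((sup_le_sup_left (Ideal.pow_le_pow_right (Nat.le_add_left i j)) (b n) : b n ⊔ m ^ (j + i) ≤ b n ⊔ m ^ i) (hs i n)) (Ideal.mem_sup_right (hL' i))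
  apply hxj
  have h1 := hs'' 0 j (Nat.zero_le j)
  have h2 := hL' j
  rw [hL0, sub_zero] at h2
  have : x = (s 0 - s j) + s j := by simp [s]
  rw [this]
  exact add_mem h1 h2

/-- Powers of a non-maximal ideal are cofinal with `𝔪`-saturated ideals, in a complete local domain. -/
lemma exists_saturated_between [IsDomain R] [IsAdicComplete (maximalIdeal R) R] {a P : Ideal R} [hP : P.IsPrime]
    (haP : a ≤ P) (hPm : P ≠ maximalIdeal R) (n : ℕ) :
    ∃ k, n ≤ k ∧ ∃ b : Ideal R, a ^ k ≤ b ∧ b ≤ a ^ n ∧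
      ∀ (x : R ⧸ b) (j : ℕ), (∀ r ∈ maximalIdeal R ^ j, r • x = 0) → x = 0 := by
  let m := maximalIdeal R
  let b : ℕ → Ideal R := fun n => (tors m (R ⧸ a ^ n)).comap (a ^ n).mkQ
  have hmem : ∀ n x, x ∈ b n ↔ ∃ k, ∀ r ∈ m ^ k, r * x ∈ a ^ n := by
    intro n x
    simp only [b, Submodule.mem_comap, mem_tors]
    refine exists_congr fun k => forall₂_congr fun r _ => ?_
    rw [← map_smul, Submodule.mkQ_apply, Submodule.Quotient.mk_eq_zero, smul_eq_mul]
  have hb : Antitone b := fun i k hik x hx => by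
    rw [hmem] at hx ⊢
    exact hx.imp fun t ht r hr => Ideal.pow_le_pow_right hik (ht r hr)
  have hle : ∀ n, a ^ n ≤ b n := fun n x hx => (hmem n x).2 ⟨0, fun r _ => Ideal.mul_mem_left _ _ hx⟩
  obtain ⟨t, htm, htP⟩ := SetLike.exists_of_lt (lt_of_le_of_ne (le_maximalIdeal hP.ne_top) hPm)
  have hinter : ∀ x, (∀ n, x ∈ b n) → x = 0 := by
    intro x hx
    have hinj : Function.Injective (algebraMap R (Localization.AtPrime P)) :=
      IsLocalization.injective _ P.primeCompl_le_nonZeroDivisors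
    apply hinj
    rw [map_zero]
    have h1 := Ideal.iInf_pow_eq_bot_of_isLocalRing (maximalIdeal (Localization.AtPrime P))
      (maximalIdeal.isMaximal _).ne_top
    rw [← Ideal.mem_bot, ← h1, Ideal.mem_iInf]
    intro n
    obtain ⟨k, hk⟩ := (hmem n x).1 (hx n)
    have h2 : algebraMap R (Localization.AtPrime P) (t ^ k * x) ∈ maximalIdeal (Localization.AtPrime P) ^ n := by
      rw [← Localization.AtPrime.map_eq_maximalIdeal, ← Ideal.map_pow]
      exact Ideal.mem_map_of_mem _ (Ideal.pow_right_mono haP n (hk _ (Ideal.pow_mem_pow htm k)))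
    have h3 : IsUnit (algebraMap R (Localization.AtPrime P) (t ^ k)) :=
      IsLocalization.map_units (M := P.primeCompl) _ ⟨t ^ k, fun h => htP (hP.mem_of_pow_mem k h)⟩
    rw [map_mul] at h2
    exact (Ideal.unit_mul_mem_iff_mem _ h3).1 h2
  obtain ⟨t, ht⟩ : ∃ t, m ^ t • b n ≤ a ^ n := by
    let g : b n →ₗ[R] tors m (R ⧸ a ^ n) := ((a ^ n).mkQ ∘ₗ (b n).subtype).codRestrict _ (fun x => x.2)
    obtain ⟨t, ht⟩ := exists_pow_le_ker (isTors_tors m (R ⧸ a ^ n)) g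
    refine ⟨t, Submodule.smul_le.2 fun r hr x hx => ?_⟩
    have := congrArg Subtype.val (LinearMap.mem_ker.1 (ht (Submodule.smul_mem_smul hr (Submodule.mem_top (x := ⟨x, hx⟩)))))
    exact (Submodule.Quotient.mk_eq_zero (a ^ n)).1 this
  obtain ⟨c, hc⟩ := Ideal.exists_pow_inf_eq_pow_smul m (b n)
  obtain ⟨k, hk⟩ := exists_le_maximalIdeal_pow b hb hinter (c + t)
  refine ⟨max k n, le_max_right _ _, b (max k n), hle _, fun x hx => ?_, fun x j hx => ?_⟩
  · have h1 : x ∈ m ^ (c + t) • (⊤ : Submodule R R) ⊓ b n :=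
      ⟨by simpa using hk (hb (le_max_left k n) hx), hb (le_max_right k n) hx⟩
    rw [hc _ (Nat.le_add_right c t), Nat.add_sub_cancel_left] at h1
    exact ht (Submodule.smul_mono le_rfl inf_le_right h1)
  · obtain ⟨x, rfl⟩ := Submodule.Quotient.mk_surjective _ x
    rw [Submodule.Quotient.mk_eq_zero]
    have := torsionFree_quotient_tors m (Submodule.Quotient.mk (Submodule.Quotient.mk x : R ⧸ a ^ (max k n))) j
      (fun r hr => by
        have := hx r hr
        rw [← Submodule.Quotient.mk_smul, Submodule.Quotient.mk_eq_zero] at this ⊢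
        exact this)
    rwa [Submodule.Quotient.mk_eq_zero] at this

end chevalley

section free
variable {N : Type} [AddCommGroup N] [Module R N]

lemma LC.map_sum (I : Ideal R) (i : ℕ) {A B ι : Type} [AddCommGroup A] [Module R A] [AddCommGroup B] [Module R B]
    (s : Finset ι) (f : ι → (A →ₗ[R] B)) (z : LC I i A) : LC.map I i (∑ k ∈ s, f k) z = ∑ k ∈ s, LC.map I i (f k) z := by
  classical
  induction s using Finset.induction_on with
  | empty => simp [LC.map_zero]
  | insert k s hk ih => rw [Finset.sum_insert hk, Finset.sum_insert hk, LC.map_add, ih]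

/-- Elements of the local cohomology of a free module decompose into coordinates. -/
lemma LC.eq_sum_single (I : Ideal R) (i n : ℕ) (z : LC I i (Fin n → R)) :
    z = ∑ k, LC.map I i (LinearMap.single R (fun _ : Fin n => R) k) (LC.map I i (LinearMap.proj k) z) := by
  conv_lhs => rw [← LC.map_id I i z]
  rw [show (LinearMap.id : (Fin n → R) →ₗ[R] _) =
    ∑ k, LinearMap.single R (fun _ : Fin n => R) k ∘ₗ LinearMap.proj k by
      refine LinearMap.ext fun x => ?_
      simp only [LinearMap.id_apply, LinearMap.sum_apply, LinearMap.comp_apply, LinearMap.proj_apply,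
        LinearMap.single_apply]
      exact (Finset.univ_sum_single x).symm]
  rw [LC.map_sum]
  exact Finset.sum_congr rfl fun k _ => LC.map_comp ..

lemma LC.smul_eq_zero_of_free {I : Ideal R} {i : ℕ} {s : R} (hs : ∀ z : LC I i R, s • z = 0) (n : ℕ)
    (z : LC I i (Fin n → R)) : s • z = 0 := by
  rw [LC.eq_sum_single I i n z, Finset.smul_sum]
  refine Finset.sum_eq_zero fun k _ => ?_
  rw [← LinearMap.map_smul, hs, LinearMap.map_zero]

/-- The comparison map from the dual of local cohomology to homomorphisms into the canonical module. -/
def theta (I : Ideal R) (i : ℕ) (X : Type) [AddCommGroup X] [Module R X] (φ : LC I i X →ₗ[R] N) :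
    X →ₗ[R] (LC I i R →ₗ[R] N) where
  toFun e := φ ∘ₗ LC.map I i (LinearMap.toSpanSingleton R X e)
  map_add' e e' := by
    ext z
    simp [LinearMap.toSpanSingleton_add, LC.map_add]
  map_smul' r e := by
    ext z
    simp [LinearMap.toSpanSingleton_smul, LC.map_smul]

lemma theta_apply {I : Ideal R} {i : ℕ} {X : Type} [AddCommGroup X] [Module R X] (φ : LC I i X →ₗ[R] N) (e : X)
    (z : LC I i R) : theta I i X φ e z = φ (LC.map I i (LinearMap.toSpanSingleton R X e) z) := rfl

lemma theta_smul {I : Ideal R} {i : ℕ} {X : Type} [AddCommGroup X] [Module R X] (r : R) (φ : LC I i X →ₗ[R] N) :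
    theta I i X (r • φ) = r • theta I i X φ := rfl

lemma theta_comp {I : Ideal R} {i : ℕ} {X Y : Type} [AddCommGroup X] [Module R X] [AddCommGroup Y] [Module R Y]
    (φ : LC I i Y →ₗ[R] N) (g : X →ₗ[R] Y) : theta I i X (φ ∘ₗ LC.map I i g) = theta I i Y φ ∘ₗ g := by
  ext e z
  rw [theta_apply, LinearMap.comp_apply, LinearMap.comp_apply, theta_apply, ← LC.map_comp]
  congr 3
  ext
  simp

lemma theta_free_injective {I : Ideal R} {i n : ℕ} (φ : LC I i (Fin n → R) →ₗ[R] N) (h : theta I i _ φ = 0) : φ = 0 := by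
  ext z
  rw [LC.eq_sum_single I i n z, _root_.map_sum, LinearMap.zero_apply]
  refine Finset.sum_eq_zero fun k _ => ?_
  have := LinearMap.congr_fun (LinearMap.congr_fun h (Pi.single k 1)) (LC.map I i (LinearMap.proj k) z)
  have h1 : LinearMap.single R (fun _ : Fin n => R) k =
      LinearMap.toSpanSingleton R (Fin n → R) (Pi.single k 1) := by
    refine LinearMap.ext_ring ?_
    rw [LinearMap.toSpanSingleton_apply, one_smul, LinearMap.single_apply]
  rw [h1]
  exact this

lemma theta_free_surjective {I : Ideal R} {i n : ℕ} (ψ : (Fin n → R) →ₗ[R] (LC I i R →ₗ[R] N)) :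
    ∃ φ, theta I i _ φ = ψ := by
  refine ⟨∑ k, ψ (Pi.single k 1) ∘ₗ LC.map I i (LinearMap.proj k), ?_⟩
  refine (Pi.basisFun R (Fin n)).ext fun j => ?_
  ext z
  rw [theta_apply, LinearMap.sum_apply, Finset.sum_eq_single j]
  · rw [LinearMap.comp_apply, ← LC.map_comp]
    have : (LinearMap.proj j : (Fin n → R) →ₗ[R] R) ∘ₗ
      LinearMap.toSpanSingleton R (Fin n → R) (Pi.basisFun R (Fin n) j) = LinearMap.id := by
      ext; simp
    rw [this, LC.map_id, Pi.basisFun_apply]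
  · intro k _ hk
    rw [LinearMap.comp_apply, ← LC.map_comp]
    have : (LinearMap.proj k : (Fin n → R) →ₗ[R] R) ∘ₗ
      LinearMap.toSpanSingleton R (Fin n → R) (Pi.basisFun R (Fin n) j) = 0 := by
      ext; simp [hk]
    rw [this, LC.map_zero, LinearMap.map_zero]
  · simp

/-- If `d` bounds the dimension of the ring, all maps into the canonical module come from local cohomology. -/
lemma theta_surjective [IsNoetherianRing R] {I : Ideal R} {d : ℕ} (hd : Module.supportDim R R ≤ d)
    {X : Type} [AddCommGroup X] [Module R X] [Module.Finite R X] (ψ : X →ₗ[R] (LC I d R →ₗ[R] N)) :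
    ∃ φ, theta I d X φ = ψ := by
  have hdim : ∀ (Y : Type) [AddCommGroup Y] [Module R Y] [Module.Finite R Y], Module.supportDim R Y ≤ d := fun Y _ _ _ =>
    (Module.supportDim_le_ringKrullDim R Y).trans ((Module.supportDim_self_eq_ringKrullDim (R := R)).symm.le.trans hd)
  obtain ⟨n, π, hπ⟩ := Module.Finite.exists_fin' R X
  obtain ⟨m, ρ, hρ⟩ := Module.Finite.exists_fin' R (LinearMap.ker π)
  obtain ⟨φ₀, hφ₀⟩ := theta_free_surjective (ψ ∘ₗ π)
  have ses := SES.of_surjective hπ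
  have h0 : φ₀ ∘ₗ LC.map I d ((LinearMap.ker π).subtype ∘ₗ ρ) = 0 := by
    apply theta_free_injective
    rw [theta_comp, hφ₀]
    refine LinearMap.ext fun e => ?_
    simp only [LinearMap.comp_apply, Submodule.subtype_apply, LinearMap.zero_apply]
    rw [LinearMap.mem_ker.1 (ρ e).2, _root_.map_zero]
  have hker : LinearMap.ker (LC.map I d π) ≤ LinearMap.ker φ₀ := by
    intro z hz
    obtain ⟨w, rfl⟩ := (LC.exact₂ I d ses z).1 hz
    obtain ⟨w, rfl⟩ := LC.map_surjective_top I (hdim _) hρ w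
    have := LinearMap.congr_fun h0 w
    rw [LinearMap.comp_apply, LC.map_comp] at this
    exact this
  have hsurj := LC.map_surjective_top I (hdim _) hπ
  let φ : LC I d X →ₗ[R] N := (LinearMap.ker (LC.map I d π)).liftQ φ₀ hker ∘ₗ
    ((LC.map I d π).quotKerEquivOfSurjective hsurj).symm.toLinearMap
  have hφ : φ ∘ₗ LC.map I d π = φ₀ := by
    refine LinearMap.ext fun z => ?_
    have : ((LC.map I d π).quotKerEquivOfSurjective hsurj).symm (LC.map I d π z) = Submodule.Quotient.mk z := by
      rw [LinearEquiv.symm_apply_eq]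
      rfl
    change (LinearMap.ker (LC.map I d π)).liftQ φ₀ hker (((LC.map I d π).quotKerEquivOfSurjective hsurj).symm (LC.map I d π z)) = _
    rw [this]
    rfl
  refine ⟨φ, LinearMap.ext fun e => ?_⟩
  obtain ⟨e, rfl⟩ := hπ e
  rw [← LinearMap.comp_apply, ← theta_comp, hφ, hφ₀]
  rfl

end free

lemma SES.coconn_pre {X Y Z A : Type} [AddCommGroup X] [AddCommGroup Y] [AddCommGroup Z] [AddCommGroup A]
    [Module R X] [Module R Y] [Module R Z] [Module R A] {f : X →ₗ[R] Y} {g : Y →ₗ[R] Z} (h : SES f g) (i : ℕ) (x : ExtM R Y A i) :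
    h.coconn A i (pre A i f x) = 0 := by
  change h.shortExact.extClass.comp ((Ext.mk₀ (ModuleCat.ofHom f)).comp x (zero_add i)) (add_comm 1 i) = 0
  refine (Ext.comp_assoc _ _ _ (add_zero 1) (zero_add i) (by omega)).symm.trans ?_
  have : h.shortExact.extClass.comp (Ext.mk₀ (ModuleCat.ofHom f)) (add_zero 1) = 0 := h.shortExact.extClass_comp
  rw [this]
  exact Ext.zero_comp (β := (x : Abelian.Ext (ModuleCat.of R Y) (ModuleCat.of R A) i)) ..

section annihilation
variable [IsLocalRing R] [IsNoetherianRing R] {I : Ideal R} {d : ℕ}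

/-- Annihilators of local cohomology annihilate the complementary Ext modules into the canonical module. -/
lemma smul_ext_canonical_eq_zero (hd : Module.supportDim R R ≤ d) {s : R}
    (hs : ∀ i < d, ∀ z : LC I i R, s • z = 0) (j : ℕ) :
    ∀ (i : ℕ) (_ : i + (j + 1) = d) (X : Type) [AddCommGroup X] [Module R X] [Module.Finite R X] (c : R)
      (_ : ∀ z : LC I i X, c • z = 0) (x : ExtM R X (Dual R (LC I d R)) (j + 1)), (s ^ j * c) • x = 0 := by
  induction j with
  | zero =>
    intro i hij X _ _ _ c hc x
    obtain rfl : d = i + 1 := by omega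
    obtain ⟨n, π, hπ⟩ := Module.Finite.exists_fin' R X
    have ses := SES.of_surjective hπ
    have := subsingleton_ext_of_projective (R := R) (Fin n → R) (Dual R (LC I (i + 1) R)) 0
    obtain ⟨y, rfl⟩ := ses.coexact₃ _ 0 (x := x) (Subsingleton.elim _ _)
    obtain ⟨ψ, rfl⟩ := (ext0 R (LinearMap.ker π) _).symm.surjective y
    obtain ⟨φ, rfl⟩ := theta_surjective hd ψ
    have hker : LinearMap.ker (LC.map I (i + 1) (LinearMap.ker π).subtype) ≤ LinearMap.ker (c • φ) := by
      intro z hz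
      obtain ⟨w, rfl⟩ := (LC.exact₁ I i ses z).1 hz
      rw [LinearMap.mem_ker, LinearMap.smul_apply, ← LinearMap.map_smul, ← LinearMap.map_smul, hc,
        LinearMap.map_zero, LinearMap.map_zero]
    obtain ⟨k, hk⟩ := exists_extend _ _ hker
    rw [pow_zero, one_mul, ← LinearMap.map_smul, ← LinearEquiv.map_smul, ← theta_smul, ← hk, theta_comp]
    have h2 := ext0_pre (LinearMap.ker π).subtype ((ext0 R (Fin n → R) _).symm (theta I (i + 1) _ k))
    rw [LinearEquiv.apply_symm_apply] at h2
    rw [← h2, LinearEquiv.symm_apply_apply]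
    exact ses.coconn_pre _ _
  | succ j ih =>
    intro i hij X _ _ _ c hc x
    obtain ⟨n, π, hπ⟩ := Module.Finite.exists_fin' R X
    have ses := SES.of_surjective hπ
    have := subsingleton_ext_of_projective (R := R) (Fin n → R) (Dual R (LC I d R)) (j + 1)
    obtain ⟨y, rfl⟩ := ses.coexact₃ _ (j + 1) (x := x) (Subsingleton.elim _ _)
    have h1 := ih (i + 1) (by omega) (LinearMap.ker π) (c * s) (fun z => by
      rw [mul_smul]
      have h2 : LC.map I (i + 1) (LinearMap.ker π).subtype (s • z) = 0 := by
        rw [LinearMap.map_smul]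
        exact LC.smul_eq_zero_of_free (hs (i + 1) (by omega)) n _
      obtain ⟨w, hw⟩ := (LC.exact₁ I i ses (s • z)).1 h2
      rw [← hw, ← LinearMap.map_smul, hc, LinearMap.map_zero]) y
    rw [← LinearMap.map_smul, show s ^ (j + 1) * c = s ^ j * (c * s) by ring, h1, LinearMap.map_zero]

end annihilation

lemma isSMulRegular_of_ne_zero [IsDomain R] {x : R} (hx : x ≠ 0) : IsSMulRegular R x := by
  rw [isSMulRegular_iff_right_eq_zero_of_smul]
  exact fun z hz => (mul_eq_zero.1 hz).resolve_left hx

variable (R) in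
lemma supportDim_bot_quotient : Module.supportDim R (R ⧸ (⊥ : Ideal R)) = Module.supportDim R R :=
  Module.supportDim_eq_of_equiv (Submodule.quotEquivOfEqBot (⊥ : Ideal R) rfl)

/-- In the dimension, nonzerodivisors of a finite module act surjectively on local cohomology. -/
lemma LC.smul_surjective_top_of_isSMulRegular [IsNoetherianRing R] (I : Ideal R) {N : Type} [AddCommGroup N] [Module R N] [Module.Finite R N]
    {d : ℕ} (hN : Module.supportDim R N ≤ d) {x : R} (hx : IsSMulRegular N x) (z : LC I d N) :
    ∃ w, x • w = z := by
  have := LC.subsingleton_of_supportDim_lt I d _ (dim_lt (supportDim_quotient_smul hx)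
    (hN.trans_lt (by exact_mod_cast Nat.lt_succ_self d)))
  exact LC.smul_surjective_top I hN x this z

section lhvt
variable [IsLocalRing R] [IsNoetherianRing R]

/-- A single nonzero element annihilates all lower local cohomology of a complete local domain. -/
lemma exists_smul_eq_zero_of_lt [IsDomain R] [IsAdicComplete (maximalIdeal R) R] {d : ℕ}
    (hd : Module.supportDim R R = d) :
    ∃ s : R, s ≠ 0 ∧ ∀ i < d, ∀ z : LC (maximalIdeal R) i R, s • z = 0 := by
  have h1 : ∀ i < d, ∃ s : R, s ≠ 0 ∧ ∀ z : LC (maximalIdeal R) i R, s • z = 0 := by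
    intro i hi
    obtain ⟨h1, h2⟩ := finite_dual_LC (R := R) i R
    by_contra! hc
    have hann : Module.annihilator R (Dual R (LC (maximalIdeal R) i R)) ≤ ⊥ := by
      intro y hy
      by_contra hyp
      obtain ⟨z, hz⟩ := hc y hyp
      exact hz (smul_eq_zero_of_dual (fun φ => Module.mem_annihilator.1 hy φ) z)
    have h3 := supportDim_quotient_le_of_mem_support (q := ⟨⊥, Ideal.isPrime_bot⟩)
      (Module.mem_support_iff_of_finite.2 hann)
    rw [supportDim_bot_quotient, hd] at h3
    exact absurd (h3.trans h2) (not_le.2 (by exact_mod_cast hi))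
  have h2 : ∀ n ≤ d, ∃ s : R, s ≠ 0 ∧ ∀ i < n, ∀ z : LC (maximalIdeal R) i R, s • z = 0 := by
    intro n
    induction n with
    | zero => exact fun _ => ⟨1, one_ne_zero, fun i hi => absurd hi (Nat.not_lt_zero i)⟩
    | succ n ih =>
      intro hn
      obtain ⟨s, hs, hs'⟩ := ih (by omega)
      obtain ⟨t, ht, ht'⟩ := h1 n hn
      refine ⟨s * t, mul_ne_zero hs ht, fun i hi z => ?_⟩
      rcases Nat.lt_succ_iff_lt_or_eq.1 hi with hi | rfl
      · rw [mul_comm, mul_smul, hs' i hi, smul_zero]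
      · rw [mul_smul, ht', smul_zero]
  exact h2 d le_rfl

lemma LC.not_subsingleton_of_domain [IsDomain R] [IsAdicComplete (maximalIdeal R) R] {d : ℕ}
    (hd : Module.supportDim R R = d) : ¬ Subsingleton (LC (maximalIdeal R) d R) := fun _ =>
  LC.not_subsingleton_of_prime d (⊥ : Ideal R) ((supportDim_bot_quotient R).trans hd)
    (LC.congr (maximalIdeal R) d (Submodule.quotEquivOfEqBot (⊥ : Ideal R) rfl)).injective.subsingleton

/-- The local Hartshorne–Lichtenbaum vanishing theorem for complete local domains. -/
theorem LC.subsingleton_of_domain [IsDomain R] [IsAdicComplete (maximalIdeal R) R] {d : ℕ}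
    (hd : Module.supportDim R R = d) {a P : Ideal R} [hP : P.IsPrime] (haP : a ≤ P)
    (hPm : P ≠ maximalIdeal R) : Subsingleton (LC a d R) := by
  have hdpos : 1 ≤ d := by
    by_contra! h0
    have h1 := supportDim_lt_of_prime_lt (lt_of_le_of_ne (le_maximalIdeal hP.ne_top) hPm)
    have h2 := zero_le_supportDim (maximalIdeal.isMaximal R).ne_top
    have h3 := supportDim_quotient_anti (bot_le : (⊥ : Ideal R) ≤ P)
    rw [supportDim_bot_quotient, hd] at h3
    have h4 : (1 : WithBot ℕ∞) ≤ ((d : ℕ) : WithBot ℕ∞) := by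
      refine le_trans ?_ (h1.trans h3)
      simpa using add_le_add_left h2 1
    exact absurd h4 (not_le.2 (by exact_mod_cast h0))
  obtain ⟨d', rfl⟩ : ∃ d', d = d' + 1 := ⟨d - 1, by omega⟩
  set d := d' + 1
  have hdim : ∀ (Y : Type) [AddCommGroup Y] [Module R Y] [Module.Finite R Y], Module.supportDim R Y ≤ d := fun Y _ _ _ =>
    (Module.supportDim_le_ringKrullDim R Y).trans
      ((Module.supportDim_self_eq_ringKrullDim (R := R)).symm.le.trans hd.le)
  let K := Dual R (LC (maximalIdeal R) d R)
  have hKfin : Module.Finite R K := (finite_dual_LC (R := R) d R).1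
  have hKreg : ∀ x : R, x ≠ 0 → IsSMulRegular K x := by
    intro x hx
    rw [isSMulRegular_iff_right_eq_zero_of_smul]
    intro φ hφ
    refine LinearMap.ext fun z => ?_
    obtain ⟨w, rfl⟩ := LC.smul_surjective_top_of_isSMulRegular (maximalIdeal R) hd.le (isSMulRegular_of_ne_zero hx) z
    rw [LinearMap.map_smul, ← LinearMap.smul_apply, hφ]
    rfl
  obtain ⟨s, hs0, hs⟩ := exists_smul_eq_zero_of_lt hd
  have hK : Subsingleton (LC a d K) := by
    have hkill : ∀ z : LC a d K, s ^ d' • z = 0 := by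
      intro z
      obtain ⟨n, x, rfl⟩ := LC.exists_of z
      obtain ⟨k, hnk, b, hkb, hbn, hb⟩ := exists_saturated_between haP hPm n
      have hzero : ∀ z : LC (maximalIdeal R) 0 (R ⧸ b), (1 : R) • z = 0 := by
        intro z
        rw [one_smul]
        apply LC.ev_injective
        rw [LinearMap.map_zero]
        obtain ⟨j, hj⟩ := LC.isTors (maximalIdeal R) 0 _ z
        exact hb _ j fun r hr => by rw [← LinearMap.map_smul, hj r hr, LinearMap.map_zero]
      have h1 := smul_ext_canonical_eq_zero hd.le hs d' 0 (zero_add _) (R ⧸ b) 1 hzero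
        (pre K d (Submodule.factor hbn) x)
      rw [mul_one] at h1
      rw [← LC.of_res hnk, ← Submodule.factor_comp hkb hbn, pre_comp, ← LinearMap.map_smul, ← LinearMap.map_smul]
      erw [h1]
      rw [LinearMap.map_zero, LinearMap.map_zero]
    refine subsingleton_of_forall_eq 0 fun z => ?_
    obtain ⟨w, rfl⟩ := LC.smul_surjective_top_of_isSMulRegular a (hdim K) (hKreg _ (pow_ne_zero d' hs0)) z
    exact hkill w
  obtain ⟨φ, hφ⟩ : ∃ φ : K, φ ≠ 0 := by
    obtain ⟨z, hz⟩ : ∃ z : LC (maximalIdeal R) d R, z ≠ 0 := by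
      by_contra! h
      exact LC.not_subsingleton_of_domain hd (subsingleton_of_forall_eq 0 h)
    obtain ⟨φ, h⟩ := exists_dual_ne_zero R hz
    exact ⟨φ, fun h0 => h (by rw [h0]; rfl)⟩
  obtain ⟨f, hf⟩ := exists_functional (R := R) (M := K) (⊥ : Ideal R) (fun r hr => by
    by_contra hr0
    exact hφ (isSMulRegular_iff_right_eq_zero_of_smul.1 (hKreg r hr0) φ (Module.mem_annihilator.1 hr φ)))
  let e := Submodule.quotEquivOfEqBot (⊥ : Ideal R) rfl
  let g : K →ₗ[R] R := e.toLinearMap ∘ₗ f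
  obtain ⟨y, hy⟩ : ∃ y, g y ≠ 0 := by
    by_contra! h
    exact hf (LinearMap.ext fun y => e.injective ((h y).trans (_root_.map_zero e).symm))
  have h1 : Subsingleton (LC a d (LinearMap.range g)) :=
    (LC.map_surjective_top a (hdim K) g.surjective_rangeRestrict).subsingleton
  have h2 : Module.supportDim R (R ⧸ LinearMap.range g) < d := by
    refine lt_of_le_of_lt ?_ (dim_lt (supportDim_quotient_smul (isSMulRegular_of_ne_zero hy))
      ((hdim R).trans_lt (by exact_mod_cast Nat.lt_succ_self d)))
    refine Module.supportDim_le_of_surjective (Submodule.factor ?_) (Submodule.factor_surjective _)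
    intro z hz
    obtain ⟨w, -, rfl⟩ := (Submodule.mem_smul_pointwise_iff_exists _ _ _).1 hz
    rw [smul_eq_mul, mul_comm, ← smul_eq_mul]
    exact Submodule.smul_mem _ _ ⟨y, rfl⟩
  have h3 := LC.subsingleton_of_supportDim_lt a d _ h2
  exact (LC.map_surjective_left a d (SES.of_submodule (LinearMap.range g))).subsingleton

end lhvt

lemma isPrecomplete_of_surjective {I : Ideal R} {A B : Type} [AddCommGroup A] [Module R A] [AddCommGroup B]
    [Module R B] [IsPrecomplete I A] (g : A →ₗ[R] B) (hg : Function.Surjective g) : IsPrecomplete I B where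
  prec' f hf := by
    have lift : ∀ k, ∃ a ∈ (I ^ k • ⊤ : Submodule R A), g a = f (k + 1) - f k := fun k => by
      have h := SModEq.sub_mem.1 (hf (Nat.le_succ k)).symm
      rwa [← LinearMap.range_eq_top.2 hg, LinearMap.range_eq_map, ← Submodule.map_smul''] at h
    choose h hmem hgh using lift
    obtain ⟨l, hl⟩ := hg (f 0)
    set F : ℕ → A := fun n => l + ∑ i ∈ Finset.range n, h i with hF
    have hgF : ∀ n, g (F n) = f n := fun n => by
      rw [hF, map_add, map_sum, hl, Finset.sum_congr rfl fun i _ => hgh i, Finset.sum_range_sub]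
      abel
    obtain ⟨L, hL⟩ := IsPrecomplete.prec (I := I) (M := A) inferInstance (f := F) (fun {m n} hmn => by
      rw [SModEq.comm, SModEq.sub_mem, hF, add_sub_add_left_eq_sub, ← Finset.sum_Ico_eq_sub _ hmn]
      exact Submodule.sum_mem _ fun i hi =>
        Submodule.smul_mono_left (Ideal.pow_le_pow_right (Finset.mem_Ico.1 hi).1) (hmem i))
    refine ⟨g L, fun n => ?_⟩
    rw [← hgF n]
    have := (hL n).map g
    rw [SModEq.sub_mem] at this ⊢
    refine Submodule.smul_mono le_rfl le_top ((Submodule.map_smul'' _ _ _).le this)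

section
variable [IsLocalRing R] [IsNoetherianRing R] [IsAdicComplete (maximalIdeal R) R]

lemma LC.subsingleton_quotient_prime {d : ℕ} {a p : Ideal R} [hp : p.IsPrime]
    (hd : Module.supportDim R (R ⧸ p) = d) (h : (a ⊔ p).radical ≠ maximalIdeal R) :
    Subsingleton (LC a d (R ⧸ p)) := by
  set f := algebraMap R (R ⧸ p)
  have hf : Function.Surjective f := Ideal.Quotient.mk_surjective
  have hk : RingHom.ker f = p := Ideal.mk_ker
  have : IsLocalRing (R ⧸ p) := IsLocalRing.of_surjective' f hf
  have hm : (maximalIdeal R).map f = maximalIdeal (R ⧸ p) := by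
    have : ((maximalIdeal R).map f).IsMaximal := by
      refine (Ideal.map_eq_top_or_isMaximal_of_surjective f hf (maximalIdeal.isMaximal R)).resolve_left fun ht => ?_
      have := congrArg (Ideal.comap f) ht
      rw [Ideal.comap_map_of_surjective' f hf, hk, sup_eq_left.2 (le_maximalIdeal hp.ne_top)] at this
      exact (maximalIdeal.isMaximal R).ne_top this
    exact IsLocalRing.eq_maximalIdeal this
  have : IsPrecomplete (maximalIdeal (R ⧸ p)) (R ⧸ p) := by
    rw [← hm]
    exact IsPrecomplete.map_algebraMap_iff.2 (isPrecomplete_of_surjective (Submodule.mkQ p) (Submodule.mkQ_surjective p))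
  have : IsAdicComplete (maximalIdeal (R ⧸ p)) (R ⧸ p) := {}
  have hd' : Module.supportDim (R ⧸ p) (R ⧸ p) = d := by
    rw [Module.supportDim_self_eq_ringKrullDim, ← Module.supportDim_quotient_eq_ringKrullDim, hd]
  refine LC.subsingleton_of_algebra (A := R ⧸ p) a d _ ?_
  have ham : a.map f = (a ⊔ p).map f := by
    rw [Ideal.map_sup, (Ideal.map_eq_bot_iff_le_ker f (I := p)).2 hk.ge, sup_bot_eq]
  by_cases ht : a ⊔ p = ⊤
  · rw [ham, ht, Ideal.map_top]
    infer_instance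
  obtain ⟨P, hP, haP, hPm⟩ : ∃ P : Ideal R, P.IsPrime ∧ a ⊔ p ≤ P ∧ P ≠ maximalIdeal R := by
    by_contra! hc
    refine h (le_antisymm ?_ ?_)
    · rw [(maximalIdeal.isMaximal R).isPrime.radical_le_iff]
      exact le_maximalIdeal ht
    · rw [Ideal.radical_eq_sInf]
      exact le_sInf fun J hJ => (hc J hJ.2 hJ.1).ge
  have hpP := le_sup_right.trans haP
  have := Ideal.map_isPrime_of_surjective hf (I := P) (hk.trans_le hpP)
  refine LC.subsingleton_of_domain hd' (a := a.map f) (P := P.map f) ?_ ?_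
  · exact Ideal.map_mono (le_sup_left.trans haP)
  · rw [← hm]
    intro he
    have := congrArg (Ideal.comap f) he
    rw [Ideal.comap_map_of_surjective' f hf, Ideal.comap_map_of_surjective' f hf, hk, sup_eq_left.2 hpP,
      sup_eq_left.2 (le_maximalIdeal hp.ne_top)] at this
    exact hPm this

/-- The Hartshorne–Lichtenbaum vanishing theorem for finitely generated modules over complete local rings. -/
theorem LC.subsingleton_of_forall_radical_ne {d : ℕ} (a : Ideal R) (N : Type) [AddCommGroup N] [Module R N]
    [hfin : Module.Finite R N] (hN : Module.supportDim R N ≤ d)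
    (h : ∀ p ∈ Module.support R N, Module.supportDim R (R ⧸ p.asIdeal) = d →
      (a ⊔ p.asIdeal).radical ≠ maximalIdeal R) :
    Subsingleton (LC a d N) := by
  induction hfin using IsNoetherianRing.induction_on_isQuotientEquivQuotientPrime R with
  | subsingleton N =>
    refine LC.subsingleton_of_supportDim_lt a d N ?_
    rw [(Module.supportDim_eq_bot_iff_subsingleton R N).2 inferInstance]
    exact WithBot.bot_lt_coe _
  | quotient N p e =>
    rw [Module.supportDim_eq_of_equiv e] at hN
    have : Subsingleton (LC a d (R ⧸ p.asIdeal)) := by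
      rcases hN.lt_or_eq with hlt | heq
      · exact LC.subsingleton_of_supportDim_lt a d _ hlt
      · refine LC.subsingleton_quotient_prime heq (h p ?_ heq)
        rw [e.support_eq, Module.mem_support_iff_of_finite, Ideal.annihilator_quotient]
    exact (LC.congr a d e).toEquiv.subsingleton
  | exact N₁ N₂ N₃ f g hf hg hex ih₁ ih₃ =>
    have ses : SES f g := ⟨hf, hex, hg⟩
    have := ih₁ ((Module.supportDim_le_of_injective f hf).trans hN) fun p hp =>
      h p (Module.support_subset_of_injective f hf hp)
    have := ih₃ ((Module.supportDim_le_of_surjective g hg).trans hN) fun p hp =>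
      h p (Module.support_subset_of_surjective g hg hp)
    exact LC.subsingleton_middle a d ses

end

lemma eq_of_le_of_supportDim_eq [IsNoetherianRing R] {p q : Ideal R} [p.IsPrime] {d : ℕ}
    (hp : Module.supportDim R (R ⧸ p) = d) (hq : Module.supportDim R (R ⧸ q) = d) (h : p ≤ q) : p = q := by
  by_contra hne
  have := supportDim_lt_of_prime_lt (lt_of_le_of_ne h hne)
  rw [hp, hq] at this
  exact absurd this (not_le.2 (by exact_mod_cast Nat.lt_succ_self d))

lemma supportDim_quotient_submodule_lt [IsNoetherianRing R] {p : Ideal R} [p.IsPrime] {d : ℕ}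
    (hd : Module.supportDim R (R ⧸ p) = d)
    {C : Submodule R (R ⧸ p)} (hC : C ≠ ⊥) : Module.supportDim R ((R ⧸ p) ⧸ C) < d := by
  obtain ⟨c, hc, hc0⟩ := Submodule.exists_mem_ne_zero_of_ne_bot hC
  obtain ⟨y, rfl⟩ := Ideal.Quotient.mk_surjective c
  have hy : y ∉ p := fun h => hc0 (Ideal.Quotient.eq_zero_iff_mem.2 h)
  have hle : y • (⊤ : Submodule R (R ⧸ p)) ≤ C := by
    rintro _ ⟨z, -, rfl⟩
    obtain ⟨z, rfl⟩ := Ideal.Quotient.mk_surjective z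
    have := C.smul_mem z hc
    rwa [← Ideal.Quotient.mk_eq_mk, ← Submodule.Quotient.mk_smul, smul_eq_mul, mul_comm] at this
  refine (Module.supportDim_le_of_surjective _ (Submodule.factor_surjective hle)).trans_lt ?_
  exact dim_lt (supportDim_quotient_smul (isSMulRegular_quotient_prime hy))
    (hd.trans_lt (by exact_mod_cast Nat.lt_succ_self d))

lemma isTors_of_smul_eq_zero {c : Ideal R} {N : Type} [AddCommGroup N] [Module R N]
    (h : ∀ r ∈ c, ∀ x : N, r • x = 0) : IsTors c N :=
  fun x => ⟨1, fun r hr => h r (by rwa [pow_one] at hr) x⟩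

section radical
variable [IsLocalRing R]

lemma radical_eq_maximalIdeal {J : Ideal R} (hJ : J ≤ maximalIdeal R)
    (h : ∀ P : Ideal R, P.IsPrime → J ≤ P → P = maximalIdeal R) : J.radical = maximalIdeal R := by
  refine le_antisymm ((maximalIdeal.isMaximal R).isPrime.radical_le_iff.2 hJ) ?_
  rw [Ideal.radical_eq_sInf]
  exact le_sInf fun P hP => (h P hP.2 hP.1).ge

lemma eq_maximalIdeal_of_radical_eq {J P : Ideal R} (hJ : J.radical = maximalIdeal R) [hP : P.IsPrime]
    (h : J ≤ P) : P = maximalIdeal R :=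
  (le_maximalIdeal hP.ne_top).antisymm (hJ ▸ hP.radical_le_iff.2 h)

variable [IsNoetherianRing R]

lemma eq_maximalIdeal_of_lt_of_supportDim_eq_one {P Q : Ideal R} [hP : P.IsPrime] [Q.IsPrime]
    (hQ : Module.supportDim R (R ⧸ Q) = (1 : ℕ)) (h : Q < P) : P = maximalIdeal R := by
  by_contra hne
  have h1 := supportDim_lt_of_prime_lt h
  have h2 := supportDim_lt_of_prime_lt (lt_of_le_of_ne (le_maximalIdeal hP.ne_top) hne)
  rw [hQ] at h1
  have h3 := h2.trans (le_of_add_one_le (n := 0) h1)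
  have h4 := zero_le_supportDim (maximalIdeal.isMaximal R).ne_top
  have h5 : (0 : WithBot ℕ∞) + 1 ≤ Module.supportDim R (R ⧸ maximalIdeal R) + 1 := add_le_add h4 le_rfl
  exact absurd (h5.trans h3) (by simp)

lemma eq_maximalIdeal_of_supportDim_eq_zero {P : Ideal R} [hP : P.IsPrime]
    (h : Module.supportDim R (R ⧸ P) = (0 : ℕ)) : P = maximalIdeal R := by
  refine eq_of_le_of_supportDim_eq h ?_ (le_maximalIdeal hP.ne_top)
  refine le_antisymm ((supportDim_quotient_anti (le_maximalIdeal hP.ne_top)).trans h.le) ?_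
  exact_mod_cast zero_le_supportDim (maximalIdeal.isMaximal R).ne_top

lemma exists_prime_supportDim_eq_one {q : Ideal R} [hq : q.IsPrime] {d : ℕ}
    (hd : Module.supportDim R (R ⧸ q) = (d + 1 : ℕ)) {x : R} (hx : x ∉ q) :
    ∃ Q : Ideal R, Q.IsPrime ∧ q ≤ Q ∧ x ∉ Q ∧ Module.supportDim R (R ⧸ Q) = (1 : ℕ) := by
  induction d generalizing q with
  | zero => exact ⟨q, hq, le_rfl, hx, hd⟩
  | succ d ih =>
    obtain ⟨q', hq', hlt, hx', hd'⟩ := exists_prime_gt_notMem hd hx (fun h => absurd h d.succ_ne_zero)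
    obtain ⟨Q, hQ, hle, hxQ, hQd⟩ := ih hd' hx'
    exact ⟨Q, hQ, hlt.le.trans hle, hxQ, hQd⟩

end radical

/-- The primes of dimension `d` in the support of a module. -/
def topPrimes (R : Type) [CommRing R] (d : ℕ) (M : Type) [AddCommGroup M] [Module R M] :
    Set (PrimeSpectrum R) :=
  {p | p ∈ Module.support R M ∧ Module.supportDim R (R ⧸ p.asIdeal) = d}

/-- The primes of dimension `d` in the support whose sum with `a` is primary to the maximal ideal. -/
def cofinitePrimes [IsLocalRing R] (a : Ideal R) (d : ℕ) (M : Type) [AddCommGroup M] [Module R M] :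
    Set (PrimeSpectrum R) :=
  {p | p ∈ topPrimes R d M ∧ (a ⊔ p.asIdeal).radical = maximalIdeal R}

section top
variable {M : Type} [AddCommGroup M] [Module R M] [Module.Finite R M] {d : ℕ}
variable [IsNoetherianRing R]

lemma mem_minimalPrimes_of_mem_topPrimes (hM : Module.supportDim R M ≤ d) {p : PrimeSpectrum R}
    (hp : p ∈ topPrimes R d M) : p.asIdeal ∈ (Module.annihilator R M).minimalPrimes := by
  obtain ⟨q, hq, hqp⟩ := Ideal.exists_minimalPrimes_le (Module.mem_support_iff_of_finite.1 hp.1)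
  have := hq.1.1
  have hqs : (⟨q, hq.1.1⟩ : PrimeSpectrum R) ∈ Module.support R M :=
    Module.mem_support_iff_of_finite.2 hq.1.2
  have hqd : Module.supportDim R (R ⧸ q) = d :=
    ((supportDim_quotient_le_of_mem_support hqs).trans hM).antisymm
      (hp.2.symm.le.trans (supportDim_quotient_anti hqp))
  rwa [← eq_of_le_of_supportDim_eq hqd hp.2 hqp]

lemma finite_topPrimes (hM : Module.supportDim R M ≤ d) : (topPrimes R d M).Finite :=
  Set.Finite.of_finite_image
    ((Ideal.finite_minimalPrimes_of_isNoetherianRing R (Module.annihilator R M)).subset (by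
      rintro _ ⟨p, hp, rfl⟩
      exact mem_minimalPrimes_of_mem_topPrimes hM hp))
    (f := PrimeSpectrum.asIdeal) (fun p _ q _ h => PrimeSpectrum.ext h)

lemma LC.exists_surjective_quotient_prime (hM : Module.supportDim R M ≤ d) (a : Ideal R) {p : PrimeSpectrum R}
    (hp : p ∈ topPrimes R d M) :
    ∃ f : M →ₗ[R] R ⧸ p.asIdeal, Function.Surjective (LC.map a d f) := by
  obtain ⟨f, hf⟩ := exists_functional p.asIdeal (Module.mem_support_iff_of_finite.1 hp.1)
  refine ⟨f, ?_⟩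
  have := LC.subsingleton_of_supportDim_lt a d _ (supportDim_quotient_submodule_lt hp.2
    (mt LinearMap.range_eq_bot.1 hf))
  have h1 := LC.map_surjective_left a d (SES.of_submodule (LinearMap.range f))
  have h2 := LC.map_surjective_top a hM f.surjective_rangeRestrict
  intro z
  obtain ⟨z, rfl⟩ := h1 z
  obtain ⟨z, rfl⟩ := h2 z
  exact ⟨z, by rw [← LC.map_comp]; rfl⟩

variable [IsLocalRing R]

lemma exists_mem_forall_exists_smul_eq [IsAdicComplete (maximalIdeal R) R] (hM : Module.supportDim R M ≤ d)
    {a : Ideal R} {p : PrimeSpectrum R} (hp : p ∈ topPrimes R d M) (hpa : p ∉ cofinitePrimes a d M) :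
    ∃ x ∈ p.asIdeal, ∀ z : LC a d M, ∃ w, x • w = z := by
  have hfin : (cofinitePrimes a d M).Finite := (finite_topPrimes hM).subset fun q hq => hq.1
  obtain ⟨x, hxp, hx⟩ : ∃ x ∈ p.asIdeal, ∀ q ∈ cofinitePrimes a d M, x ∉ q.asIdeal := by
    by_contra! hc
    have hsub : (p.asIdeal : Set R) ⊆ ⋃ q ∈ cofinitePrimes a d M, q.asIdeal := fun x hx => by
      obtain ⟨q, hq, hxq⟩ := hc x hx
      exact Set.mem_biUnion hq hxq
    obtain ⟨q, hq, hpq⟩ := (Ideal.subset_union_prime_finite hfin (f := PrimeSpectrum.asIdeal) p p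
      (fun i _ _ _ => i.2)).1 hsub
    exact hpa (PrimeSpectrum.ext (eq_of_le_of_supportDim_eq hp.2 hq.1.2 hpq) ▸ hq)
  refine ⟨x, hxp, LC.smul_surjective_top a hM x (LC.subsingleton_of_forall_radical_ne a _ ?_ ?_)⟩
  · exact (Module.supportDim_le_of_surjective (Submodule.mkQ _) (Submodule.mkQ_surjective _)).trans hM
  · intro q hq hqd hrad
    have hqM := Module.support_subset_of_surjective (Submodule.mkQ _) (Submodule.mkQ_surjective _) hq
    refine hx q ⟨⟨hqM, hqd⟩, hrad⟩ ?_
    refine Module.mem_support_iff_of_finite.1 hq (Module.mem_annihilator.2 fun m => ?_)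
    obtain ⟨m, rfl⟩ := Submodule.mkQ_surjective _ m
    rw [← map_smul, Submodule.mkQ_apply, Submodule.Quotient.mk_eq_zero]
    exact Submodule.smul_mem_pointwise_smul m x ⊤ Submodule.mem_top

lemma not_forall_exists_smul_eq [IsAdicComplete (maximalIdeal R) R] (hM : Module.supportDim R M ≤ d)
    {a : Ideal R} {p : PrimeSpectrum R} (hp : p ∈ cofinitePrimes a d M) {x : R} (hx : x ∈ p.asIdeal) :
    ¬ ∀ z : LC a d M, ∃ w, x • w = z := by
  intro h
  obtain ⟨f, hf⟩ := LC.exists_surjective_quotient_prime hM a hp.1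
  have hkill : ∀ r ∈ p.asIdeal, ∀ y : R ⧸ p.asIdeal, r • y = 0 := fun r hr y => by
    obtain ⟨y, rfl⟩ := Submodule.Quotient.mk_surjective _ y
    rw [← Submodule.Quotient.mk_smul, Submodule.Quotient.mk_eq_zero]
    exact p.asIdeal.mul_mem_right y hr
  have hx0 : (x • LinearMap.id : (R ⧸ p.asIdeal) →ₗ[R] R ⧸ p.asIdeal) = 0 :=
    LinearMap.ext fun y => hkill x hx y
  have hsub : Subsingleton (LC a d (R ⧸ p.asIdeal)) := by
    refine subsingleton_of_forall_eq 0 fun z => ?_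
    obtain ⟨z, rfl⟩ := hf z
    obtain ⟨w, rfl⟩ := h z
    rw [LinearMap.map_smul, ← LC.map_smul_id, hx0, LC.map_zero]
  have ham : a ≤ maximalIdeal R := le_sup_left.trans (Ideal.le_radical.trans hp.2.le)
  obtain ⟨s, hs⟩ := Ideal.exists_pow_le_of_le_radical_of_fg hp.2.ge (IsNoetherian.noetherian _)
  exact LC.not_subsingleton_of_prime d p.asIdeal hp.1.2
    ((LC.compEquiv ham hs d _ (isTors_of_smul_eq_zero hkill)).toEquiv.subsingleton)

end top

lemma exists_mul_pow_mem_of_mem_minimalPrimes {I p : Ideal R} (hp : p ∈ I.minimalPrimes) {x : R}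
    (hx : x ∈ p) : ∃ y ∉ p, ∃ n, y * x ^ n ∈ I := by
  have := hp.1.1
  have h : algebraMap R (Localization.AtPrime p) x ∈ (I.map (algebraMap R (Localization.AtPrime p))).radical := by
    rw [IsLocalization.AtPrime.radical_map_of_mem_minimalPrimes _ p I hp]
    exact Ideal.mem_map_of_mem _ hx
  obtain ⟨n, hn⟩ := h
  rw [← map_pow, IsLocalization.algebraMap_mem_map_algebraMap_iff p.primeCompl] at hn
  obtain ⟨y, hy, h⟩ := hn
  exact ⟨y, hy, n, h⟩

lemma sInf_le_of_isPrime {T : Set (Ideal R)} (hT : T.Finite) {P : Ideal R} (hP : P.IsPrime)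
    (h : sInf T ≤ P) : ∃ p ∈ T, p ≤ P := by
  lift T to Finset (Ideal R) using hT
  rw [← Finset.inf_id_eq_sInf, hP.inf_le'] at h
  exact h

/-- The elements vanishing in the localizations at the given primes. -/
def localKer (T : Set (PrimeSpectrum R)) (M : Type) [AddCommGroup M] [Module R M] : Submodule R M :=
  ⨅ p ∈ T, LinearMap.ker (LocalizedModule.mkLinearMap p.asIdeal.primeCompl M)

lemma mem_localKer {T : Set (PrimeSpectrum R)} {M : Type} [AddCommGroup M] [Module R M] {x : M} :
    x ∈ localKer T M ↔ ∀ p ∈ T, ∃ r ∉ p.asIdeal, r • x = 0 := by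
  simp only [localKer, Submodule.mem_iInf, LocalizedModule.mem_ker_mkLinearMap_iff]
  rfl

lemma notMem_support_localKer {T : Set (PrimeSpectrum R)} {M : Type} [AddCommGroup M] [Module R M]
    {p : PrimeSpectrum R} (hp : p ∈ T) : p ∉ Module.support R (localKer T M) := by
  rw [Module.notMem_support_iff']
  rintro ⟨x, hx⟩
  obtain ⟨r, hr, h⟩ := mem_localKer.1 hx p hp
  exact ⟨r, hr, Subtype.ext h⟩

lemma sInf_le_radical_annihilator_quotient_localKer {M : Type} [AddCommGroup M] [Module R M]
    {T : Set (PrimeSpectrum R)} (hfin : T.Finite)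
    (hT : ∀ p ∈ T, p.asIdeal ∈ (Module.annihilator R M).minimalPrimes) :
    sInf (PrimeSpectrum.asIdeal '' T) ≤ (Module.annihilator R (M ⧸ localKer T M)).radical := by
  intro x hx
  have h : ∀ p ∈ T, ∃ n, ∃ y ∉ p.asIdeal, y * x ^ n ∈ Module.annihilator R M := fun p hp => by
    obtain ⟨y, hy, n, h⟩ := exists_mul_pow_mem_of_mem_minimalPrimes (hT p hp)
      (Submodule.mem_sInf.1 hx _ ⟨p, hp, rfl⟩)
    exact ⟨n, y, hy, h⟩
  choose! n hn using h
  refine ⟨hfin.toFinset.sup n, Module.mem_annihilator.2 fun z => ?_⟩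
  obtain ⟨z, rfl⟩ := Submodule.mkQ_surjective _ z
  rw [← map_smul, Submodule.mkQ_apply, Submodule.Quotient.mk_eq_zero, mem_localKer]
  intro p hp
  obtain ⟨y, hy, h⟩ := hn p hp
  refine ⟨y, hy, ?_⟩
  have hle : n p ≤ hfin.toFinset.sup n := Finset.le_sup (hfin.mem_toFinset.2 hp)
  rw [← mul_smul, ← Nat.sub_add_cancel hle, pow_add, mul_left_comm, mul_smul, Module.mem_annihilator.1 h, smul_zero]

section top
variable {M : Type} [AddCommGroup M] [Module R M] [Module.Finite R M] {d : ℕ}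

variable [IsLocalRing R] [IsNoetherianRing R]

/-- Every subset of `topPrimes` is realized by some ideal. -/
theorem exists_cofinitePrimes_eq (hM : Module.supportDim R M ≤ d) {T : Set (PrimeSpectrum R)}
    (hT : T ⊆ topPrimes R d M) : ∃ a : Ideal R, cofinitePrimes a d M = T := by
  rcases T.eq_empty_or_nonempty with rfl | ⟨p₀, hp₀⟩
  · refine ⟨⊤, Set.eq_empty_iff_forall_notMem.2 fun p hp => ?_⟩
    have := hp.2
    rw [top_sup_eq, Ideal.radical_top] at this
    exact (maximalIdeal.isMaximal R).ne_top this.symm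
  have hfin : (topPrimes R d M).Finite := finite_topPrimes hM
  have hex : ∀ q ∈ topPrimes R d M \ T, ∃ Q : Ideal R, Q.IsPrime ∧ q.asIdeal ≤ Q ∧
      Module.supportDim R (R ⧸ Q) = (1 : ℕ) ∧ ∃ x ∈ sInf (PrimeSpectrum.asIdeal '' T), x ∉ Q := by
    rintro q ⟨hq, hqT⟩
    obtain ⟨x, hx, hxq⟩ : ∃ x ∈ sInf (PrimeSpectrum.asIdeal '' T), x ∉ q.asIdeal := by
      by_contra! hc
      obtain ⟨_, ⟨p, hp, rfl⟩, hpq⟩ := sInf_le_of_isPrime ((hfin.subset hT).image _) q.2 hc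
      exact hqT (PrimeSpectrum.ext (eq_of_le_of_supportDim_eq (hT hp).2 hq.2 hpq) ▸ hp)
    cases d with
    | zero =>
      refine absurd hp₀ ?_
      rwa [PrimeSpectrum.ext ((eq_maximalIdeal_of_supportDim_eq_zero (hT hp₀).2).trans
        (eq_maximalIdeal_of_supportDim_eq_zero hq.2).symm)]
    | succ d =>
      obtain ⟨Q, hQ, hqQ, hxQ, hQd⟩ := exists_prime_supportDim_eq_one hq.2 hxq
      exact ⟨Q, hQ, hqQ, hQd, x, hx, hxQ⟩
  choose! Q hQ hqQ hQd x hx hxQ using hex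
  have hmem : ∀ p ∈ T, ∀ q ∈ topPrimes R d M \ T, x q ∈ p.asIdeal := fun p hp q hq =>
    Submodule.mem_sInf.1 (hx q hq) _ ⟨p, hp, rfl⟩
  set S : Set (Ideal R) := insert (maximalIdeal R) (Q '' (topPrimes R d M \ T)) with hS
  have hSfin : S.Finite := ((hfin.subset Set.sdiff_subset).image _).insert _
  refine ⟨sInf S, Set.Subset.antisymm ?_ fun p hp => ⟨hT hp, radical_eq_maximalIdeal ?_ fun P hP hle => ?_⟩⟩
  · rintro q ⟨hq, hrad⟩
    by_contra hqT
    have hQq : Q q ∈ S := Set.mem_insert_of_mem _ ⟨q, ⟨hq, hqT⟩, rfl⟩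
    have := hQ q ⟨hq, hqT⟩
    have h := eq_maximalIdeal_of_radical_eq hrad (sup_le (sInf_le hQq) (hqQ q ⟨hq, hqT⟩))
    refine hxQ q ⟨hq, hqT⟩ ?_
    rw [h]
    exact le_maximalIdeal p₀.2.ne_top (hmem p₀ hp₀ q ⟨hq, hqT⟩)
  · exact sup_le (sInf_le (Set.mem_insert _ _)) (le_maximalIdeal p.2.ne_top)
  · obtain ⟨J, hJ, hJP⟩ := sInf_le_of_isPrime hSfin hP (le_sup_left.trans hle)
    rcases hJ with rfl | ⟨q, hq, rfl⟩
    · exact (le_maximalIdeal hP.ne_top).antisymm hJP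
    · have := hQ q hq
      refine eq_maximalIdeal_of_lt_of_supportDim_eq_one (hQd q hq) (lt_of_le_of_ne hJP ?_)
      intro he
      exact hxQ q hq (he ▸ hle (Ideal.mem_sup_right (hmem p hp q hq)))

variable [IsAdicComplete (maximalIdeal R) R]

/-- The top local cohomology only depends on the maximal ideal and the set `cofinitePrimes`. -/
lemma LC.nonempty_equiv_quotient_localKer (hM : Module.supportDim R M ≤ d) {a : Ideal R}
    (hne : (cofinitePrimes a d M).Nonempty) :
    Nonempty (LC a d M ≃ₗ[R] LC (maximalIdeal R) d (M ⧸ localKer (cofinitePrimes a d M) M)) := by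
  set T := cofinitePrimes a d M with hTdef
  set Q := localKer T M
  have hfin : T.Finite := (finite_topPrimes hM).subset fun q hq => hq.1
  obtain ⟨p₀, hp₀⟩ := hne
  have ham : a ≤ maximalIdeal R := le_sup_left.trans (Ideal.le_radical.trans hp₀.2.le)
  have hQ : Subsingleton (LC a d Q) := by
    refine LC.subsingleton_of_forall_radical_ne a Q
      ((Module.supportDim_le_of_injective Q.subtype Subtype.val_injective).trans hM) fun p hp hpd hrad => ?_
    have hpM := Module.support_subset_of_injective Q.subtype Subtype.val_injective hp
    exact notMem_support_localKer (T := T) ⟨⟨hpM, hpd⟩, hrad⟩ hp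
  have e₁ : LC a d M ≃ₗ[R] LC a d (M ⧸ Q) := LinearEquiv.ofBijective (LC.map a d Q.mkQ)
    ⟨LC.map_injective_of_subsingleton a d (SES.of_submodule Q),
      LC.map_surjective_top a hM Q.mkQ_surjective⟩
  have hle : maximalIdeal R ≤ (a ⊔ Module.annihilator R (M ⧸ Q)).radical := by
    rw [Ideal.radical_eq_sInf]
    refine le_sInf fun P hP => ?_
    have hP' := hP.2
    have h1 : sInf (PrimeSpectrum.asIdeal '' T) ≤ P :=
      (sInf_le_radical_annihilator_quotient_localKer hfin fun p hp =>
        mem_minimalPrimes_of_mem_topPrimes hM hp.1).trans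
        (hP'.radical_le_iff.2 (le_sup_right.trans hP.1))
    obtain ⟨_, ⟨p, hp, rfl⟩, hpP⟩ := sInf_le_of_isPrime (hfin.image _) hP' h1
    exact (eq_maximalIdeal_of_radical_eq hp.2 (sup_le (le_sup_left.trans hP.1) hpP)).ge
  obtain ⟨s, hs⟩ := Ideal.exists_pow_le_of_le_radical_of_fg hle (IsNoetherian.noetherian _)
  have htors : IsTors (Module.annihilator R (M ⧸ Q)) (M ⧸ Q) :=
    isTors_of_smul_eq_zero fun r hr x => Module.mem_annihilator.1 hr x
  exact ⟨e₁.trans (LC.compEquiv ham hs d _ htors).symm⟩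

lemma LC.subsingleton_of_cofinitePrimes_eq_empty (hM : Module.supportDim R M ≤ d) {a : Ideal R}
    (h : cofinitePrimes a d M = ∅) : Subsingleton (LC a d M) :=
  LC.subsingleton_of_forall_radical_ne a M hM fun p hp hpd hrad =>
    Set.eq_empty_iff_forall_notMem.1 h p ⟨⟨hp, hpd⟩, hrad⟩

/-- Two top local cohomology modules are isomorphic exactly when they have the same attached primes. -/
theorem LC.nonempty_equiv_iff (hM : Module.supportDim R M ≤ d) {a b : Ideal R} :
    Nonempty (LC a d M ≃ₗ[R] LC b d M) ↔ cofinitePrimes a d M = cofinitePrimes b d M := by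
  constructor
  · have key : ∀ a b : Ideal R, (LC a d M ≃ₗ[R] LC b d M) → cofinitePrimes a d M ⊆ cofinitePrimes b d M := by
      intro a b e p hp
      by_contra hpb
      obtain ⟨x, hx, h⟩ := exists_mem_forall_exists_smul_eq hM hp.1 hpb
      refine not_forall_exists_smul_eq hM hp hx fun z => ?_
      obtain ⟨w, hw⟩ := h (e z)
      exact ⟨e.symm w, by rw [← LinearEquiv.map_smul, hw, e.symm_apply_apply]⟩
    rintro ⟨e⟩
    exact (key a b e).antisymm (key b a e.symm)
  · intro h
    rcases (cofinitePrimes a d M).eq_empty_or_nonempty with h0 | hne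
    · have := LC.subsingleton_of_cofinitePrimes_eq_empty hM h0
      have := LC.subsingleton_of_cofinitePrimes_eq_empty hM (h ▸ h0)
      exact ⟨0, 0, fun _ => Subsingleton.elim _ _, fun _ => Subsingleton.elim _ _⟩
    · obtain ⟨e₁⟩ := LC.nonempty_equiv_quotient_localKer hM hne
      obtain ⟨e₂⟩ := LC.nonempty_equiv_quotient_localKer hM (h ▸ hne)
      rw [← h] at e₂
      exact ⟨e₁.trans e₂.symm⟩

end top

lemma coheight_eq_supportDim (R : Type) [CommRing R] [IsNoetherianRing R] (I : Ideal R) :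
    Paper.coheight R I = Module.supportDim R (R ⧸ I) :=
  Order.krullDim_eq_of_orderIso
    { toFun := fun p => ⟨⟨p.1, p.2.1⟩, mem_support_quotient.2 p.2.2⟩
      invFun := fun p => ⟨p.1.asIdeal, p.1.2, mem_support_quotient.1 p.2⟩
      left_inv := fun _ => rfl
      right_inv := fun _ => rfl
      map_rel_iff' := Iff.rfl }

lemma dimMod_eq_supportDim (R : Type) [CommRing R] [IsNoetherianRing R] (M : Type) [AddCommGroup M] [Module R M]
    [Module.Finite R M] : Paper.dimMod R M = Module.supportDim R M := by
  rw [Paper.dimMod, coheight_eq_supportDim, Module.supportDim_eq_ringKrullDim_quotient_annihilator R M,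
    Module.supportDim_quotient_eq_ringKrullDim]

lemma image_topPrimes_eq_assh (R : Type) [CommRing R] [IsNoetherianRing R] (M : Type) [AddCommGroup M]
    [Module R M] [Module.Finite R M] {d : ℕ} (hdim : Paper.dimMod R M = d) :
    PrimeSpectrum.asIdeal '' topPrimes R d M = Paper.assh R M := by
  ext p
  constructor
  · rintro ⟨p, hp, rfl⟩
    refine ⟨⟨p.2, Module.mem_support_iff_of_finite.1 hp.1⟩, ?_⟩
    rw [coheight_eq_supportDim, hdim, hp.2]
  · rintro ⟨⟨hp, hle⟩, hd⟩
    rw [coheight_eq_supportDim, hdim] at hd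
    exact ⟨⟨p, hp⟩, ⟨Module.mem_support_iff_of_finite.2 hle, hd⟩, rfl⟩

lemma topLCSetoid_iff {R : Type} [CommRing R] [IsNoetherianRing R] {d : ℕ} {M : Type} [AddCommGroup M]
    [Module R M] {a b : Ideal R} :
    Paper.topLCSetoid R d M a b ↔ Nonempty (LC a d M ≃ₗ[R] LC b d M) :=
  ⟨fun ⟨e⟩ => ⟨((Bridge.equiv a d M).symm.trans e).trans (Bridge.equiv b d M)⟩,
    fun ⟨e⟩ => ⟨((Bridge.equiv a d M).trans e).trans (Bridge.equiv b d M).symm⟩⟩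

end LocCoh

/-- Over a complete Noetherian local ring, the number of isomorphism classes of top local
cohomology modules `H^d_a(M)`, as `a` ranges over all ideals, is `2 ^ |Assh M|`. -/
theorem card_iso_classes_top_localCohomology (R : Type) [CommRing R] [IsNoetherianRing R]
    [IsLocalRing R] [IsAdicComplete (IsLocalRing.maximalIdeal R) R]
    (M : Type) [AddCommGroup M] [Module R M] [Module.Finite R M]
    (d : ℕ) (hdim : Paper.dimMod R M = d) :
    Nat.card (Quotient (Paper.topLCSetoid R d M)) = 2 ^ Nat.card (Paper.assh R M) := by
  have hM : Module.supportDim R M ≤ d := (LocCoh.dimMod_eq_supportDim R M).symm.le.trans hdim.le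
  have hiff (a b : Ideal R) : Paper.topLCSetoid R d M a b ↔
      LocCoh.cofinitePrimes a d M = LocCoh.cofinitePrimes b d M :=
    LocCoh.topLCSetoid_iff.trans (LocCoh.LC.nonempty_equiv_iff hM)
  let Φ : Quotient (Paper.topLCSetoid R d M) → 𝒫 (LocCoh.topPrimes R d M) :=
    Quotient.lift (fun a => ⟨LocCoh.cofinitePrimes a d M, fun _ hp => hp.1⟩)
      fun a b h => Subtype.ext ((hiff a b).1 h)
  have hΦ : Function.Bijective Φ := by
    constructor
    · rintro ⟨a⟩ ⟨b⟩ h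
      exact Quotient.sound ((hiff a b).2 (congrArg Subtype.val h))
    · rintro ⟨T, hT⟩
      obtain ⟨a, ha⟩ := LocCoh.exists_cofinitePrimes_eq hM hT
      exact ⟨Quotient.mk _ a, Subtype.ext ha⟩
  rw [Nat.card_congr (Equiv.ofBijective Φ hΦ), Nat.card_coe_set_eq,
    Set.ncard_powerset _ (LocCoh.finite_topPrimes hM), ← LocCoh.image_topPrimes_eq_assh R M hdim,
    Nat.card_coe_set_eq, Set.ncard_image_of_injective _ fun _ _ h => PrimeSpectrum.ext h]
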